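/- Let k be a number field in which −1 is a sum of two squares. Then there exist nonzero a, b ∈ k such that the field k_{a,b} is not Witt equivalent to the field k_{1,1}; in particular there are at least 2 Witt-inequivalent fields of the form k_{a,b} with a, b ∈ kˣ. -/

import Mathlib

open MvPolynomial

noncomputable section

/-- The defining polynomial `a·x² + b·y² − 1` of the affine conic. -/
def conicPoly (k : Type*) [Field k] (a b : k) : MvPolynomial (Fin 2) k :=
  C a * X 0 ^ 2 + C b * X 1 ^ 2 - 1

/-- The coordinate ring `k[x,y]/(a·x² + b·y² − 1)` of the affine conic. -/
abbrev ConicRing (k : Type*) [Field k] (a b : k) : Type _ :=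
  MvPolynomial (Fin 2) k ⧸ Ideal.span {conicPoly k a b}

/-- `K` (together with the embedding `ι : k →+* K`) is a model of the function field
`k_{a,b}`, i.e. the quotient field of `k[x,y]/(a·x² + b·y² − 1)`. -/
def IsConicFunctionField (k : Type*) [Field k] (a b : k)
    (K : Type*) [Field K] (ι : k →+* K) : Prop :=
  ∃ f : ConicRing k a b →+* K,
    Function.Injective f ∧
    f.comp (algebraMap k (ConicRing k a b)) = ι ∧
    ∀ z : K, ∃ p q : ConicRing k a b, f q ≠ 0 ∧ z = f p / f q

/-- The subgroup of squares in `Kˣ`. -/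
def sqSubgroup (K : Type*) [Field K] : Subgroup Kˣ :=
  MonoidHom.range (powMonoidHom 2 : Kˣ →* Kˣ)

/-- The square class group `Kˣ/Kˣ²`. -/
abbrev SqClass (K : Type*) [Field K] := Kˣ ⧸ sqSubgroup K

/-- The square class of a unit. -/
def sqCl {K : Type*} [Field K] (u : Kˣ) : SqClass K := QuotientGroup.mk u

/-- `α : Kˣ/Kˣ² → Lˣ/Lˣ²` is a Witt equivalence: it sends `-1` to `-1` and preserves
binary value sets. -/
structure IsWittEquiv {K L : Type*} [Field K] [Field L]
    (α : SqClass K ≃* SqClass L) : Prop where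
  map_neg_one : α (sqCl (-1)) = sqCl (-1)
  represents : ∀ (a b c : Kˣ) (a' b' c' : Lˣ),
    α (sqCl a) = sqCl a' → α (sqCl b) = sqCl b' → α (sqCl c) = sqCl c' →
    ((∃ x y : K, (c : K) = (a : K) * x ^ 2 + (b : K) * y ^ 2) ↔
      (∃ x y : L, (c' : L) = (a' : L) * x ^ 2 + (b' : L) * y ^ 2))

/-- Two fields are Witt equivalent if there is a Witt equivalence between them. -/
def WittEquivalent (K L : Type*) [Field K] [Field L] : Prop :=
  ∃ α : SqClass K ≃* SqClass L, IsWittEquiv α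

/-- An ordering of a field `F`. -/
structure IsOrdering {F : Type*} [Field F] (P : Set F) : Prop where
  add_mem : ∀ x ∈ P, ∀ y ∈ P, x + y ∈ P
  mul_mem : ∀ x ∈ P, ∀ y ∈ P, x * y ∈ P
  total : ∀ x : F, x ∈ P ∨ -x ∈ P
  antisymm : ∀ x : F, x ∈ P → -x ∈ P → x = 0

universe u

/-- The function fields `k_{a,b}` and `k_{c,d}` are *not* Witt equivalent:
no model of `k_{a,b}` is Witt equivalent to a model of `k_{c,d}`. -/
def ConicNotWittEquivalent (k : Type u) [Field k] (a b c d : k) : Prop :=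
  ∀ (K L : Type u) [Field K] [Field L] (ι : k →+* K) (ι' : k →+* L),
    IsConicFunctionField k a b K ι → IsConicFunctionField k c d L ι' →
    ¬ WittEquivalent K L

/-- A subgroup of `Eˣ` containing all nonzero squares, as a subset of `E`. -/
structure SqGroup (E : Type*) [Field E] where
  carrier : Set E
  zero_notMem : (0 : E) ∉ carrier
  sq_mem : ∀ x : E, x ≠ 0 → x ^ 2 ∈ carrier
  mul_mem : ∀ x ∈ carrier, ∀ y ∈ carrier, x * y ∈ carrier

namespace SqGroup

variable {E : Type*} [Field E]

instance : Membership E (SqGroup E) := ⟨fun T x => x ∈ T.carrier⟩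

variable (T H : SqGroup E)

theorem ne_zero {T : SqGroup E} {x : E} (h : x ∈ T) : x ≠ 0 := fun h0 =>
  T.zero_notMem (h0 ▸ h)

theorem mul {T : SqGroup E} {x y : E} (hx : x ∈ T) (hy : y ∈ T) : x * y ∈ T :=
  T.mul_mem x hx y hy

theorem sq {x : E} (hx : x ≠ 0) : x ^ 2 ∈ T := T.sq_mem x hx

theorem one : (1 : E) ∈ T := by simpa using T.sq (one_ne_zero (α := E))

theorem mul_sq_iff {T : SqGroup E} {x y : E} (hy : y ≠ 0) : x * y ^ 2 ∈ T ↔ x ∈ T := by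
  constructor
  · intro h
    have := mul h (T.sq (inv_ne_zero hy))
    have e : x * y ^ 2 * y⁻¹ ^ 2 = x := by field_simp
    rwa [e] at this
  · exact fun h => mul h (T.sq hy)

/-- Membership only depends on the class modulo squares. -/
theorem congr_sq {T : SqGroup E} {x y z : E} (hz : z ≠ 0) (h : y = x * z ^ 2) :
    y ∈ T ↔ x ∈ T := by rw [h, mul_sq_iff hz]

theorem inv_iff {T : SqGroup E} {x : E} : x⁻¹ ∈ T ↔ x ∈ T := by
  by_cases hx : x = 0
  · simp [hx]
  · exact congr_sq (inv_ne_zero hx) (by field_simp)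

theorem mul_iff {T : SqGroup E} {x y : E} (hx : x ∈ T) : x * y ∈ T ↔ y ∈ T := by
  constructor
  · intro h
    exact (congr_sq (ne_zero hx) (by ring)).1 (mul hx h)
  · exact mul hx

theorem mul_iff' {T : SqGroup E} {x y : E} (hx : x ∈ T) : y * x ∈ T ↔ y ∈ T := by
  rw [mul_comm, mul_iff hx]

end SqGroup

/-- Every `x` outside `H` is `T`-rigid. -/
def RigidOutside {E : Type*} [Field E] (T H : SqGroup E) : Prop :=
  ∀ x : E, x ≠ 0 → x ∉ H → ∀ s ∈ T, ∀ t ∈ T, s + x * t ∈ T ∨ (s + x * t) * x ∈ T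

namespace RigidConstruction

open SqGroup

variable {E : Type*} [Field E] {T H : SqGroup E}

/-- The elements of positive value outside `H`. -/
def Small (T H : SqGroup E) (x : E) : Prop := x ≠ 0 ∧ x ∉ H ∧ 1 - x ∈ T

/-- The elements of nonnegative value in `H`. -/
def Mult (T H : SqGroup E) (x : E) : Prop := x ∈ H ∧ ∀ y, Small T H y → Small T H (x * y)

/-- Nonzero elements of the valuation ring. -/
def Int (T H : SqGroup E) (x : E) : Prop := Small T H x ∨ Mult T H x

structure Data (T H : SqGroup E) where
  le : ∀ x, x ∈ T → x ∈ H
  neg_one : (-1 : E) ∈ T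
  rigid : RigidOutside T H
  a : E
  b : E
  ha : a ∈ H
  hb : b ∈ H
  hab : a + b = 1
  ha' : a ∉ T
  hb' : b ∉ T
  hab' : a * b ∉ T

/-- if `c ∈ T ∪ xT` and `c ∈ T ∪ yT` with `xT ≠ yT` then `c ∈ T` -/
theorem mem_of_two {c x y : E} (h1 : c ∈ T ∨ c * x ∈ T)
    (h2 : c ∈ T ∨ c * y ∈ T) (hxy : x * y ∉ T) : c ∈ T := by
  rcases h1 with h1 | h1
  · exact h1
  rcases h2 with h2 | h2
  · exact h2
  exact absurd ((congr_sq (z := c) (by rintro rfl; simp at h1; exact T.zero_notMem h1)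
    (by ring)).1 (mul h1 h2)) hxy

theorem neg_iff (D : Data T H) {x : E} : -x ∈ T ↔ x ∈ T := by
  have := mul_iff (y := x) D.neg_one
  simpa using this

theorem negH_iff (D : Data T H) {x : E} : -x ∈ H ↔ x ∈ H := by
  have := mul_iff (y := x) (D.le _ D.neg_one)
  simpa using this

theorem sub_rigid (D : Data T H) {s x : E} (hx0 : x ≠ 0) (hx : x ∉ H) (hs : s ∈ T) {t : E} (ht : t ∈ T) :
    s - x * t ∈ T ∨ (s - x * t) * x ∈ T := by
  have := D.rigid x hx0 hx s hs (-t) ((neg_iff D).2 ht)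
  simpa [sub_eq_add_neg] using this

theorem sub_rigid' (D : Data T H) {s x : E} (hx0 : x ≠ 0) (hx : x ∉ H) (hs : s ∈ T) :
    s - x ∈ T ∨ (s - x) * x ∈ T := by
  simpa using sub_rigid D hx0 hx hs T.one

theorem small_or_inv (D : Data T H) {x : E} (hx0 : x ≠ 0) (hx : x ∉ H) : Small T H x ∨ Small T H x⁻¹ := by
  rcases sub_rigid' D hx0 hx T.one with h | h
  · exact Or.inl ⟨hx0, hx, h⟩
  · refine Or.inr ⟨inv_ne_zero hx0, fun h' => hx (inv_iff.1 h'), ?_⟩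
    rw [← neg_iff D]
    refine (congr_sq (x := (1 - x) * x) (inv_ne_zero hx0) ?_).2 h
    field_simp
    ring

theorem not_small_inv (D : Data T H) {x : E} (h : Small T H x) : ¬ Small T H x⁻¹ := by
  rintro ⟨-, -, h'⟩
  obtain ⟨h0, h1, h2⟩ := h
  apply h1
  apply D.le
  have := mul ((neg_iff D).2 h') h2
  rw [← mul_iff' (neg_iff D |>.2 h'), ← mul_iff' h2]
  refine (congr_sq (x := 1) (z := 1 - x) (ne_zero h2) ?_).2 T.one
  field_simp
  ring

theorem sub_mul_of_ne (D : Data T H) {x y : E} (hx : Small T H x) (hy : Small T H y) (hxy : x * y ∉ T) :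
    1 - x * y ∈ T := by
  have e1 : 1 - x * y = (1 - x) + x * (1 - y) := by ring
  have e2 : 1 - x * y = (1 - y) + y * (1 - x) := by ring
  refine mem_of_two ?_ ?_ hxy
  · rw [e1]; exact D.rigid x hx.1 hx.2.1 _ hx.2.2 _ hy.2.2
  · rw [e2]; exact D.rigid y hy.1 hy.2.1 _ hy.2.2 _ hx.2.2

theorem sub_sub_of_ne (D : Data T H) {x y : E} (hx : Small T H x) (hy : Small T H y) (hxy : x * y ∉ T) :
    1 - x - y ∈ T := by
  refine mem_of_two ?_ ?_ hxy
  · have e : 1 - x - y = (1 - y) - x := by ring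
    rw [e]; exact sub_rigid' D hx.1 hx.2.1 hy.2.2
  · exact sub_rigid' D hy.1 hy.2.1 hx.2.2

theorem small_mul_a (D : Data T H) {x : E} (hx : Small T H x) : Small T H (x * D.a) := by
  have hxa : x * D.a ∉ H := fun h => hx.2.1 ((mul_iff' D.ha).1 h)
  have hxb : x * D.b ∉ H := fun h => hx.2.1 ((mul_iff' D.hb).1 h)
  have ha0 := ne_zero D.ha
  have hb0 := ne_zero D.hb
  refine ⟨mul_ne_zero hx.1 ha0, hxa, ?_⟩
  refine mem_of_two (y := x * D.b) (sub_rigid' D (mul_ne_zero hx.1 ha0) hxa T.one) ?_ ?_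
  · have e : 1 - x * D.a = (1 - x) + x * D.b * 1 := by
      linear_combination (-x) * D.hab
    rw [e]; exact D.rigid _ (mul_ne_zero hx.1 hb0) hxb _ hx.2.2 _ T.one
  · intro h
    exact D.hab' ((congr_sq hx.1 (by ring)).1 h)

theorem sub_sub (D : Data T H) {x y : E} (hx : Small T H x) (hy : Small T H y) : 1 - x - y ∈ T := by
  by_cases hxy : x * y ∈ T
  · have hya := small_mul_a D hy
    have hb0 := ne_zero D.hb
    have hyb : y * D.b ∉ H := fun h => hy.2.1 ((mul_iff' D.hb).1 h)
    have h1 : 1 - x - y * D.a ∈ T := by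
      refine sub_sub_of_ne D hx hya ?_
      rw [← mul_assoc, mul_iff hxy]
      exact D.ha'
    have e : 1 - x - y = (1 - x - y * D.a) - y * D.b := by linear_combination (y) * D.hab
    refine mem_of_two (x := y * D.b) ?_ (sub_rigid' D hy.1 hy.2.1 hx.2.2) ?_
    · rw [e]; exact sub_rigid' D (mul_ne_zero hy.1 hb0) hyb h1
    · intro h
      exact D.hb' ((congr_sq hy.1 (by ring)).1 h)
  · exact sub_sub_of_ne D hx hy hxy

theorem sub_mul (D : Data T H) {x y : E} (hx : Small T H x) (hy : Small T H y) : 1 - x * y ∈ T := by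
  by_cases hxy : x * y ∈ T
  · have e1 : 1 - x * y = (1 - x) + x * (1 - y) := by ring
    have h := D.rigid x hx.1 hx.2.1 _ hx.2.2 _ hy.2.2
    rw [← e1] at h
    rcases h with h | h
    · exact h
    exfalso
    have hX : Small T H (1 - x * y) := by
      refine ⟨fun h0 => ?_, fun h' => hx.2.1 ((mul_iff h').1 (D.le _ h)), ?_⟩
      · rw [h0] at h; simp at h; exact T.zero_notMem h
      · simpa using hxy
    have h2 := sub_sub D hx hX
    have e : 1 - x - (1 - x * y) = -(x * (1 - y)) := by ring
    rw [e, neg_iff D, mul_iff' hy.2.2] at h2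
    exact hx.2.1 (D.le _ h2)
  · exact sub_mul_of_ne D hx hy hxy

theorem sub_mul_mul (D : Data T H) {x y z : E} (hx : Small T H x) (hy : Small T H y) (hz : Small T H z)
    (h : x * y * z ∉ H) : 1 - x * y * z ∈ T := by
  have key : ∀ {x y z : E}, Small T H x → Small T H y → Small T H z →
      x * y * z ∉ H → x * y ∉ T → 1 - x * y * z ∈ T := by
    intro x y z hx hy hz h hxy
    refine mem_of_two ?_ ?_ hxy
    · have e : 1 - x * y * z = (1 - x) + x * (1 - y * z) := by ring
      rw [e]; exact D.rigid x hx.1 hx.2.1 _ hx.2.2 _ (sub_mul D hy hz)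
    · have e : 1 - x * y * z = (1 - y) + y * (1 - x * z) := by ring
      rw [e]; exact D.rigid y hy.1 hy.2.1 _ hy.2.2 _ (sub_mul D hx hz)
  by_cases hxy : x * y ∈ T
  · have hxa := small_mul_a D hx
    let D' : Data T H := { D with a := D.b, b := D.a, ha := D.hb, hb := D.ha,
                                  hab := by rw [add_comm, D.hab], ha' := D.hb', hb' := D.ha',
                                  hab' := by rw [mul_comm]; exact D.hab' }
    have hxb : Small T H (x * D.b) := small_mul_a D' hx
    have h1 : 1 - x * D.a * y * z ∈ T := by
      refine key hxa hy hz ?_ ?_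
      · intro h'; apply h; rw [← mul_iff' D.ha]; convert h' using 1; ring
      · intro h'; apply D.ha'; rw [← mul_iff hxy]; convert h' using 1; ring
    have h2 : 1 - x * D.b * y * z ∈ T := by
      refine key hxb hy hz ?_ ?_
      · intro h'; apply h; rw [← mul_iff' D.hb]; convert h' using 1; ring
      · intro h'; apply D.hb'; rw [← mul_iff hxy]; convert h' using 1; ring
    have s1 : Small T H (x * D.a * y * z) := by
      refine ⟨mul_ne_zero (mul_ne_zero hxa.1 hy.1) hz.1, ?_, h1⟩
      intro h'; apply h; rw [← mul_iff' D.ha]; convert h' using 1; ring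
    have s2 : Small T H (x * D.b * y * z) := by
      refine ⟨mul_ne_zero (mul_ne_zero hxb.1 hy.1) hz.1, ?_, h2⟩
      intro h'; apply h; rw [← mul_iff' D.hb]; convert h' using 1; ring
    have := sub_sub D s1 s2
    convert this using 1
    linear_combination (x * y * z) * D.hab
  · exact key hx hy hz h hxy

theorem int_mul (D : Data T H) {x y : E} (hx : Int T H x) (hy : Int T H y) : Int T H (x * y) := by
  rcases hx with hx | hx <;> rcases hy with hy | hy
  · by_cases h : x * y ∈ H
    · refine Or.inr ⟨h, fun z hz => ?_⟩
      have hn : x * y * z ∉ H := fun h' => hz.2.1 ((mul_iff h).1 h')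
      exact ⟨mul_ne_zero (mul_ne_zero hx.1 hy.1) hz.1, hn, sub_mul_mul D hx hy hz hn⟩
    · exact Or.inl ⟨mul_ne_zero hx.1 hy.1, h, sub_mul D hx hy⟩
  · rw [mul_comm]; exact Or.inl (hy.2 x hx)
  · exact Or.inl (hx.2 y hy)
  · refine Or.inr ⟨mul hx.1 hy.1, fun z hz => ?_⟩
    rw [mul_assoc]; exact hx.2 _ (hy.2 z hz)

theorem int_or_inv (D : Data T H) {x : E} (hx0 : x ≠ 0) : Int T H x ∨ Int T H x⁻¹ := by
  by_cases hx : x ∈ H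
  · by_cases hm : Mult T H x
    · exact Or.inl (Or.inr hm)
    · right; right
      have : ∃ y, Small T H y ∧ ¬ Small T H (x * y) := by
        by_contra hc
        push Not at hc
        exact hm ⟨hx, hc⟩
      obtain ⟨y, hy, hxy⟩ := this
      have hxyH : x * y ∉ H := fun h' => hy.2.1 ((mul_iff hx).1 h')
      have hs := (small_or_inv D (mul_ne_zero hx0 hy.1) hxyH).resolve_left hxy
      refine ⟨inv_iff.2 hx, fun z hz => ?_⟩
      have e : x⁻¹ * z = (x * y)⁻¹ * y * z := by
        have := hy.1
        field_simp
      have hn : x⁻¹ * z ∉ H := fun h' => hz.2.1 ((mul_iff (inv_iff.2 hx)).1 h')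
      refine ⟨mul_ne_zero (inv_ne_zero hx0) hz.1, hn, ?_⟩
      rw [e] at hn ⊢
      exact sub_mul_mul D hs hy hz hn
  · exact (small_or_inv D hx0 hx).imp Or.inl Or.inl

theorem small_neg (D : Data T H) {y : E} (hy : Small T H y) : Small T H (-y) := by
  have hn : -y ∉ H := fun h => hy.2.1 ((negH_iff D).1 h)
  refine ((small_or_inv D (neg_ne_zero.2 hy.1) hn)).resolve_right fun h => ?_
  have e : y * y * (-y)⁻¹ = -y := by
    have := hy.1
    field_simp
  have h1 := sub_mul_mul D hy hy h (by rwa [e])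
  rw [e] at h1
  exact not_small_inv D (x := -y) ⟨neg_ne_zero.2 hy.1, hn, h1⟩ h

theorem mult_neg_one (D : Data T H) : Mult T H (-1 : E) :=
  ⟨D.le _ D.neg_one, fun y hy => by simpa using small_neg D hy⟩

theorem int_one_sub (D : Data T H) {x : E} (hx : Int T H x) : x = 1 ∨ Int T H (1 - x) := by
  rcases hx with hx | hx
  · right; right
    refine ⟨D.le _ hx.2.2, fun y hy => ?_⟩
    have hn : (1 - x) * y ∉ H := fun h => hy.2.1 ((mul_iff (D.le _ hx.2.2)).1 h)
    have h0 : (1 - x) * y ≠ 0 := mul_ne_zero (ne_zero hx.2.2) hy.1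
    refine (small_or_inv D h0 hn).resolve_right fun h => ?_
    have h1 := sub_mul D hy h
    have h2 := ne_zero hx.2.2
    have e : 1 - y * ((1 - x) * y)⁻¹ = -x * (1 - x) * ((1 - x)⁻¹) ^ 2 := by
      have := hy.1
      field_simp
      ring
    rw [e, mul_sq_iff (inv_ne_zero h2), mul_iff' hx.2.2, neg_iff D] at h1
    exact hx.2.1 (D.le _ h1)
  · by_cases h1 : x = 1
    · exact Or.inl h1
    right
    have h0 : 1 - x ≠ 0 := sub_ne_zero.2 (Ne.symm h1)
    by_cases hH : 1 - x ∈ H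
    · right
      refine ⟨hH, fun y hy => ?_⟩
      refine ⟨mul_ne_zero h0 hy.1, fun h => hy.2.1 ((mul_iff hH).1 h), ?_⟩
      have := sub_sub D hy (small_neg D (hx.2 y hy))
      convert this using 1
      ring
    · left
      refine (small_or_inv D h0 hH).resolve_right fun h => ?_
      have h2 := sub_sub D h (small_neg D (hx.2 _ h))
      apply T.zero_notMem
      change (0:E) ∈ T
      convert h2 using 1
      field_simp
      ring

theorem int_add (D : Data T H) {x y : E} (hx : Int T H x) (hy : Int T H y) (h : x + y ≠ 0) :
    Int T H (x + y) := by
  have nz : ∀ {z : E}, Int T H z → z ≠ 0 := fun {z} hz => by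
    rcases hz with hz | hz
    · exact hz.1
    · exact ne_zero hz.1
  have key : ∀ {x y : E}, Int T H x → Int T H y → x + y ≠ 0 → Int T H (y / x) →
      Int T H (x + y) := by
    intro x y hx hy h hyx
    have hx0 := nz hx
    have h1 : Int T H (-1 * (y / x)) := int_mul D (Or.inr (mult_neg_one D)) hyx
    have e : x + y = x * (1 - -1 * (y / x)) := by field_simp; ring
    rw [e] at h ⊢
    refine int_mul D hx ((int_one_sub D h1).resolve_left fun h' => ?_)
    rw [h'] at h; simp at h
  rcases int_or_inv D (div_ne_zero (nz hy) (nz hx)) with h' | h'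
  · exact key hx hy h h'
  · rw [add_comm] at h ⊢
    rw [inv_div] at h'
    exact key hy hx h h'

/-- The valuation ring attached to a rigid pair. -/
def ring (D : Data T H) : ValuationSubring E where
  carrier := {x | x = 0 ∨ Int T H x}
  mul_mem' := by
    rintro x y (rfl | hx) (rfl | hy)
    · left; simp
    · left; simp
    · left; simp
    · exact Or.inr (int_mul D hx hy)
  one_mem' := Or.inr (Or.inr ⟨H.one, fun y hy => by simpa using hy⟩)
  add_mem' := by
    rintro x y (rfl | hx) (rfl | hy)
    · left; simp
    · right; simpa using hy
    · right; simpa using hx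
    · by_cases h : x + y = 0
      · exact Or.inl h
      · exact Or.inr (int_add D hx hy h)
  zero_mem' := Or.inl rfl
  neg_mem' := by
    rintro x (rfl | hx)
    · left; simp
    · right
      have := int_mul D (Or.inr (mult_neg_one D)) hx
      simpa using this
  mem_or_inv_mem' := by
    intro x
    by_cases hx : x = 0
    · exact Or.inl (Or.inl hx)
    · exact (int_or_inv D hx).imp Or.inr Or.inr

theorem not_small_of_unit (D : Data T H) {x : E} (h : x⁻¹ ∈ ring D) : ¬ Small T H x := by
  intro hx
  rcases h with h | h | h
  · exact hx.1 (inv_eq_zero.1 h)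
  · exact not_small_inv D hx h
  · exact hx.2.1 (inv_iff.1 h.1)

theorem unit_mem (D : Data T H) {x : E} (h1 : x ∈ ring D) (h2 : x⁻¹ ∈ ring D) (h0 : x ≠ 0) : x ∈ H := by
  rcases h1 with h | h | h
  · exact absurd h h0
  · exact absurd h (not_small_of_unit D h2)
  · exact h.1

/-- nonunits are outside `H` or products of two nonunits outside `H` -/
theorem nonunit_factor (D : Data T H) {x : E} (h0 : x ≠ 0) (h1 : x ∈ ring D) (h2 : x⁻¹ ∉ ring D) :
    Small T H x ∨ ∃ y z, Small T H y ∧ Small T H z ∧ x = y * z := by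
  rcases h1 with h | h | h
  · exact absurd h h0
  · exact Or.inl h
  · right
    have : ¬ Mult T H x⁻¹ := fun h' => h2 (Or.inr (Or.inr h'))
    have : ∃ y, Small T H y ∧ ¬ Small T H (x⁻¹ * y) := by
      by_contra hc
      push Not at hc
      exact this ⟨inv_iff.2 h.1, hc⟩
    obtain ⟨y, hy, hxy⟩ := this
    have hn : x⁻¹ * y ∉ H := fun h' => hy.2.1 ((mul_iff (inv_iff.2 h.1)).1 h')
    have hs := (small_or_inv D (mul_ne_zero (inv_ne_zero h0) hy.1) hn).resolve_left hxy
    refine ⟨y, _, hy, hs, ?_⟩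
    have := hy.1
    field_simp

theorem small_nonunit (D : Data T H) {x : E} (h : Small T H x) : x ∈ ring D ∧ x⁻¹ ∉ ring D :=
  ⟨Or.inr (Or.inl h), fun h' => not_small_of_unit D h' h⟩

end RigidConstruction

namespace SqGroup

variable {E : Type*} [Field E]

/-- The group generated by `T` and `-1`. -/
def pm (T : SqGroup E) : SqGroup E where
  carrier := {x | x ∈ T ∨ -x ∈ T}
  zero_notMem := by
    rintro (h | h)
    · exact T.zero_notMem h
    · rw [neg_zero] at h; exact T.zero_notMem h
  sq_mem := fun x hx => Or.inl (T.sq hx)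
  mul_mem := by
    rintro x (hx | hx) y (hy | hy)
    · exact Or.inl (mul hx hy)
    · right; simpa using mul hx hy
    · right; simpa using mul hx hy
    · left; simpa using mul hx hy

theorem mem_pm {T : SqGroup E} {x : E} : x ∈ T.pm ↔ x ∈ T ∨ -x ∈ T := Iff.rfl

end SqGroup

open SqGroup

section Val

variable {E : Type*} [Field E]

/-- Neither `a`, `b` nor `a * b` is in `T` up to sign. -/
structure IndepPair (T : SqGroup E) (a b : E) : Prop where
  sum : a + b = 1
  left : a ∉ T.pm
  right : b ∉ T.pm
  prod : a * b ∉ T.pm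

theorem val_lt_one_of_inv_notMem {O : ValuationSubring E} {x : E}
    (h : x⁻¹ ∉ O) : O.valuation x < 1 := by
  by_contra hc
  exact h ((O.valuation_le_one_iff _).1 (by
    rw [map_inv₀]; exact inv_le_one_of_one_le₀ (not_lt.1 hc)))

theorem inv_notMem_of_val_lt_one {O : ValuationSubring E} {x : E} (hx : x ≠ 0)
    (h : O.valuation x < 1) : x⁻¹ ∉ O := by
  rw [← O.valuation_le_one_iff, map_inv₀, not_le]
  exact (one_lt_inv₀ (zero_lt_iff.2 ((map_ne_zero _).2 hx))).2 h

/-- The rigidity theorem of Arason, Elman and Jacob. -/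
theorem exists_valuationSubring_of_rigidOutside {T H : SqGroup E} (hle : ∀ x, x ∈ T → x ∈ H)
    (hneg : (-1 : E) ∈ H) (hr : RigidOutside T H) {a b : E} (ha : a ∈ H) (hb : b ∈ H)
    (hab : IndepPair T a b) (hH : ∃ x, x ≠ 0 ∧ x ∉ H) :
    ∃ O : ValuationSubring E, O ≠ ⊤ ∧ (∀ x, O.valuation x < 1 → 1 + x ∈ T) ∧
      (∀ x, O.valuation x = 1 → x ∈ H) := by
  have hnegH : ∀ x, -x ∈ H ↔ x ∈ H := fun x => by simpa using mul_iff (y := x) hneg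
  let D : RigidConstruction.Data T.pm H :=
    { le := by
        rintro x (h | h)
        · exact hle _ h
        · exact (hnegH x).1 (hle _ h)
      neg_one := Or.inr (by simpa using T.one)
      rigid := by
        intro x hx0 hx s hs t ht
        have hx' : -x ∉ H := fun h => hx ((hnegH x).1 h)
        rcases hs with hs | hs <;> rcases ht with ht | ht
        · rcases hr x hx0 hx s hs t ht with h | h
          · exact Or.inl (Or.inl h)
          · exact Or.inr (Or.inl h)
        · rcases hr (-x) (neg_ne_zero.2 hx0) hx' s hs (-t) ht with h | h
          · left; left; convert h using 1; ring
          · right; right; convert h using 1; ring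
        · rcases hr (-x) (neg_ne_zero.2 hx0) hx' (-s) hs t ht with h | h
          · left; right; convert h using 1; ring
          · right; left; convert h using 1; ring
        · rcases hr x hx0 hx (-s) hs (-t) ht with h | h
          · left; right; convert h using 1; ring
          · right; right; convert h using 1; ring
      a := a
      b := b
      ha := ha
      hb := hb
      hab := hab.sum
      ha' := hab.left
      hb' := hab.right
      hab' := hab.prod }
  refine ⟨RigidConstruction.ring D, ?_, ?_, ?_⟩
  · obtain ⟨x, hx0, hx⟩ := hH
    intro htop
    rcases RigidConstruction.small_or_inv D hx0 hx with h | h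
    · exact (RigidConstruction.small_nonunit D h).2 (by rw [htop]; trivial)
    · exact (RigidConstruction.small_nonunit D h).2 (by rw [htop]; trivial)
  · set O := RigidConstruction.ring D with hO
    have hu : ∀ x, O.valuation x = 1 → x ∈ H := by
      intro x hx
      refine RigidConstruction.unit_mem D ?_ ?_ ?_
      · exact (O.valuation_le_one_iff _).1 hx.le
      · exact (O.valuation_le_one_iff _).1 (by rw [map_inv₀, hx, inv_one])
      · rintro rfl; simp at hx
    have key : ∀ z y, z ≠ 0 → z ∉ H → y ∈ T ∨ y * z ∈ T → O.valuation y = 1 → y ∈ T := by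
      intro z y hz0 hz hy hy1
      rcases hy with hy | hy
      · exact hy
      · exact absurd ((mul_iff (hu y hy1)).1 (hle _ hy)) hz
    have one : ∀ z, z ≠ 0 → z ∉ H → O.valuation z < 1 → 1 + z ∈ T := by
      intro z hz0 hz hz1
      refine key z _ hz0 hz ?_ (Valuation.map_one_add_of_lt _ hz1)
      simpa using hr z hz0 hz 1 T.one 1 T.one
    have hsmall : ∀ x, RigidConstruction.Small T.pm H x → O.valuation x < 1 := by
      intro x hx
      exact val_lt_one_of_inv_notMem (RigidConstruction.small_nonunit D hx).2
    intro x hx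
    by_cases hx0 : x = 0
    · rw [hx0, add_zero]; exact T.one
    by_cases hxH : x ∈ H
    · have hnx : O.valuation (-x) < 1 := by rwa [Valuation.map_neg]
      rcases RigidConstruction.nonunit_factor D (x := -x) (neg_ne_zero.2 hx0)
        ((O.valuation_le_one_iff _).1 hnx.le)
        (inv_notMem_of_val_lt_one (neg_ne_zero.2 hx0) hnx) with h | ⟨y, z, hy, hz, e⟩
      · exact absurd ((hnegH x).2 hxH) h.2.1
      · have e1 : 1 + x = (1 + (-y)) + y * (1 + (-z)) := by linear_combination (-1) * e
        refine key y _ hy.1 hy.2.1 ?_ (Valuation.map_one_add_of_lt _ hx)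
        rw [e1]
        refine hr y hy.1 hy.2.1 _ ?_ _ ?_
        · exact one _ (neg_ne_zero.2 hy.1) (fun h => hy.2.1 ((hnegH y).1 h))
            (by rw [Valuation.map_neg]; exact hsmall y hy)
        · exact one _ (neg_ne_zero.2 hz.1) (fun h => hz.2.1 ((hnegH z).1 h))
            (by rw [Valuation.map_neg]; exact hsmall z hz)
    · exact one x hx0 hxH hx
  · intro x hx
    refine RigidConstruction.unit_mem D ?_ ?_ ?_
    · exact (ValuationSubring.valuation_le_one_iff _ _).1 hx.le
    · exact (ValuationSubring.valuation_le_one_iff _ _).1 (by rw [map_inv₀, hx, inv_one])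
    · rintro rfl; simp at hx

/-- The group `(1 + m) Kˣ²` of a valuation ring. -/
def oneUnits (O : ValuationSubring E) : SqGroup E where
  carrier := {x | ∃ y, y ≠ 0 ∧ O.valuation (x * y ^ 2 - 1) < 1}
  zero_notMem := by
    rintro ⟨y, -, h⟩
    simp at h
  sq_mem := fun x hx => ⟨x⁻¹, inv_ne_zero hx, by
    have : x ^ 2 * x⁻¹ ^ 2 - 1 = 0 := by field_simp; simp
    rw [this]; simp⟩
  mul_mem := by
    rintro x ⟨y, hy, hxy⟩ z ⟨w, hw, hzw⟩
    refine ⟨y * w, mul_ne_zero hy hw, ?_⟩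
    have e : x * z * (y * w) ^ 2 - 1 =
      (x * y ^ 2 - 1) * (z * w ^ 2 - 1) + (x * y ^ 2 - 1) + (z * w ^ 2 - 1) := by ring
    rw [e]
    refine Valuation.map_add_lt _ (Valuation.map_add_lt _ ?_ hxy) hzw
    rw [map_mul]
    exact mul_lt_one_of_nonneg_of_lt_one_left zero_le hxy hzw.le

/-- The group `Oˣ Kˣ²` of a valuation ring. -/
def unitsSq (O : ValuationSubring E) : SqGroup E where
  carrier := {x | ∃ y, y ≠ 0 ∧ O.valuation (x * y ^ 2) = 1}
  zero_notMem := by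
    rintro ⟨y, -, h⟩
    simp at h
  sq_mem := fun x hx => ⟨x⁻¹, inv_ne_zero hx, by
    have : x ^ 2 * x⁻¹ ^ 2 = 1 := by field_simp
    rw [this, map_one]⟩
  mul_mem := by
    rintro x ⟨y, hy, hxy⟩ z ⟨w, hw, hzw⟩
    refine ⟨y * w, mul_ne_zero hy hw, ?_⟩
    have e : x * z * (y * w) ^ 2 = (x * y ^ 2) * (z * w ^ 2) := by ring
    rw [e, map_mul, hxy, hzw, one_mul]

theorem val_eq_one_of_sub {O : ValuationSubring E} {x : E} (h : O.valuation (x - 1) < 1) :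
    O.valuation x = 1 := by
  have := Valuation.map_one_add_of_lt _ h
  simpa using this

theorem mem_oneUnits {O : ValuationSubring E} {x : E} :
    x ∈ oneUnits O ↔ ∃ y, y ≠ 0 ∧ O.valuation (x * y ^ 2 - 1) < 1 := Iff.rfl

theorem mem_unitsSq {O : ValuationSubring E} {x : E} :
    x ∈ unitsSq O ↔ ∃ y, y ≠ 0 ∧ O.valuation (x * y ^ 2) = 1 := Iff.rfl

theorem oneUnits_le {O : ValuationSubring E} {x : E} (h : x ∈ oneUnits O) : x ∈ unitsSq O := by
  obtain ⟨y, hy, h⟩ := h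
  exact ⟨y, hy, val_eq_one_of_sub h⟩

theorem one_add_mem_oneUnits {O : ValuationSubring E} {x : E} (h : O.valuation x < 1) :
    1 + x ∈ oneUnits O := ⟨1, one_ne_zero, by simpa using h⟩

theorem unit_mem_unitsSq {O : ValuationSubring E} {x : E} (h : O.valuation x = 1) :
    x ∈ unitsSq O := ⟨1, one_ne_zero, by simpa using h⟩

theorem oneUnits_subset {O : ValuationSubring E} {T : SqGroup E}
    (h : ∀ x, O.valuation x < 1 → 1 + x ∈ T) {x : E} (hx : x ∈ oneUnits O) : x ∈ T := by
  obtain ⟨y, hy, hxy⟩ := hx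
  have := h _ hxy
  rw [add_sub_cancel] at this
  exact (mul_sq_iff hy).1 this

theorem unitsSq_subset {O : ValuationSubring E} {T : SqGroup E}
    (h : ∀ x, O.valuation x = 1 → x ∈ T) {x : E} (hx : x ∈ unitsSq O) : x ∈ T := by
  obtain ⟨y, hy, hxy⟩ := hx
  exact (mul_sq_iff hy).1 (h _ hxy)

theorem rigidOutside_valuation (O : ValuationSubring E) :
    RigidOutside (oneUnits O) (unitsSq O) := by
  intro x hx0 hx s hs t ht
  have hs0 := ne_zero hs
  have ht0 := ne_zero ht
  have hne : O.valuation s ≠ O.valuation (x * t) := by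
    intro h
    apply hx
    rw [← mul_iff' (oneUnits_le ht)]
    obtain ⟨y, hy, hy1⟩ := oneUnits_le hs
    refine ⟨y, hy, ?_⟩
    rw [map_mul, ← h, ← map_mul, hy1]
  have hv : ∀ {z : E}, z ≠ 0 → 0 < O.valuation z := fun hz => zero_lt_iff.2 ((map_ne_zero _).2 hz)
  rcases hne.lt_or_gt with h | h
  · right
    have e : (s + x * t) * x = (1 + s / (x * t)) * t * x ^ 2 := by field_simp; ring
    rw [e, mul_sq_iff hx0]
    refine mul (one_add_mem_oneUnits ?_) ht
    rw [map_div₀]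
    exact (div_lt_one₀ (hv (mul_ne_zero hx0 ht0))).2 h
  · left
    have e : (s + x * t) = (1 + x * t / s) * s := by field_simp
    rw [e]
    refine mul (one_add_mem_oneUnits ?_) hs
    rw [map_div₀]
    exact (div_lt_one₀ (hv hs0)).2 h

/-- The valuation ring has rank at most one. -/
def Arch (O : ValuationSubring E) : Prop :=
  ∀ x, O.valuation x < 1 → ∀ y, ∃ n : ℕ, O.valuation (x ^ n * y) < 1

theorem val_neg_one (O : ValuationSubring E) : O.valuation (-1) = 1 := by simp

/-- Valuation rings with comparable groups of one-units. -/
theorem eq_of_oneUnits_subset {O O₂ : ValuationSubring E} (harch : Arch O) (hO₂ : O₂ ≠ ⊤)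
    (hmin : ∀ O₃ : ValuationSubring E, O₃ ≤ O →
      (∀ x, O₃.valuation x < 1 → 1 + x ∈ oneUnits O) → O₃ = O)
    (h : ∀ x, O₂.valuation x < 1 → 1 + x ∈ oneUnits O) {y : E} (hy0 : y ≠ 0)
    (hy : y ∉ oneUnits O) : O₂ = O := by
  by_cases h1 : O₂ ≤ O
  · exact hmin _ h1 h
  by_cases h2 : O ≤ O₂
  · exfalso
    obtain ⟨z, hz, hzO⟩ := SetLike.not_le_iff_exists.1 h1
    apply hO₂
    rw [eq_top_iff]
    intro w _
    have hz' : O.valuation z⁻¹ < 1 := by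
      rw [← O.valuation_le_one_iff, not_le] at hzO
      rw [map_inv₀]
      exact inv_lt_one_of_one_lt₀ hzO
    obtain ⟨n, hn⟩ := harch _ hz' w
    have h3 : z⁻¹ ^ n * w ∈ O₂ := h2 ((O.valuation_le_one_iff _).1 hn.le)
    have h4 := mul_mem (pow_mem hz n) h3
    have hz0 : z ≠ 0 := by rintro rfl; exact hzO (zero_mem _)
    convert h4 using 1
    rw [inv_pow]
    field_simp
  exfalso
  wlog hyO : y ∈ O₂ generalizing y
  · exact this (inv_ne_zero hy0) (fun h' => hy (inv_iff.1 h'))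
      ((O₂.mem_or_inv_mem y).resolve_left hyO)
  obtain ⟨a, ha, haO⟩ := SetLike.not_le_iff_exists.1 h1
  obtain ⟨b, hb, hbO⟩ := SetLike.not_le_iff_exists.1 h2
  have ha0 : a ≠ 0 := by rintro rfl; exact haO (zero_mem _)
  have hb0 : b ≠ 0 := by rintro rfl; exact hbO (zero_mem _)
  rw [← ValuationSubring.valuation_le_one_iff] at ha hb hyO
  rw [← ValuationSubring.valuation_le_one_iff, not_le] at haO hbO
  have hc1 : O₂.valuation (a / b) < 1 := by
    rw [map_div₀]
    exact (div_lt_one₀ (zero_lt_one.trans hbO)).2 (ha.trans_lt hbO)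
  have hc2 : O.valuation (b / a) < 1 := by
    rw [map_div₀]
    exact (div_lt_one₀ (zero_lt_one.trans haO)).2 (hb.trans_lt haO)
  obtain ⟨n, hn⟩ := harch _ hc2 y⁻¹
  have hcn : O₂.valuation ((a / b) ^ (n + 1)) < 1 := by
    rw [map_pow]; exact pow_lt_one₀ zero_le hc1 (by simp)
  have hcn' : O.valuation ((b / a) ^ (n + 1)) < 1 := by
    rw [map_pow]; exact pow_lt_one₀ zero_le hc2 (by simp)
  have hn' : O.valuation ((b / a) ^ (n + 1) * y⁻¹) < 1 := by
    rw [pow_succ', mul_assoc, map_mul]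
    exact mul_lt_one_of_nonneg_of_lt_one_left zero_le hc2 hn.le
  have h3 : 1 + (a / b) ^ (n + 1) * y ∈ oneUnits O := h _ (by
    rw [map_mul]; exact mul_lt_one_of_nonneg_of_lt_one_left zero_le hcn hyO)
  have h4 : 1 + (a / b) ^ (n + 1) ∈ oneUnits O := h _ hcn
  have h5 := one_add_mem_oneUnits hn'
  have h6 := one_add_mem_oneUnits hcn'
  have h7 := mul h3 h6
  have h8 : (1 + (a / b) ^ (n + 1) * y) * (1 + (b / a) ^ (n + 1)) =
      (1 + (a / b) ^ (n + 1)) * ((1 + (b / a) ^ (n + 1) * y⁻¹) * y) := by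
    rw [div_pow, div_pow]
    field_simp
    ring
  rw [h8, mul_iff h4, mul_iff h5] at h7
  exact hy h7

end Val

/-- A Witt equivalence, seen as a relation between nonzero elements. -/
structure WittRel (K L : Type*) [Field K] [Field L] where
  rel : K → L → Prop
  ne_zero : ∀ {x y}, rel x y → x ≠ 0
  ne_zero' : ∀ {x y}, rel x y → y ≠ 0
  total : ∀ x, x ≠ 0 → ∃ y, rel x y
  total' : ∀ y, y ≠ 0 → ∃ x, rel x y
  sq : ∀ x y, x ≠ 0 → y ≠ 0 → rel (x ^ 2) (y ^ 2)
  mul : ∀ {x y x' y'}, rel x y → rel x' y' → rel (x * x') (y * y')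
  inj : ∀ {x x' y}, rel x y → rel x' y → ∃ z, z ≠ 0 ∧ x' = x * z ^ 2
  inj' : ∀ {x y y'}, rel x y → rel x y' → ∃ z, z ≠ 0 ∧ y' = y * z ^ 2
  neg_one : rel (-1) (-1)
  rep : ∀ {a b c a' b' c'}, rel a a' → rel b b' → rel c c' →
    (∃ x y, c = a * x ^ 2 + b * y ^ 2) → (∃ x y, c' = a' * x ^ 2 + b' * y ^ 2)
  rep' : ∀ {a b c a' b' c'}, rel a a' → rel b b' → rel c c' →
    (∃ x y, c' = a' * x ^ 2 + b' * y ^ 2) → (∃ x y, c = a * x ^ 2 + b * y ^ 2)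

namespace WittRel

variable {K L : Type*} [Field K] [Field L] (R : WittRel K L)

/-- The inverse Witt equivalence. -/
def symm : WittRel L K where
  rel x y := R.rel y x
  ne_zero := R.ne_zero'
  ne_zero' := R.ne_zero
  total := R.total'
  total' := R.total
  sq x y hx hy := R.sq y x hy hx
  mul := R.mul
  inj := R.inj'
  inj' := R.inj
  neg_one := R.neg_one
  rep := R.rep'
  rep' := R.rep

/-- The image of a subgroup containing the squares. -/
def map (T : SqGroup K) : SqGroup L where
  carrier := {y | ∃ x ∈ T, R.rel x y}
  zero_notMem := by
    rintro ⟨x, -, h⟩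
    exact R.ne_zero' h rfl
  sq_mem := fun y hy => ⟨1, T.one, by simpa using R.sq 1 y one_ne_zero hy⟩
  mul_mem := by
    rintro y ⟨x, hx, h⟩ y' ⟨x', hx', h'⟩
    exact ⟨x * x', SqGroup.mul hx hx', R.mul h h'⟩

variable {R}

theorem mem_map {T : SqGroup K} {x : K} {y : L} (h : R.rel x y) : y ∈ R.map T ↔ x ∈ T := by
  constructor
  · rintro ⟨x', hx', h'⟩
    obtain ⟨z, hz, e⟩ := R.inj h' h
    exact (congr_sq hz e).2 hx'
  · exact fun hx => ⟨x, hx, h⟩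

theorem mem_map_symm {T : SqGroup L} {x : K} {y : L} (h : R.rel x y) :
    x ∈ R.symm.map T ↔ y ∈ T := mem_map (R := R.symm) h

theorem mul_sq {x : K} {y z : L} (h : R.rel x y) (hz : z ≠ 0) : R.rel x (y * z ^ 2) := by
  simpa using R.mul h (R.sq 1 z one_ne_zero hz)

theorem neg {x : K} {y : L} (h : R.rel x y) : R.rel (-x) (-y) := by
  simpa using R.mul h R.neg_one

theorem one_rel : R.rel 1 1 := by simpa using R.sq 1 1 one_ne_zero one_ne_zero

theorem mem_map_pm {T : SqGroup K} {x : K} {y : L} (h : R.rel x y) :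
    y ∈ (R.map T).pm ↔ x ∈ T.pm := by
  rw [mem_pm, mem_pm, mem_map h, mem_map (neg h)]

theorem rigidOutside_map {T H : SqGroup K} (hle : ∀ x, x ∈ T → x ∈ H) (hneg : (-1 : K) ∈ H)
    (h : RigidOutside T H) : RigidOutside (R.map T) (R.map H) := by
  rintro y hy0 hy s' ⟨s, hs, hss⟩ t' ⟨t, ht, htt⟩
  obtain ⟨x, hx⟩ := R.total' y hy0
  have hxH : x ∉ H := fun h' => hy ((mem_map hx).2 h')
  have hc0 : s' + y * t' ≠ 0 := by
    intro h0
    apply hy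
    have h1 : -s' ∈ R.map H := ⟨-s, by
      simpa using SqGroup.mul hneg (hle s hs), neg hss⟩
    have h2 : t' ∈ R.map H := ⟨t, hle t ht, htt⟩
    rw [← mul_iff' h2]
    convert h1 using 1
    linear_combination h0
  obtain ⟨c, hc⟩ := R.total' _ hc0
  obtain ⟨u, w, e⟩ := R.rep' hss (R.mul hx htt) hc ⟨1, 1, by ring⟩
  rw [mem_map hc, mem_map (R.mul hc hx)]
  by_cases hu : u = 0
  · right
    have hw : w ≠ 0 := by
      rintro rfl
      apply R.ne_zero hc
      rw [e, hu]; ring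
    rw [hu] at e
    exact (congr_sq (z := x * w) (mul_ne_zero (R.ne_zero hx) hw) (by rw [e]; ring)).2 ht
  by_cases hw : w = 0
  · left
    rw [hw] at e
    exact (congr_sq (z := u) hu (by rw [e]; ring)).2 hs
  · have := h x (R.ne_zero hx) hxH _ ((mul_sq_iff hu).2 hs) _ ((mul_sq_iff hw).2 ht)
    rw [e]
    convert this using 3 <;> ring

theorem indepPair_map {T : SqGroup K} {a b : K} (ha : a ≠ 0) (hb : b ≠ 0)
    (h : IndepPair T a b) :
    ∃ a' b', R.rel a a' ∧ R.rel b b' ∧ IndepPair (R.map T) a' b' := by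
  obtain ⟨a', ha'⟩ := R.total a ha
  obtain ⟨b', hb'⟩ := R.total b hb
  obtain ⟨x, y, e⟩ := R.rep ha' hb' one_rel ⟨1, 1, by linear_combination (-1) * h.sum⟩
  have ht := (R.map T).one
  have hx : x ≠ 0 := by
    rintro rfl
    apply h.right
    left
    rw [← mem_map hb']
    refine (mul_sq_iff (y := y) ?_).1 ?_
    · rintro rfl
      simp at e
    · convert ht using 1; rw [e]; ring
  have hy : y ≠ 0 := by
    rintro rfl
    apply h.left
    left
    rw [← mem_map ha']
    refine (mul_sq_iff (y := x) hx).1 ?_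
    convert ht using 1; rw [e]; ring
  have h1 := mul_sq ha' hx
  have h2 := mul_sq hb' hy
  refine ⟨_, _, h1, h2, e.symm, ?_, ?_, ?_⟩
  · rw [mem_map_pm h1]; exact h.left
  · rw [mem_map_pm h2]; exact h.right
  · rw [mem_map_pm (R.mul h1 h2)]; exact h.prod

/-- A Witt equivalence transports certain valuations. -/
theorem exists_valuationSubring (R : WittRel K L) {O : ValuationSubring K} (harch : Arch O)
    (hmin : ∀ O₃ : ValuationSubring K, O₃ ≤ O →
      (∀ x, O₃.valuation x < 1 → 1 + x ∈ oneUnits O) → O₃ = O)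
    (hH : ∃ x, x ≠ 0 ∧ x ∉ unitsSq O)
    {a b : K} (ha : O.valuation a = 1) (hb : O.valuation b = 1)
    (hab : IndepPair (oneUnits O) a b) :
    ∃ O' : ValuationSubring L, O' ≠ ⊤ ∧ (∀ x y, R.rel x y → (x ∈ oneUnits O ↔ y ∈ oneUnits O')) ∧
      (∀ x y, R.rel x y → y ∈ unitsSq O' → x ∈ unitsSq O) ∧
      ∃ a' b', O'.valuation a' = 1 ∧ O'.valuation b' = 1 ∧ IndepPair (oneUnits O') a' b' := by
  have ha0 : a ≠ 0 := by rintro rfl; simp at ha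
  have hb0 : b ≠ 0 := by rintro rfl; simp at hb
  have hneg : (-1 : K) ∈ unitsSq O := unit_mem_unitsSq (val_neg_one O)
  obtain ⟨a', b', haa, hbb, hab'⟩ := indepPair_map (R := R) ha0 hb0 hab
  obtain ⟨x₀, hx₀, hx₀H⟩ := hH
  obtain ⟨y₀, hxy₀⟩ := R.total x₀ hx₀
  obtain ⟨O', hO', hm', hu'⟩ := exists_valuationSubring_of_rigidOutside
    (T := R.map (oneUnits O)) (H := R.map (unitsSq O))
    (fun y ⟨x, hx, h⟩ => ⟨x, oneUnits_le hx, h⟩) ⟨-1, hneg, R.neg_one⟩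
    (rigidOutside_map (fun x => oneUnits_le) hneg (rigidOutside_valuation O))
    ⟨a, unit_mem_unitsSq ha, haa⟩ ⟨b, unit_mem_unitsSq hb, hbb⟩ hab'
    ⟨y₀, R.ne_zero' hxy₀, fun h => hx₀H ((mem_map hxy₀).1 h)⟩
  have hT : ∀ x y, R.rel x y → y ∈ oneUnits O' → x ∈ oneUnits O := fun x y h hy =>
    (mem_map h).1 (oneUnits_subset hm' hy)
  have hHH : ∀ x y, R.rel x y → y ∈ unitsSq O' → x ∈ unitsSq O := fun x y h hy =>
    (mem_map h).1 (unitsSq_subset hu' hy)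
  have hs := hab'.sum
  have hlt : ∀ {z w : L}, z + w = 1 → w ∉ (R.map (oneUnits O)).pm → ¬ O'.valuation z < 1 := by
    intro z w h hw hz
    apply hw
    left
    have := hm' (-z) (by rwa [Valuation.map_neg])
    convert this using 1
    linear_combination h
  have ha1 : 1 ≤ O'.valuation a' := not_lt.1 (hlt hs hab'.right)
  have hb1 : 1 ≤ O'.valuation b' := not_lt.1 (hlt (by rw [add_comm, hs]) hab'.left)
  have ha'0 : a' ≠ 0 := R.ne_zero' haa
  have ha2 : O'.valuation a' ≤ 1 := by
    by_contra hc
    rw [not_le] at hc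
    have := hm' (-(a')⁻¹) (by
      rw [Valuation.map_neg, map_inv₀]; exact inv_lt_one_of_one_lt₀ hc)
    apply hab'.prod
    right
    refine (congr_sq ha'0 ?_).2 this
    field_simp
    linear_combination (-1) * hs
  have hav : O'.valuation a' = 1 := le_antisymm ha2 ha1
  have hbv : O'.valuation b' = 1 := by
    refine le_antisymm ?_ hb1
    have : b' = 1 - a' := by linear_combination hs
    rw [this]
    exact Valuation.map_sub_le _ (map_one _).le ha2
  have hab1 : IndepPair (oneUnits O') a' b' := by
    have : ∀ x y, R.rel x y → x ∉ (oneUnits O).pm → y ∉ (oneUnits O').pm := by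
      rintro x y h hx (hy | hy)
      · exact hx (Or.inl (hT x y h hy))
      · exact hx (Or.inr (hT _ _ (neg h) hy))
    exact ⟨hs, this _ _ haa hab.left, this _ _ hbb hab.right, this _ _ (R.mul haa hbb) hab.prod⟩
  have hneg' : (-1 : L) ∈ unitsSq O' := unit_mem_unitsSq (val_neg_one O')
  obtain ⟨a₁, b₁, haa₁, hbb₁, hab₁⟩ := indepPair_map (R := R.symm) ha'0 (R.ne_zero' hbb) hab1
  obtain ⟨O₂, hO₂, hm₂, hu₂⟩ := exists_valuationSubring_of_rigidOutside
    (T := R.symm.map (oneUnits O')) (H := R.symm.map (unitsSq O'))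
    (fun y ⟨x, hx, h⟩ => ⟨x, oneUnits_le hx, h⟩) ⟨-1, hneg', R.neg_one⟩
    (rigidOutside_map (fun x => oneUnits_le) hneg' (rigidOutside_valuation O'))
    ⟨a', unit_mem_unitsSq hav, haa₁⟩ ⟨b', unit_mem_unitsSq hbv, hbb₁⟩ hab₁
    ⟨x₀, hx₀, fun h => hx₀H (hHH _ _ hxy₀ ((mem_map_symm hxy₀).1 h))⟩
  have hsub : ∀ x, O₂.valuation x < 1 → 1 + x ∈ oneUnits O := by
    intro x hx
    obtain ⟨y, hy, h⟩ := hm₂ x hx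
    exact hT _ _ h hy
  have hEq : O₂ = O := eq_of_oneUnits_subset harch hO₂ hmin hsub ha0 (fun h => hab.left (Or.inl h))
  subst hEq
  refine ⟨O', hO', fun x y h => ⟨fun hx => ?_, hT x y h⟩, hHH, a', b', hav, hbv, hab1⟩
  exact (mem_map_symm h).1 (oneUnits_subset hm₂ hx)

end WittRel

theorem sqCl_eq_iff {K : Type*} [Field K] {u v : Kˣ} :
    sqCl u = sqCl v ↔ ∃ z : K, z ≠ 0 ∧ (v : K) = u * z ^ 2 := by
  unfold sqCl
  rw [QuotientGroup.eq]
  constructor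
  · rintro ⟨z, hz⟩
    refine ⟨z, z.ne_zero, ?_⟩
    have : v = u * z ^ 2 := by
      rw [powMonoidHom_apply] at hz
      rw [hz, mul_inv_cancel_left]
    rw [this]
    simp
  · rintro ⟨z, hz, e⟩
    refine ⟨Units.mk0 z hz, ?_⟩
    ext
    simp [e]

/-- The relation between nonzero elements attached to a Witt equivalence. -/
def WittRel.ofEquiv {K L : Type*} [Field K] [Field L] (α : SqClass K ≃* SqClass L)
    (h : IsWittEquiv α) : WittRel K L where
  rel x y := ∃ (u : Kˣ) (v : Lˣ), (u : K) = x ∧ (v : L) = y ∧ α (sqCl u) = sqCl v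
  ne_zero := by
    rintro _ _ ⟨u, v, rfl, rfl, -⟩
    exact u.ne_zero
  ne_zero' := by
    rintro _ _ ⟨u, v, rfl, rfl, -⟩
    exact v.ne_zero
  total x hx := by
    obtain ⟨v, hv⟩ := QuotientGroup.mk_surjective (α (sqCl (Units.mk0 x hx)))
    exact ⟨v, Units.mk0 x hx, v, rfl, rfl, hv.symm⟩
  total' y hy := by
    obtain ⟨u, hu⟩ := QuotientGroup.mk_surjective (α.symm (sqCl (Units.mk0 y hy)))
    exact ⟨u, u, Units.mk0 y hy, rfl, rfl, by
      change α (QuotientGroup.mk u) = _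
      rw [hu, MulEquiv.apply_symm_apply]⟩
  sq x y hx hy := by
    refine ⟨Units.mk0 x hx ^ 2, Units.mk0 y hy ^ 2, by simp, by simp, ?_⟩
    have h1 : sqCl (Units.mk0 x hx ^ 2) = 1 :=
      (sqCl_eq_iff (u := Units.mk0 x hx ^ 2) (v := 1)).2 ⟨x⁻¹, inv_ne_zero hx, by simp [hx]⟩
    have h2 : sqCl (Units.mk0 y hy ^ 2) = 1 :=
      (sqCl_eq_iff (u := Units.mk0 y hy ^ 2) (v := 1)).2 ⟨y⁻¹, inv_ne_zero hy, by simp [hy]⟩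
    rw [h1, h2, map_one]
  mul := by
    rintro _ _ _ _ ⟨u, v, rfl, rfl, h⟩ ⟨u', v', rfl, rfl, h'⟩
    refine ⟨u * u', v * v', by simp, by simp, ?_⟩
    change α (sqCl u * sqCl u') = sqCl v * sqCl v'
    rw [map_mul, h, h']
  inj := by
    rintro _ _ _ ⟨u, v, rfl, rfl, h⟩ ⟨u', v', rfl, e, h'⟩
    obtain rfl := Units.ext e
    exact sqCl_eq_iff.1 (α.injective (h.trans h'.symm))
  inj' := by
    rintro _ _ _ ⟨u, v, rfl, rfl, h⟩ ⟨u', v', e, rfl, h'⟩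
    obtain rfl := Units.ext e
    exact sqCl_eq_iff.1 (h.symm.trans h')
  neg_one := ⟨-1, -1, by simp, by simp, h.map_neg_one⟩
  rep := by
    rintro _ _ _ _ _ _ ⟨a, a', rfl, rfl, ha⟩ ⟨b, b', rfl, rfl, hb⟩ ⟨c, c', rfl, rfl, hc⟩
    exact (h.represents a b c a' b' c' ha hb hc).1
  rep' := by
    rintro _ _ _ _ _ _ ⟨a, a', rfl, rfl, ha⟩ ⟨b, b', rfl, rfl, hb⟩ ⟨c, c', rfl, rfl, hc⟩
    exact (h.represents a b c a' b' c' ha hb hc).2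

section Ord

open IsDedekindDomain NumberField

universe w

variable {k : Type w} [Field k] [NumberField k]

/-- The (negative of the) order of vanishing at `v`. -/
noncomputable def ordAt (v : HeightOneSpectrum (𝓞 k)) (x : k) : ℤ := WithZero.log (v.valuation k x)

theorem ordAt_mul (v : HeightOneSpectrum (𝓞 k)) {x y : k} (hx : x ≠ 0) (hy : y ≠ 0) :
    ordAt v (x * y) = ordAt v x + ordAt v y := by
  unfold ordAt
  rw [map_mul, WithZero.log_mul] <;> simpa

theorem ordAt_sq (v : HeightOneSpectrum (𝓞 k)) (x : k) : ordAt v (x ^ 2) = 2 * ordAt v x := by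
  by_cases hx : x = 0
  · simp [ordAt, hx]
  · rw [pow_two, ordAt_mul v hx hx]; ring

theorem val_eq_exp (v : HeightOneSpectrum (𝓞 k)) {x : k} (hx : x ≠ 0) :
    v.valuation k x = WithZero.exp (ordAt v x) := by
  rw [ordAt, WithZero.exp_log]
  simpa

theorem ordAt_eq_of_val {v : HeightOneSpectrum (𝓞 k)} {x : k} {n : ℤ}
    (h : v.valuation k x = WithZero.exp n) : ordAt v x = n := by rw [ordAt, h, WithZero.log_exp]

theorem ordAt_eq_zero {v : HeightOneSpectrum (𝓞 k)} {x : k}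
    (h : v.valuation k x = 1) : ordAt v x = 0 := by rw [ordAt, h, WithZero.log_one]

theorem not_isSquare_of_odd {v : HeightOneSpectrum (𝓞 k)} {x : k} (h : Odd (ordAt v x)) :
    ¬ IsSquare x := by
  rintro ⟨y, rfl⟩
  rw [← pow_two, ordAt_sq] at h
  exact (Int.not_odd_iff_even.2 (even_two_mul _)) h

theorem ordAt_neg (v : HeightOneSpectrum (𝓞 k)) (x : k) : ordAt v (-x) = ordAt v x := by
  rw [ordAt, Valuation.map_neg, ordAt]

theorem exists_uniformizer (v : HeightOneSpectrum (𝓞 k)) :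
    ∃ π : 𝓞 k, π ≠ 0 ∧ v.valuation k (π : k) = WithZero.exp (-1 : ℤ) := by
  obtain ⟨π, hπ⟩ := v.valuation_exists_uniformizer' k
  refine ⟨π, ?_, hπ⟩
  rintro rfl
  change v.valuation k (algebraMap (𝓞 k) k 0) = _ at hπ
  rw [map_zero, map_zero] at hπ
  exact WithZero.exp_ne_zero hπ.symm

theorem exists_unit_factor (v : HeightOneSpectrum (𝓞 k)) {π : k} (hπ : v.valuation k π = WithZero.exp (-1 : ℤ))
    {x : k} (hx : x ≠ 0) : v.valuation k (x * π ^ ordAt v x) = 1 := by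
  rw [map_mul, map_zpow₀, hπ, val_eq_exp v hx, ← WithZero.exp_zsmul, ← WithZero.exp_add]
  simp

theorem exists_close (v : HeightOneSpectrum (𝓞 k)) {x : k} (h : v.valuation k x ≤ 1) :
    ∃ a : 𝓞 k, v.valuation k ((a : k) - x) < 1 := by
  simpa using v.exists_valuation_sub_lt_of_integer h 1

theorem finite_quotient (v : HeightOneSpectrum (𝓞 k)) : Finite (𝓞 k ⧸ v.asIdeal) :=
  Ideal.finiteQuotientOfFreeOfNeBot _ v.ne_bot

/-- Square classes up to units congruent to `1` at `v` are classified by finitely many keys. -/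
theorem exists_key (v : HeightOneSpectrum (𝓞 k)) :
    ∃ (S : Type w) (_ : Finite S) (key : k → S), ∀ x y, x ≠ 0 → y ≠ 0 → key x = key y →
      ∃ z, z ≠ 0 ∧ v.valuation k (x / y * z ^ 2 - 1) < 1 := by
  obtain ⟨π, hπ0, hπ⟩ := exists_uniformizer v
  have hπ0' : (π : k) ≠ 0 := by simpa using hπ0
  have : ∀ x : k, ∃ a : 𝓞 k, x ≠ 0 → v.valuation k ((a : k) - x * (π : k) ^ ordAt v x) < 1 := by
    intro x
    by_cases hx : x = 0
    · exact ⟨0, fun h => absurd hx h⟩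
    · obtain ⟨a, ha⟩ := exists_close v (exists_unit_factor v hπ hx).le
      exact ⟨a, fun _ => ha⟩
  choose f hf using this
  have := finite_quotient v
  refine ⟨ZMod 2 × (𝓞 k ⧸ v.asIdeal), inferInstance,
    fun x => (((ordAt v x : ℤ) : ZMod 2), Ideal.Quotient.mk _ (f x)), fun x y hx hy h => ?_⟩
  rw [Prod.mk.injEq] at h
  obtain ⟨h1, h2⟩ := h
  obtain ⟨m, hm⟩ : (2 : ℤ) ∣ ordAt v y - ordAt v x := by
    have := (ZMod.intCast_eq_intCast_iff_dvd_sub _ _ 2).1 h1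
    exact_mod_cast this
  rw [Ideal.Quotient.mk_eq_mk_iff_sub_mem, ← v.valuation_lt_one_iff_mem (K := k)] at h2
  refine ⟨(π : k) ^ (-m), zpow_ne_zero _ hπ0', ?_⟩
  have hy1 := exists_unit_factor v hπ hy
  have e : x / y * ((π : k) ^ (-m)) ^ 2 - 1 = ((((f x - f y : 𝓞 k) : k)
      - ((f x : k) - x * (π : k) ^ ordAt v x)) + ((f y : k) - y * (π : k) ^ ordAt v y))
        / (y * (π : k) ^ ordAt v y) := by
    have e1 : ordAt v y = ordAt v x + 2 * m := by linear_combination hm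
    have e2 : (π : k) ^ ordAt v y = (π : k) ^ ordAt v x * ((π : k) ^ m) ^ 2 := by
      rw [e1, zpow_add₀ hπ0', mul_comm 2 m, zpow_mul]; norm_cast
    have hP := zpow_ne_zero m hπ0'
    have hQ := zpow_ne_zero (ordAt v x) hπ0'
    rw [e2, zpow_neg, show ((f x - f y : 𝓞 k) : k) = (f x : k) - f y from
      map_sub (algebraMap (𝓞 k) k) _ _]
    generalize (π : k) ^ m = P at *
    generalize (π : k) ^ ordAt v x = Q at *
    field_simp
    ring
  rw [e, map_div₀, hy1, div_one]
  exact Valuation.map_add_lt _ (Valuation.map_sub_lt _ h2 (hf x hx)) (hf y hy)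

/-- At a dyadic prime, elements of even order are squares modulo units congruent to `1`. -/
theorem exists_sq_of_even (v : HeightOneSpectrum (𝓞 k)) (h2 : v.valuation k 2 < 1) {x : k}
    (hx : x ≠ 0) (he : Even (ordAt v x)) : ∃ z, z ≠ 0 ∧ v.valuation k (x * z ^ 2 - 1) < 1 := by
  obtain ⟨π, hπ0, hπ⟩ := exists_uniformizer v
  have hπ0' : (π : k) ≠ 0 := by simpa using hπ0
  obtain ⟨m, hm⟩ := he
  have hu := exists_unit_factor v hπ hx
  obtain ⟨a, ha⟩ := exists_close v hu.le
  have := finite_quotient v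
  have := v.isMaximal
  let _ : Field (𝓞 k ⧸ v.asIdeal) := Ideal.Quotient.field _
  let _ := Fintype.ofFinite (𝓞 k ⧸ v.asIdeal)
  have hchar : ringChar (𝓞 k ⧸ v.asIdeal) = 2 := by
    have : ((2 : ℕ) : 𝓞 k ⧸ v.asIdeal) = 0 := by
      have h3 : (2 : 𝓞 k) ∈ v.asIdeal := by
        rw [← v.valuation_lt_one_iff_mem (K := k)]
        change v.valuation k (algebraMap (𝓞 k) k 2) < 1
        rwa [map_ofNat]
      have := Ideal.Quotient.eq_zero_iff_mem.2 h3
      rw [map_ofNat] at this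
      exact_mod_cast this
    have h4 := (ringChar.spec _ 2).1 this
    rcases (Nat.dvd_prime Nat.prime_two).1 h4 with h5 | h5
    · exact absurd h5 CharP.ringChar_ne_one
    · exact h5
  obtain ⟨b, hb⟩ := FiniteField.isSquare_of_char_two hchar (Ideal.Quotient.mk v.asIdeal a)
  obtain ⟨b, rfl⟩ := Ideal.Quotient.mk_surjective b
  rw [← map_mul, Ideal.Quotient.mk_eq_mk_iff_sub_mem, ← v.valuation_lt_one_iff_mem (K := k)] at hb
  have hub : v.valuation k (x * (π : k) ^ ordAt v x - (b : k) ^ 2) < 1 := by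
    have e : x * (π : k) ^ ordAt v x - (b : k) ^ 2 = ((a - b * b : 𝓞 k) : k) -
      ((a : k) - x * (π : k) ^ ordAt v x) := by push_cast; ring
    rw [e]
    exact Valuation.map_sub_lt _ hb ha
  have hb1 : v.valuation k (b : k) ^ 2 = 1 := by
    have := Valuation.map_sub_eq_of_lt_left (v.valuation k) (x := x * (π : k) ^ ordAt v x)
      (y := x * (π : k) ^ ordAt v x - (b : k) ^ 2) (by rwa [hu])
    rw [sub_sub_cancel, map_pow, hu] at this
    exact this
  have hb0 : (b : k) ≠ 0 := by
    intro h0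
    rw [h0] at hb1
    simp at hb1
  refine ⟨(π : k) ^ m / b, div_ne_zero (zpow_ne_zero _ hπ0') hb0, ?_⟩
  have e : x * ((π : k) ^ m / b) ^ 2 - 1 = (x * (π : k) ^ ordAt v x - (b : k) ^ 2) / (b : k) ^ 2 := by
    rw [hm, zpow_add₀ hπ0']
    field_simp
  rw [e, map_div₀, map_pow, hb1, div_one]
  exact hub

theorem finite_ne_one (x : k) (hx : x ≠ 0) :
    {v : HeightOneSpectrum (𝓞 k) | v.valuation k x ≠ 1}.Finite := by
  refine ((HeightOneSpectrum.Support.finite (𝓞 k) x).union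
    (HeightOneSpectrum.Support.finite (𝓞 k) x⁻¹)).subset ?_
  intro v hv
  rcases lt_or_gt_of_ne hv with h | h
  · right
    change 1 < v.valuation k x⁻¹
    rw [map_inv₀]
    exact (one_lt_inv₀ (zero_lt_iff.2 ((map_ne_zero _).2 hx))).2 h
  · exact Or.inl h

theorem finite_dyadic : {v : HeightOneSpectrum (𝓞 k) | v.valuation k 2 < 1}.Finite :=
  (finite_ne_one (2 : k) two_ne_zero).subset fun _ hv => hv.ne

/-- Elements of even order at all dyadic primes. -/
def EvenDyadic (x : k) : Prop :=
  x ≠ 0 ∧ ∀ v : HeightOneSpectrum (𝓞 k), v.valuation k 2 < 1 → Even (ordAt v x)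

/-- The elements of even order at all dyadic primes form a subgroup of finite index. -/
theorem exists_key_evenDyadic : ∃ (S : Type w) (_ : Finite S) (key : k → S),
    ∀ x y, x ≠ 0 → y ≠ 0 → key x = key y → EvenDyadic (x / y) := by
  have := (finite_dyadic (k := k)).to_subtype
  refine ⟨{v : HeightOneSpectrum (𝓞 k) | v.valuation k 2 < 1} → ZMod 2, inferInstance,
    fun x v => ((ordAt v.1 x : ℤ) : ZMod 2), fun x y hx hy h => ⟨div_ne_zero hx hy, ?_⟩⟩
  intro v hv
  have h1 := congrFun h ⟨v, hv⟩
  obtain ⟨m, hm⟩ : (2 : ℤ) ∣ ordAt v y - ordAt v x := by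
    have := (ZMod.intCast_eq_intCast_iff_dvd_sub _ _ 2).1 h1
    exact_mod_cast this
  have h2 := ordAt_mul v (div_ne_zero hx hy) hy
  rw [div_mul_cancel₀ _ hy] at h2
  exact ⟨-m, by linear_combination (-1) * hm - h2⟩

theorem exists_crt {q r : HeightOneSpectrum (𝓞 k)} (h : q ≠ r) (a b : 𝓞 k) :
    ∃ c : 𝓞 k, c - a ∈ q.asIdeal ^ 2 ∧ c - b ∈ r.asIdeal ^ 2 := by
  have hc : IsCoprime (q.asIdeal ^ 2) (r.asIdeal ^ 2) := by
    refine IsCoprime.pow ?_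
    rw [Ideal.isCoprime_iff_sup_eq]
    exact q.isMaximal.coprime_of_ne r.isMaximal fun h' => h (HeightOneSpectrum.ext h')
  obtain ⟨i, hi, j, hj, e⟩ := Ideal.isCoprime_iff_exists.1 hc
  refine ⟨a * j + b * i, ?_, ?_⟩
  · have : a * j + b * i - a = (b - a) * i := by linear_combination a * e
    rw [this]; exact Ideal.mul_mem_left _ _ hi
  · have : a * j + b * i - b = (a - b) * j := by linear_combination b * e
    rw [this]; exact Ideal.mul_mem_left _ _ hj

theorem val_of_sub_mem_sq {v : HeightOneSpectrum (𝓞 k)} {a c : 𝓞 k} (h : c - a ∈ v.asIdeal ^ 2)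
    (ha : v.valuation k (a : k) = WithZero.exp (-1 : ℤ)) :
    v.valuation k (c : k) = WithZero.exp (-1 : ℤ) := by
  rw [← v.intValuation_le_pow_iff_mem, ← v.valuation_of_algebraMap (K := k)] at h
  have e : (c : k) = a + ((c - a : 𝓞 k) : k) := by push_cast; ring
  rw [e, Valuation.map_add_eq_of_lt_left, ha]
  rw [ha]
  exact lt_of_le_of_lt h (WithZero.exp_lt_exp.2 (by norm_num))

theorem val_lt_of_sub_mem_sq {v : HeightOneSpectrum (𝓞 k)} {a c : 𝓞 k}
    (h : c - a ∈ v.asIdeal ^ 2) : v.valuation k ((c : k) - a) < 1 := by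
  have := (v.valuation_lt_one_iff_mem (K := k) (c - a)).2 (Ideal.pow_le_self two_ne_zero h)
  change v.valuation k (algebraMap (𝓞 k) k (c - a)) < 1 at this
  rwa [map_sub] at this

theorem exists_crt_one {q r : HeightOneSpectrum (𝓞 k)} (h : q ≠ r) :
    ∃ c : k, q.valuation k (c - 1) < 1 ∧ r.valuation k c = WithZero.exp (-1 : ℤ) := by
  obtain ⟨π, -, hπ⟩ := exists_uniformizer r
  obtain ⟨c, h1, h2⟩ := exists_crt h 1 π
  refine ⟨c, ?_, val_of_sub_mem_sq h2 hπ⟩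
  simpa using val_lt_of_sub_mem_sq h1

/-- Over a number field there are `a + b = 1` independent modulo `± kˣ²`. -/
theorem exists_independent_sum_one {q r : HeightOneSpectrum (𝓞 k)} (h : q ≠ r) :
    ∃ a b : k, a + b = 1 ∧ ∀ x, (x = a ∨ x = b ∨ x = a * b) → ¬ IsSquare x ∧ ¬ IsSquare (-x) := by
  obtain ⟨π, -, hπ⟩ := exists_uniformizer q
  obtain ⟨ϖ, -, hϖ⟩ := exists_uniformizer r
  obtain ⟨c, h1, h2⟩ := exists_crt h π (1 - ϖ)
  have hc := val_of_sub_mem_sq h1 hπ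
  have hd : r.valuation k (((1 - c : 𝓞 k) : 𝓞 k) : k) = WithZero.exp (-1 : ℤ) := by
    refine val_of_sub_mem_sq (a := ϖ) ?_ hϖ
    have : 1 - c - ϖ = -(c - (1 - ϖ)) := by ring
    rw [this]; exact neg_mem h2
  have e : ((1 - c : 𝓞 k) : k) = 1 - (c : k) := by push_cast; ring
  rw [e] at hd
  have hc1 : ordAt q (c : k) = -1 := ordAt_eq_of_val hc
  have hd1 : ordAt r (1 - (c : k)) = -1 := ordAt_eq_of_val hd
  have hc0 : (c : k) ≠ 0 := by
    intro h0; rw [h0, map_zero] at hc; exact WithZero.exp_ne_zero hc.symm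
  have hd0 : 1 - (c : k) ≠ 0 := by
    intro h0; rw [h0, map_zero] at hd; exact WithZero.exp_ne_zero hd.symm
  have hlt : q.valuation k (-(c : k)) < 1 := by
    rw [Valuation.map_neg, hc]; exact WithZero.exp_lt_exp.2 (by norm_num)
  have hcd : ordAt q (1 - (c : k)) = 0 := ordAt_eq_zero (by
    have := Valuation.map_one_add_of_lt _ hlt
    rwa [← sub_eq_add_neg] at this)
  have key : ∀ (v : HeightOneSpectrum (𝓞 k)) (x : k), ordAt v x = -1 →
      ¬ IsSquare x ∧ ¬ IsSquare (-x) := fun v x hx =>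
    ⟨not_isSquare_of_odd (v := v) (by rw [hx]; decide),
      not_isSquare_of_odd (v := v) (by rw [ordAt_neg, hx]; decide)⟩
  refine ⟨c, 1 - c, by ring, ?_⟩
  rintro x (rfl | rfl | rfl)
  · exact key q _ hc1
  · exact key r _ hd1
  · exact key q _ (by rw [ordAt_mul q hc0 hd0, hc1, hcd]; norm_num)

end Ord

section Primes

open IsDedekindDomain NumberField

universe w

variable {k : Type w} [Field k] [NumberField k]

/-- The valuation rings of an extension field either contain `k` or lie over a prime of `k`. -/
theorem exists_prime_of_valuationSubring {L : Type*} [Field L] [Algebra k L]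
    (O : ValuationSubring L) (h : ¬ ∀ x : k, algebraMap k L x ∈ O) :
    ∃ v : HeightOneSpectrum (𝓞 k),
      (∀ x : k, O.valuation (algebraMap k L x) ≤ 1 ↔ v.valuation k x ≤ 1) ∧
      (∀ x : k, O.valuation (algebraMap k L x) < 1 ↔ v.valuation k x < 1) ∧
      (∀ x : k, O.valuation (algebraMap k L x) = 1 ↔ v.valuation k x = 1) := by
  have h_integral : ∀ x : 𝓞 k, O.valuation (algebraMap k L x) ≤ 1 := by
    intro x
    have : IsIntegral O (algebraMap k L x) := by
      have h1 : IsIntegral ℤ (algebraMap k L x) := x.isIntegral_coe.map (algebraMap k L).toIntAlgHom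
      exact h1.tower_top
    obtain ⟨y, hy⟩ := IsIntegrallyClosed.isIntegral_iff.1 this
    rw [← hy]
    exact O.valuation_le_one y
  let q : Ideal (𝓞 k) :=
    { carrier := {r | O.valuation (algebraMap k L r) < 1}
      add_mem' := fun {a b} ha hb => by
        simp only [Set.mem_ofPred_eq] at *
        change O.valuation (algebraMap k L (algebraMap (𝓞 k) k (a + b))) < 1
        rw [map_add, map_add]
        exact Valuation.map_add_lt _ ha hb
      zero_mem' := by simp
      smul_mem' := fun a b hb => by
        simp only [Set.mem_ofPred_eq, smul_eq_mul] at *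
        change O.valuation (algebraMap k L (algebraMap (𝓞 k) k (a * b))) < 1
        rw [map_mul, map_mul, map_mul]
        exact (mul_le_of_le_one_left' (h_integral a)).trans_lt hb }
  have hq : ∀ r, r ∈ q ↔ O.valuation (algebraMap k L r) < 1 := fun r => Iff.rfl
  have hqp : q.IsPrime := by
    constructor
    · intro h1
      have := (hq 1).1 (h1 ▸ Submodule.mem_top)
      simp at this
    · intro x y hxy
      by_contra hcon
      push Not at hcon
      have hx := lt_or_eq_of_le (h_integral x) |>.resolve_left hcon.1
      have hy := lt_or_eq_of_le (h_integral y) |>.resolve_left hcon.2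
      have := (hq _).1 hxy
      change O.valuation (algebraMap k L (algebraMap (𝓞 k) k (x * y))) < 1 at this
      rw [map_mul, map_mul, map_mul, hx, hy] at this
      simp at this
  have hq0 : q ≠ ⊥ := by
    intro h0
    apply h
    intro x
    obtain ⟨a, b, hb, rfl⟩ := IsFractionRing.div_surjective (A := 𝓞 k) x
    have hb0 : b ≠ 0 := nonZeroDivisors.ne_zero hb
    have hb1 : ¬ O.valuation (algebraMap k L b) < 1 := fun h1 => hb0 (by
      have : b ∈ q := h1
      rwa [h0, Ideal.mem_bot] at this)
    have hb2 := lt_or_eq_of_le (h_integral b) |>.resolve_left hb1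
    refine O.mem_of_valuation_le_one _ ?_
    change O.valuation (algebraMap k L ((a : k) / (b : k))) ≤ 1
    rw [map_div₀, map_div₀, hb2, div_one]
    exact h_integral a
  let v : HeightOneSpectrum (𝓞 k) := ⟨q, hqp, hq0⟩
  have hle : HeightOneSpectrum.valuationSubringAtPrime k v ≤ O.comap (algebraMap k L) := by
    rintro x ⟨a, s, hs, rfl⟩
    have h1 : O.valuation (algebraMap k L (algebraMap (𝓞 k) k s)) = 1 :=
      lt_or_eq_of_le (h_integral s) |>.resolve_left fun h2 => hs h2
    rw [ValuationSubring.mem_comap]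
    refine O.mem_of_valuation_le_one _ ?_
    rw [map_mul, map_mul, map_inv₀, map_inv₀, h1, inv_one, mul_one]
    exact h_integral a
  rw [HeightOneSpectrum.valuationSubringAtPrime_eq_valuationSubring] at hle
  have hne : O.comap (algebraMap k L) ≠ ⊤ := by
    intro h1
    apply h
    intro x
    have : x ∈ O.comap (algebraMap k L) := h1 ▸ ValuationSubring.mem_top x
    exact this
  have heq := ValuationSubring.eq_of_le_of_ne_top _
    ((HeightOneSpectrum.valuationSubringAtPrime_eq_valuationSubring (K := k) v).le.trans hle) hne
  rw [HeightOneSpectrum.valuationSubringAtPrime_eq_valuationSubring] at heq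
  have hle1 : ∀ x : k, O.valuation (algebraMap k L x) ≤ 1 ↔ v.valuation k x ≤ 1 := by
    intro x
    rw [ValuationSubring.valuation_le_one_iff, ← ValuationSubring.mem_comap, ← heq]
    rfl
  have hlt1 : ∀ x : k, O.valuation (algebraMap k L x) < 1 ↔ v.valuation k x < 1 := by
    intro x
    by_cases hx : x = 0
    · simp [hx]
    · have h1 := hle1 x⁻¹
      rw [map_inv₀, map_inv₀, map_inv₀] at h1
      rw [inv_le_one₀ (zero_lt_iff.2 (by simpa using hx)),
        inv_le_one₀ (zero_lt_iff.2 (by simpa using hx))] at h1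
      rw [← not_le, ← not_le, h1]
  refine ⟨v, hle1, hlt1, fun x => ?_⟩
  rw [le_antisymm_iff, le_antisymm_iff, hle1, ← not_lt (b := (1 : O.ValueGroup)), hlt1, not_lt]

theorem exists_norm_gt {f : Polynomial (𝓞 k)} (hf : 0 < f.natDegree) (c b : 𝓞 k) (hb : b ≠ 0)
    (m : ℝ) : ∃ s : ℕ, m < |((Algebra.norm ℚ ((f.eval (c + b * (s : 𝓞 k)) : 𝓞 k) : k) : ℚ) : ℝ)| := by
  have key : ∀ w : InfinitePlace k, ∀ᶠ s : ℕ in Filter.atTop,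
      max m 1 < w ((f.eval (c + b * (s : 𝓞 k)) : 𝓞 k) : k) := by
    intro w
    let σ : 𝓞 k →+* ℂ := w.embedding.comp (algebraMap (𝓞 k) k)
    have hσ : Function.Injective σ :=
      w.embedding.injective.comp (RingOfIntegers.coe_injective)
    have h1 : Filter.Tendsto (fun s : ℕ => ‖σ (c + b * (s : 𝓞 k))‖) Filter.atTop Filter.atTop := by
      have h2 : Filter.Tendsto (fun s : ℕ => ‖σ b‖ * (s : ℝ) + -‖σ c‖) Filter.atTop Filter.atTop := by
        refine Filter.tendsto_atTop_add_const_right _ _ ?_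
        refine Filter.Tendsto.const_mul_atTop ?_ tendsto_natCast_atTop_atTop
        exact norm_pos_iff.2 ((map_ne_zero_iff σ hσ).2 hb)
      refine Filter.tendsto_atTop_mono (fun s => ?_) h2
      rw [map_add, map_mul, map_natCast]
      have := norm_sub_norm_le (σ b * (s : ℂ)) (-σ c)
      rw [norm_mul, norm_neg, Complex.norm_natCast, sub_neg_eq_add, add_comm (σ b * _)] at this
      linarith
    have h3 := (f.map σ).tendsto_norm_atTop (by
      rw [Polynomial.degree_map_eq_of_injective hσ]
      exact Polynomial.natDegree_pos_iff_degree_pos.1 hf) h1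
    filter_upwards [h3.eventually_gt_atTop (max m 1)] with s hs
    rw [Polynomial.eval_map, Polynomial.eval₂_hom] at hs
    rw [← w.norm_embedding_eq]
    exact hs
  classical
  obtain ⟨s, hs⟩ := (Filter.eventually_all.2 key).exists
  refine ⟨s, ?_⟩
  set x : k := ((f.eval (c + b * (s : 𝓞 k)) : 𝓞 k) : k)
  have := InfinitePlace.prod_eq_abs_norm x
  rw [← Rat.cast_abs, ← this]
  obtain ⟨w0⟩ : Nonempty (InfinitePlace k) := inferInstance
  have h1 : ∀ w : InfinitePlace k, 1 ≤ w x := fun w => (le_max_right _ _).trans (hs w).le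
  rw [← Finset.mul_prod_erase _ _ (Finset.mem_univ w0)]
  have h2 : m < w0 x ^ w0.mult :=
    (le_max_left m 1).trans_lt ((hs w0).trans_le (le_self_pow₀ (h1 w0) InfinitePlace.mult_ne_zero))
  have h3 : 1 ≤ ∏ w ∈ Finset.univ.erase w0, w x ^ w.mult :=
    Finset.prod_induction _ (fun x : ℝ => 1 ≤ x) (fun _ _ => one_le_mul_of_one_le_of_one_le) le_rfl
      fun w _ => one_le_pow₀ (h1 w)
  have h4 : 1 ≤ w0 x ^ w0.mult := one_le_pow₀ (h1 w0)
  nlinarith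

theorem exists_prime_value {f A B : Polynomial (𝓞 k)} (hf : 0 < f.natDegree) {d : 𝓞 k} (hd : d ≠ 0)
    (hAB : A * f + B * f.derivative = Polynomial.C d) {S : Set (HeightOneSpectrum (𝓞 k))}
    (hS : S.Finite) : ∃ r ∉ S, ∃ c : 𝓞 k,
      r.valuation k ((f.eval c : 𝓞 k) : k) = WithZero.exp (-1 : ℤ) := by
  have hf0 : f ≠ 0 := by rintro rfl; simp at hf
  obtain ⟨c0, hc0⟩ : ∃ c0 : 𝓞 k, f.eval c0 ≠ 0 := by
    by_contra hcon
    push Not at hcon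
    exact hf0 (Polynomial.funext fun r => by simp [hcon r])
  set S' : Set (HeightOneSpectrum (𝓞 k)) := S ∪ {v | v.valuation k ((d * f.eval c0 : 𝓞 k) : k) ≠ 1}
    with hS'
  have hfin : S'.Finite := hS.union (finite_ne_one _ (by
    simpa using And.intro hd hc0))
  obtain ⟨M, hM0, hM⟩ : ∃ M : 𝓞 k, M ≠ 0 ∧ ∀ v ∈ S', M ∈ v.asIdeal := by
    have : ∀ v : HeightOneSpectrum (𝓞 k), ∃ x ∈ v.asIdeal, x ≠ 0 := fun v =>
      Submodule.exists_mem_ne_zero_of_ne_bot v.ne_bot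
    choose g hg hg0 using this
    refine ⟨∏ v ∈ hfin.toFinset, g v, Finset.prod_ne_zero_iff.2 fun v _ => hg0 v, fun v hv => ?_⟩
    exact Ideal.mem_of_dvd _ (Finset.dvd_prod_of_mem _ (hfin.mem_toFinset.2 hv)) (hg v)
  obtain ⟨s, hs⟩ := exists_norm_gt hf c0 (f.eval c0 * M) (mul_ne_zero hc0 hM0)
    |((Algebra.norm ℚ ((f.eval c0 : 𝓞 k) : k) : ℚ) : ℝ)|
  set c : 𝓞 k := c0 + f.eval c0 * M * s with hc
  obtain ⟨u, hu⟩ := Polynomial.sub_dvd_eval_sub c c0 f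
  have hcu : f.eval c = f.eval c0 * (1 + M * (s * u)) := by
    have : c - c0 = f.eval c0 * M * s := by rw [hc]; ring
    rw [this] at hu
    linear_combination hu
  have hnu : ¬ IsUnit (1 + M * (s * u)) := by
    intro h1
    rw [NumberField.isUnit_iff_norm, RingOfIntegers.coe_norm] at h1
    refine hs.ne ?_
    rw [hcu]
    change _ = |((Algebra.norm ℚ (algebraMap (𝓞 k) k _) : ℚ) : ℝ)|
    rw [map_mul, map_mul, Rat.cast_mul, abs_mul]
    have h2 : |((Algebra.norm ℚ (algebraMap (𝓞 k) k (1 + M * (s * u))) : ℚ) : ℝ)| = 1 := by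
      exact_mod_cast h1
    rw [h2, mul_one]
  obtain ⟨p, hp, hpu⟩ := exists_max_ideal_of_mem_nonunits hnu
  have hfc : f.eval c ≠ 0 := by
    intro h0
    have h1 : (1 + M * (s * u) : 𝓞 k) = 0 := by
      rw [h0] at hcu
      exact (mul_eq_zero.1 hcu.symm).resolve_left hc0
    rw [h0] at hs
    simp at hs
    exact absurd hs (not_lt.2 (abs_nonneg _))
  have h1u : (1 + M * (s * u) : 𝓞 k) ≠ 0 := fun h0 => hfc (by rw [hcu, h0, mul_zero])
  let r : HeightOneSpectrum (𝓞 k) := ⟨p, hp.isPrime, fun h0 => h1u (by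
    rw [h0] at hpu; simpa using hpu)⟩
  have hrS : r ∉ S' := by
    intro h1
    have h2 := hM r h1
    refine hp.ne_top ((Ideal.eq_top_iff_one _).2 ?_)
    have := Ideal.sub_mem _ hpu (Ideal.mul_mem_right (s * u) _ h2)
    simpa using this
  have hrd : d ∉ r.asIdeal := by
    intro h1
    refine hrS (Or.inr ?_)
    exact ((r.valuation_lt_one_iff_mem (K := k) _).2 (Ideal.mul_mem_right _ _ h1)).ne
  have hr1 : f.eval c ∈ r.asIdeal := by
    rw [hcu]; exact Ideal.mul_mem_left _ _ hpu
  have hr2 : f.derivative.eval c ∉ r.asIdeal := by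
    intro h1
    apply hrd
    have := congrArg (Polynomial.eval c) hAB
    rw [Polynomial.eval_add, Polynomial.eval_mul, Polynomial.eval_mul, Polynomial.eval_C] at this
    rw [← this]
    exact Ideal.add_mem _ (Ideal.mul_mem_left _ _ hr1) (Ideal.mul_mem_left _ _ h1)
  have hrS1 : r ∉ S := fun h1 => hrS (Or.inl h1)
  obtain ⟨π, -, hπ⟩ := exists_uniformizer r
  have hexp : ∀ x : 𝓞 k, x ∈ r.asIdeal → x ∉ r.asIdeal ^ 2 →
      r.valuation k (x : k) = WithZero.exp (-1 : ℤ) := by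
    intro x h1 h2
    rw [← pow_one r.asIdeal, ← r.intValuation_le_pow_iff_mem] at h1
    rw [← r.intValuation_le_pow_iff_mem, not_le] at h2
    have hx : r.intValuation x ≠ 0 := fun h0 => by rw [h0] at h2; simp at h2
    change r.valuation k (algebraMap (𝓞 k) k x) = _
    rw [r.valuation_of_algebraMap]
    rw [← WithZero.exp_log hx] at h1 h2 ⊢
    rw [WithZero.exp_le_exp] at h1
    rw [WithZero.exp_lt_exp] at h2
    congr 1
    push_cast at h1 h2
    omega
  by_cases h2 : f.eval c ∈ r.asIdeal ^ 2
  · obtain ⟨z, hz⟩ := f.binomExpansion c π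
    refine ⟨r, hrS1, c + π, hexp _ ?_ ?_⟩
    all_goals
      have hπm : π ∈ r.asIdeal := by
        rw [← r.valuation_lt_one_iff_mem (K := k), hπ]
        exact WithZero.exp_lt_exp.2 (by norm_num : (-1 : ℤ) < 0)
    · rw [hz]
      exact Ideal.add_mem _ (Ideal.add_mem _ hr1 (Ideal.mul_mem_left _ _ hπm))
        (Ideal.mul_mem_left _ _ (Ideal.pow_mem_of_mem _ hπm 2 two_pos))
    · intro h3
      have h4 : f.derivative.eval c * π ∈ r.asIdeal ^ 2 := by
        have := Ideal.sub_mem _ (Ideal.sub_mem _ h3 h2)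
          (Ideal.mul_mem_left _ z (Ideal.pow_mem_pow hπm 2))
        rw [hz] at this
        convert this using 1
        ring
      have h5 : π ∉ r.asIdeal ^ 2 := by
        intro h6
        rw [← r.intValuation_le_pow_iff_mem, ← r.valuation_of_algebraMap (K := k)] at h6
        change r.valuation k (π : k) ≤ _ at h6
        rw [hπ, WithZero.exp_le_exp] at h6
        norm_num at h6
      have h7 := r.isPrime.mul_mem_pow _ h4
      exact h7.elim (hr2) h5
  · exact ⟨r, hrS1, c, hexp _ hr1 h2⟩

theorem exists_seq_of_prime_value {F : k → k} (hF : ∀ S : Set (HeightOneSpectrum (𝓞 k)), S.Finite →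
    ∃ r ∉ S, ∃ c : k, r.valuation k (F c) = WithZero.exp (-1 : ℤ)) :
    ∃ c : ℕ → k, (∀ i, F (c i) ≠ 0) ∧ ∀ i j, i < j → ¬ IsSquare (F (c i) * F (c j)) := by
  refine exists_seq_of_forall_finset_exists (fun c => F c ≠ 0)
    (fun c c' => ¬ IsSquare (F c * F c')) fun s hs => ?_
  obtain ⟨r, hr, c, hc⟩ := hF (⋃ c ∈ s, {v | v.valuation k (F c) ≠ 1})
    (s.finite_toSet.biUnion fun c hc => finite_ne_one _ (hs c hc))
  have hc0 : F c ≠ 0 := fun h0 => by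
    rw [h0, map_zero] at hc; exact WithZero.exp_ne_zero hc.symm
  refine ⟨c, hc0, fun x hx => not_isSquare_of_odd (v := r) ?_⟩
  have h1 : r.valuation k (F x) = 1 := by
    by_contra h2
    exact hr (Set.mem_biUnion hx h2)
  rw [ordAt_mul r (hs x hx) hc0, ordAt_eq_zero h1, ordAt_eq_of_val hc]
  decide

/-- The values of a separable polynomial lie in infinitely many square classes. -/
theorem exists_seq_values {f : Polynomial k} (hf : 0 < f.natDegree) (hsep : f.Separable) :
    ∃ c : ℕ → k, (∀ i, f.eval (c i) ≠ 0) ∧ ∀ i j, i < j → ¬ IsSquare (f.eval (c i) * f.eval (c j)) := by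
  have hinj : Function.Injective (algebraMap (𝓞 k) k) := RingOfIntegers.coe_injective
  have hnorm : ∀ p : Polynomial k, ∃ (b : 𝓞 k) (q : Polynomial (𝓞 k)), b ≠ 0 ∧
      q.map (algebraMap (𝓞 k) k) = Polynomial.C (algebraMap (𝓞 k) k b) * p := by
    intro p
    obtain ⟨b, hb, h⟩ := IsLocalization.integerNormalization_spec (nonZeroDivisors (𝓞 k)) p
    refine ⟨b, IsLocalization.integerNormalization (nonZeroDivisors (𝓞 k)) p, nonZeroDivisors.ne_zero hb, ?_⟩
    rw [h, ← Polynomial.smul_eq_C_mul, algebraMap_smul]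
  obtain ⟨A, B, hAB⟩ := hsep
  obtain ⟨d, f0, hd, hf0⟩ := hnorm f
  obtain ⟨dA, A0, hdA, hA0⟩ := hnorm A
  obtain ⟨dB, B0, hdB, hB0⟩ := hnorm B
  have hdk : algebraMap (𝓞 k) k d ≠ 0 := by simpa using hd
  have hdeg : 0 < f0.natDegree := by
    rw [← Polynomial.natDegree_map_eq_of_injective hinj, hf0, Polynomial.natDegree_C_mul hdk]
    exact hf
  have hbez : (Polynomial.C dB * A0) * f0 + (Polynomial.C dA * B0) * f0.derivative =
      Polynomial.C (dA * dB * d) := by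
    apply Polynomial.map_injective _ hinj
    simp only [Polynomial.map_add, Polynomial.map_mul, Polynomial.map_C, ← Polynomial.derivative_map,
      hA0, hB0, hf0, Polynomial.derivative_C_mul, map_mul]
    linear_combination (Polynomial.C (algebraMap (𝓞 k) k dA) * Polynomial.C (algebraMap (𝓞 k) k dB)
      * Polynomial.C (algebraMap (𝓞 k) k d)) * hAB
  have hev : ∀ c : 𝓞 k, ((f0.eval c : 𝓞 k) : k) = algebraMap (𝓞 k) k d * f.eval (c : k) := by
    intro c
    have := congrArg (Polynomial.eval (algebraMap (𝓞 k) k c)) hf0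
    rw [Polynomial.eval_mul, Polynomial.eval_C, Polynomial.eval_map, Polynomial.eval₂_hom] at this
    exact this
  obtain ⟨c, h1, h2⟩ := exists_seq_of_prime_value
    (F := fun c => algebraMap (𝓞 k) k d * f.eval c) fun S hS => by
      obtain ⟨r, hr, c, hc⟩ := exists_prime_value hdeg (mul_ne_zero (mul_ne_zero hdA hdB) hd) hbez hS
      exact ⟨r, hr, c, by rw [← hev]; exact hc⟩
  refine ⟨c, fun i h0 => h1 i (by simp [h0]), fun i j hij ⟨y, hy⟩ => h2 i j hij
    ⟨algebraMap (𝓞 k) k d * y, ?_⟩⟩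
  linear_combination (algebraMap (𝓞 k) k d) ^ 2 * hy

theorem exists_seq_not_isSquare :
    ∃ c : ℕ → k, (∀ i, c i ≠ 0) ∧ ∀ i j, i < j → ¬ IsSquare (c i * c j) := by
  simpa using exists_seq_values (k := k) (f := Polynomial.X) (by simp) Polynomial.separable_X

theorem exists_odd_prime : ∃ v : HeightOneSpectrum (𝓞 k), v.valuation k 2 = 1 := by
  obtain ⟨r, hr, -⟩ := exists_prime_value (k := k) (f := Polynomial.X) (A := 0) (B := 1) (d := 1)
    (by simp) one_ne_zero (by simp) (finite_ne_one (2 : k) two_ne_zero)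
  exact ⟨r, not_not.1 hr⟩

theorem exists_ne_prime : ∃ q r : HeightOneSpectrum (𝓞 k), q ≠ r := by
  obtain ⟨r, hr⟩ := exists_odd_prime (k := k)
  obtain ⟨q, hq, -⟩ := exists_prime_value (k := k) (f := Polynomial.X) (A := 0) (B := 1) (d := 1)
    (by simp) one_ne_zero (by simp) (Set.finite_singleton r)
  exact ⟨q, r, hq⟩

/-- A nonsplit quaternion algebra over a number field. -/
theorem exists_anisotropic : ∃ a b : k, a ≠ 0 ∧ b ≠ 0 ∧ ¬ IsSquare a ∧
    ∀ x y z : k, a * x ^ 2 + b * y ^ 2 = z ^ 2 → x = 0 ∧ y = 0 ∧ z = 0 := by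
  obtain ⟨r, hr⟩ := exists_odd_prime (k := k)
  obtain ⟨π, -, hπ⟩ := exists_uniformizer r
  have := finite_quotient r
  have := r.isMaximal
  let _ : Field (𝓞 k ⧸ r.asIdeal) := Ideal.Quotient.field _
  have hchar : ringChar (𝓞 k ⧸ r.asIdeal) ≠ 2 := by
    intro h1
    have h2 : ((2 : ℕ) : 𝓞 k ⧸ r.asIdeal) = 0 := by rw [← h1]; exact ringChar.Nat.cast_ringChar
    have h3 : Ideal.Quotient.mk r.asIdeal 2 = 0 := by rw [map_ofNat]; exact_mod_cast h2
    have h4 := (r.valuation_lt_one_iff_mem (K := k) _).2 (Ideal.Quotient.eq_zero_iff_mem.1 h3)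
    change r.valuation k (algebraMap (𝓞 k) k 2) < 1 at h4
    rw [map_ofNat, hr] at h4
    exact lt_irrefl _ h4
  obtain ⟨a, ha⟩ := FiniteField.exists_nonsquare hchar
  obtain ⟨a, rfl⟩ := Ideal.Quotient.mk_surjective a
  -- `a` is a nonsquare unit at `r`
  have hns : ∀ z : k, ¬ r.valuation k ((a : k) - z ^ 2) < 1 := by
    intro z hz
    have ha1 : r.valuation k (a : k) ≤ 1 := r.valuation_le_one a
    have hz1 : r.valuation k z ≤ 1 := by
      by_contra hcon
      push Not at hcon
      have h1 : 1 < r.valuation k (z ^ 2) := by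
        rw [map_pow]; exact one_lt_pow₀ hcon two_ne_zero
      have h2 := Valuation.map_sub_eq_of_lt_right (r.valuation k) (lt_of_le_of_lt ha1 h1)
      rw [h2] at hz
      exact lt_asymm h1 hz
    obtain ⟨c, hc⟩ := exists_close r hz1
    apply ha
    refine ⟨Ideal.Quotient.mk _ c, ?_⟩
    rw [← map_mul, Ideal.Quotient.mk_eq_mk_iff_sub_mem, ← r.valuation_lt_one_iff_mem (K := k)]
    have e : ((a - c * c : 𝓞 k) : k) = ((a : k) - z ^ 2) - (((c : k) - z) * ((c : k) + z)) := by
      push_cast; ring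
    change r.valuation k ((a - c * c : 𝓞 k) : k) < 1
    rw [e]
    refine Valuation.map_sub_lt _ hz ?_
    rw [map_mul]
    exact mul_lt_one_of_lt_of_le hc (Valuation.map_add_le _ (r.valuation_le_one c) hz1)
  have ha0 : (a : k) ≠ 0 := fun h0 => hns 0 (by simp [h0])
  have hau : r.valuation k (a : k) = 1 := by
    refine (lt_or_eq_of_le (r.valuation_le_one a)).resolve_left fun h1 => hns 0 ?_
    simpa using h1
  have hπ0 : (π : k) ≠ 0 := fun h0 => by
    rw [h0, map_zero] at hπ; exact WithZero.exp_ne_zero hπ.symm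
  have hans : ¬ IsSquare (a : k) := by
    rintro ⟨z, hz⟩
    exact hns z (by rw [hz, ← pow_two, sub_self, map_zero]; exact zero_lt_one)
  refine ⟨a, π, ha0, hπ0, hans, fun x y z h => ?_⟩
  have hxz : ∀ z x : k, x ≠ 0 ∨ z ≠ 0 → Even (ordAt r (z ^ 2 - a * x ^ 2)) ∧ z ^ 2 - a * x ^ 2 ≠ 0 := by
    intro z x h0
    have hne : z ^ 2 - a * x ^ 2 ≠ 0 := by
      intro h1
      by_cases hx : x = 0
      · subst hx; simp at h1; simp [h1] at h0
      · refine hans ⟨z / x, ?_⟩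
        field_simp
        linear_combination -h1
    refine ⟨?_, hne⟩
    have hv : r.valuation k (a * x ^ 2) = r.valuation k x ^ 2 := by rw [map_mul, hau, one_mul, map_pow]
    rcases lt_trichotomy (r.valuation k x) (r.valuation k z) with h1 | h1 | h1
    · have : r.valuation k (z ^ 2 - a * x ^ 2) = r.valuation k (z ^ 2) :=
        Valuation.map_sub_eq_of_lt_left _ (by
          rw [hv, map_pow]; exact pow_lt_pow_left₀ h1 zero_le two_ne_zero)
      unfold ordAt; rw [this]; rw [← ordAt, ordAt_sq]; exact even_two_mul _
    · have hx : x ≠ 0 := by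
        rintro rfl
        rw [map_zero] at h1
        have := (map_eq_zero (r.valuation k)).1 h1.symm
        simp [this] at h0
      have hvx : r.valuation k x ≠ 0 := by simpa using hx
      have e : z ^ 2 - a * x ^ 2 = -((a : k) - (z / x) ^ 2) * x ^ 2 := by field_simp; ring
      have h2 : r.valuation k ((a : k) - (z / x) ^ 2) = 1 := by
        refine (lt_or_eq_of_le (Valuation.map_sub_le _ hau.le ?_)).resolve_left (hns _)
        rw [map_pow, map_div₀, h1, div_self (by rwa [← h1])]; simp
      have h3 : (a : k) - (z / x) ^ 2 ≠ 0 := fun h0 => by rw [h0] at h2; simp at h2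
      rw [e, ordAt_mul r (neg_ne_zero.2 h3) (pow_ne_zero 2 hx), ordAt_neg, ordAt_eq_zero h2, ordAt_sq,
        zero_add]
      exact even_two_mul _
    · have : r.valuation k (z ^ 2 - a * x ^ 2) = r.valuation k (a * x ^ 2) :=
        Valuation.map_sub_eq_of_lt_right _ (by
          rw [hv, map_pow]; exact pow_lt_pow_left₀ h1 zero_le two_ne_zero)
      unfold ordAt; rw [this, hv, ← map_pow]; rw [← ordAt, ordAt_sq]; exact even_two_mul _
  by_cases h0 : x ≠ 0 ∨ z ≠ 0
  · obtain ⟨h1, h2⟩ := hxz z x h0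
    have e : z ^ 2 - a * x ^ 2 = π * y ^ 2 := by linear_combination -h
    rw [e] at h1 h2
    have hy : y ^ 2 ≠ 0 := right_ne_zero_of_mul h2
    rw [ordAt_mul r hπ0 hy, ordAt_sq, ordAt_eq_of_val hπ] at h1
    exact absurd h1 (by rw [Int.not_even_iff_odd]; exact ⟨ordAt r y - 1, by ring⟩)
  · push Not at h0
    obtain ⟨rfl, rfl⟩ := h0
    refine ⟨rfl, ?_, rfl⟩
    simpa [hπ0] using h

end Primes

section Finiteness

/-- `L` is finite-dimensional over `k(s)`, expressed through relations with coefficients in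
`k[s]`. -/
def FinOver {k L : Type*} [Field k] [Field L] (ι : k →+* L) (s : L) : Prop :=
  ∃ N : ℕ, ∀ x : Fin N → L, ∃ p : Fin N → Polynomial k, p ≠ 0 ∧ ∑ i, (p i).eval₂ ι s * x i = 0

theorem finOver_ratFunc {k k' : Type*} [Field k] [Field k'] [Algebra k k'] [FiniteDimensional k k']
    (s : RatFunc k') : FinOver ((algebraMap k' (RatFunc k')).comp (algebraMap k k')) s := by
  classical
  obtain ⟨P, Q, hQ, rfl⟩ := IsFractionRing.div_surjective (A := Polynomial k') s
  have hQ0 : Q ≠ 0 := nonZeroDivisors.ne_zero hQ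
  set d := Module.finrank k k' with hd
  set e := max P.natDegree Q.natDegree with he
  refine ⟨d * e + 1, fun x => ?_⟩
  obtain ⟨⟨D, hD⟩, hA⟩ := IsLocalization.exist_integer_multiples_of_finite
    (nonZeroDivisors (Polynomial k')) x
  have hD0 : D ≠ 0 := nonZeroDivisors.ne_zero hD
  choose A hA using hA
  set f := Finset.univ.sup fun i => (A i).natDegree with hf
  set n := d * (f + 1) with hn
  let w : Fin (d * e + 1) × Fin (n + 1) → Polynomial k' := fun j =>
    P ^ (j.2 : ℕ) * Q ^ (n - j.2 : ℕ) * A j.1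
  have hw : ∀ j, (w j).natDegree ≤ n * e + f := by
    intro j
    have h1 : (P ^ (j.2 : ℕ)).natDegree ≤ j.2 * e :=
      Polynomial.natDegree_pow_le.trans (Nat.mul_le_mul_left _ (le_max_left _ _))
    have h2 : (Q ^ (n - j.2 : ℕ)).natDegree ≤ (n - j.2) * e :=
      Polynomial.natDegree_pow_le.trans (Nat.mul_le_mul_left _ (le_max_right _ _))
    have h3 : (A j.1).natDegree ≤ f :=
      Finset.le_sup (f := fun i => (A i).natDegree) (Finset.mem_univ j.1)
    refine (Polynomial.natDegree_mul_le.trans (Nat.add_le_add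
      (Polynomial.natDegree_mul_le.trans (Nat.add_le_add h1 h2)) h3)).trans (le_of_eq ?_)
    rw [← Nat.add_mul, Nat.add_sub_cancel' (Nat.lt_succ_iff.1 j.2.2)]
  let T : (Fin (d * e + 1) × Fin (n + 1) → k) →ₗ[k] (Fin (n * e + f + 1) → k') :=
    { toFun := fun c l => (∑ j, c j • w j).coeff l
      map_add' := fun a b => by
        ext l
        simp [add_smul, Finset.sum_add_distrib]
      map_smul' := fun r a => by
        ext l
        simp [mul_smul, Finset.smul_sum] }
  have hdim : Module.finrank k (Fin (n * e + f + 1) → k') <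
      Module.finrank k (Fin (d * e + 1) × Fin (n + 1) → k) := by
    rw [Module.finrank_pi_fintype, Module.finrank_fintype_fun_eq_card]
    simp only [Finset.sum_const, Finset.card_univ, Fintype.card_fin, smul_eq_mul, Fintype.card_prod]
    rw [← hd, hn]
    nlinarith [Nat.zero_le (d * e)]
  obtain ⟨c, hc, hc0⟩ := Submodule.exists_mem_ne_zero_of_ne_bot
    (LinearMap.ker_ne_bot_of_finrank_lt (f := T) hdim)
  have hsum : ∑ j, c j • w j = 0 := by
    ext l
    by_cases hl : l < n * e + f + 1
    · exact congrFun (LinearMap.mem_ker.1 hc) ⟨l, hl⟩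
    · rw [Polynomial.coeff_zero]
      refine Polynomial.coeff_eq_zero_of_natDegree_lt (lt_of_le_of_lt
        (Polynomial.natDegree_sum_le_of_forall_le _ _ fun j _ =>
          (Polynomial.natDegree_smul_le _ _).trans (hw j)) (by omega))
  refine ⟨fun i => ∑ l : Fin (n + 1), Polynomial.monomial (l : ℕ) (c (i, l)), fun h0 => hc0 ?_, ?_⟩
  · ext ⟨i, l⟩
    have := congrArg (fun p => Polynomial.coeff p l) (congrFun h0 i)
    simpa [Polynomial.finsetSum_coeff, Polynomial.coeff_monomial, Fin.val_inj] using this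
  · have hQm : algebraMap (Polynomial k') (RatFunc k') Q ≠ 0 := by
      simpa using hQ0
    have hDm : algebraMap (Polynomial k') (RatFunc k') D ≠ 0 := by
      simpa using hD0
    refine (mul_eq_zero.1 (?_ : (algebraMap (Polynomial k') (RatFunc k') Q ^ n *
      algebraMap (Polynomial k') (RatFunc k') D) * _ = 0)).resolve_left
        (mul_ne_zero (pow_ne_zero _ hQm) hDm)
    have h2 := congrArg (algebraMap (Polynomial k') (RatFunc k')) hsum
    rw [map_sum, map_zero, Fintype.sum_prod_type] at h2
    rw [← h2, Finset.mul_sum]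
    refine Finset.sum_congr rfl fun i _ => ?_
    rw [Polynomial.eval₂_finsetSum, Finset.sum_mul, Finset.mul_sum]
    refine Finset.sum_congr rfl fun l _ => ?_
    have hAi : algebraMap (Polynomial k') (RatFunc k') (A i) =
        algebraMap (Polynomial k') (RatFunc k') D * x i := by
      rw [hA, Algebra.smul_def]
    rw [Polynomial.eval₂_monomial, Algebra.smul_def, map_mul, map_mul, map_mul, map_pow, map_pow, hAi,
      ← IsScalarTower.algebraMap_apply k (Polynomial k') (RatFunc k'), RingHom.comp_apply,
      ← IsScalarTower.algebraMap_apply k k' (RatFunc k')]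
    have hpow : algebraMap (Polynomial k') (RatFunc k') Q ^ n =
        algebraMap (Polynomial k') (RatFunc k') Q ^ (l : ℕ) *
        algebraMap (Polynomial k') (RatFunc k') Q ^ (n - l : ℕ) := by
      rw [← pow_add, Nat.add_sub_cancel' (Nat.lt_succ_iff.1 l.2)]
    rw [hpow, div_pow]
    field_simp

theorem FinOver.of_hom {k L M : Type*} [Field k] [Field L] [Field M] {ι : k →+* L} (φ : L →+* M)
    {s : L} (h : FinOver (φ.comp ι) (φ s)) : FinOver ι s := by
  obtain ⟨N, hN⟩ := h
  refine ⟨N, fun x => ?_⟩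
  obtain ⟨p, hp, h⟩ := hN fun i => φ (x i)
  refine ⟨p, hp, φ.injective ?_⟩
  rw [map_zero, ← h, map_sum]
  exact Finset.sum_congr rfl fun i _ => by rw [map_mul, Polynomial.hom_eval₂]

end Finiteness

section Special

/-- A field in which binary forms `⟨1, r⟩` with `r` a nonsquare represent many classes, and in which
representation by such forms is transitive. -/
structure SpecialField (κ : Type*) [Field κ] : Prop where
  exists_rep : ∀ r : κ, ¬ IsSquare r → ∃ x y : κ, ¬ IsSquare (x ^ 2 + r * y ^ 2) ∧
    ¬ IsSquare ((x ^ 2 + r * y ^ 2) * r)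
  trans : ∀ r q p : κ, ¬ IsSquare r → ¬ IsSquare q → p ≠ 0 → (∃ x y, q = x ^ 2 + r * y ^ 2) →
    (∃ x y, p = x ^ 2 + q * y ^ 2) → ∃ x y, p = x ^ 2 + r * y ^ 2

theorem specialField_charTwo {κ : Type*} [Field κ] (h2 : (2 : κ) = 0) : SpecialField κ where
  exists_rep := by
    intro r hr
    refine ⟨1, 1, ?_, ?_⟩
    · rintro ⟨x, hx⟩
      exact hr ⟨x + 1, by linear_combination hx - (x + 1) * h2⟩
    · rintro ⟨x, hx⟩
      exact hr ⟨x + r, by linear_combination hx - (x * r + r ^ 2) * h2⟩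
  trans := by
    rintro r q p - - - ⟨x, y, rfl⟩ ⟨u, w, rfl⟩
    exact ⟨u + x * w, y * w, by linear_combination (-(u * x * w)) * h2⟩

open WithZero in
/-- A field with a suitable discrete valuation is not special. -/
theorem not_specialField {F : Type*} [Field F] (v : Valuation F (WithZero (Multiplicative ℤ)))
    {ϖ u : F} (hϖ : v ϖ < 1) (hϖ' : Odd (log (v ϖ))) (h2 : v 2 = 1) (hneg : IsSquare (-1 : F))
    (hu : v u = 1) (hu' : ∀ z, ¬ v (u - z ^ 2) < 1) : ¬ SpecialField F := by
  intro hF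
  obtain ⟨i, hi⟩ := hneg
  have hϖ0 : ϖ ≠ 0 := by
    rintro rfl
    simp at hϖ'
  have hlog : ∀ x : F, x ≠ 0 → log (v (x ^ 2)) = 2 * log (v x) := fun x hx => by
    rw [map_pow, log_pow]; simp
  have hlogm : ∀ x y : F, x ≠ 0 → y ≠ 0 → log (v (x * y)) = log (v x) + log (v y) :=
    fun x y hx hy => by
      rw [map_mul, log_mul] <;> simpa
  have hodd : ∀ x : F, Odd (log (v x)) → ¬ IsSquare x := by
    rintro x hx ⟨y, rfl⟩
    by_cases hy : y = 0
    · simp [hy] at hx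
    · rw [← pow_two, hlog y hy] at hx
      exact (Int.not_odd_iff_even.2 (even_two_mul _)) hx
  -- elements of even order represented by the form are dominated by the square
  have key : ∀ x y p : F, p = x ^ 2 + ϖ * y ^ 2 → p ≠ 0 → Even (log (v p)) →
      x ≠ 0 ∧ v (ϖ * y ^ 2) < v (x ^ 2) := by
    rintro x y p hp hp0 hev
    have hx : x ≠ 0 := by
      rintro rfl
      have hy : y ≠ 0 := by rintro rfl; simp at hp; exact hp0 hp
      have : p = ϖ * y ^ 2 := by rw [hp]; ring
      rw [this, hlogm _ _ hϖ0 (pow_ne_zero 2 hy), hlog y hy] at hev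
      exact (Int.not_even_iff_odd.2 (hϖ'.add_even (even_two_mul _))) hev
    refine ⟨hx, ?_⟩
    by_contra hle
    rw [not_lt] at hle
    by_cases hy : y = 0
    · simp [hy] at hle
      exact hx hle
    have hodd' : Odd (log (v (ϖ * y ^ 2))) := by
      rw [hlogm _ _ hϖ0 (pow_ne_zero 2 hy), hlog y hy]
      exact hϖ'.add_even (even_two_mul _)
    rcases hle.lt_or_eq with h | h
    · have : v p = v (ϖ * y ^ 2) := by rw [hp]; exact Valuation.map_add_eq_of_lt_right _ h
      rw [this] at hev
      exact Int.not_even_iff_odd.2 hodd' hev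
    · rw [← h, hlog x hx] at hodd'
      exact Int.not_odd_iff_even.2 (even_two_mul _) hodd'
  obtain ⟨h, hD, hns, hev⟩ : ∃ h : F, (∃ x y, h = x ^ 2 + ϖ * y ^ 2) ∧ ¬ IsSquare h ∧
      Even (log (v h)) := by
    obtain ⟨x, y, h1, h2⟩ := hF.exists_rep ϖ (hodd _ hϖ')
    have hn0 : x ^ 2 + ϖ * y ^ 2 ≠ 0 := fun h0 => h1 (h0 ▸ ⟨0, by simp⟩)
    rcases Int.even_or_odd (log (v (x ^ 2 + ϖ * y ^ 2))) with he | ho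
    · exact ⟨_, ⟨x, y, rfl⟩, h1, he⟩
    · refine ⟨_, ⟨ϖ * y, x, ?_⟩, h2, ?_⟩
      · ring
      · rw [hlogm _ _ hn0 hϖ0]
        exact ho.add_odd hϖ'
  have hh0 : h ≠ 0 := fun h0 => hns (h0 ▸ ⟨0, by simp⟩)
  obtain ⟨x, y, hxy⟩ := hD
  obtain ⟨hx, hlt'⟩ := key x y h hxy hh0 hev
  set q := 1 + ϖ * (y / x) ^ 2 with hq
  have hqh : h = q * x ^ 2 := by rw [hxy, hq]; field_simp
  have hqm : v (q - 1) < 1 := by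
    have : q - 1 = (ϖ * y ^ 2) / x ^ 2 := by rw [hq]; field_simp; ring
    rw [this, map_div₀]
    exact (div_lt_one₀ (by simpa [zero_lt_iff] using hx)).2 hlt'
  have hqs : ¬ IsSquare q := by
    rintro ⟨c, hc⟩
    exact hns ⟨c * x, by rw [hqh, hc]; ring⟩
  have h20 : (2 : F) ≠ 0 := by intro h0; simp [h0] at h2
  set α := (u + 1) / 2
  set β := (u - 1) / 2
  have hαβ : α ^ 2 - β ^ 2 = u := by simp only [α, β]; field_simp; ring
  have hβ : v β ≤ 1 := by
    simp only [β]
    rw [map_div₀, h2, div_one]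
    exact Valuation.map_sub_le _ hu.le (by simp)
  set p := α ^ 2 + q * (i * β) ^ 2 with hp
  have hpu : v (p - u) < 1 := by
    have : p - u = -((q - 1) * β ^ 2) := by
      rw [← hαβ, hp]
      linear_combination (-(q * β ^ 2)) * hi
    rw [this, Valuation.map_neg, map_mul, map_pow]
    exact mul_lt_one_of_nonneg_of_lt_one_left zero_le hqm (pow_le_one₀ zero_le hβ)
  have hvp : v p = 1 := by
    have := Valuation.map_add_eq_of_lt_right v (x := p - u) (y := u) (by rwa [hu])
    rwa [sub_add_cancel, hu] at this
  have hp0 : p ≠ 0 := by intro h0; simp [h0] at hvp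
  obtain ⟨X, Y, hXY⟩ := hF.trans ϖ q p (hodd _ hϖ') hqs hp0 ⟨1, y / x, by rw [hq]; ring⟩ ⟨_, _, hp⟩
  obtain ⟨hX, hXY'⟩ := key X Y p hXY hp0 (by rw [hvp]; simp)
  have hvX : v (X ^ 2) = 1 := by
    rw [← hvp, hXY]
    exact (Valuation.map_add_eq_of_lt_left v hXY').symm.trans (by rw [add_comm])
  refine hu' X ?_
  have : u - X ^ 2 = ϖ * Y ^ 2 - (p - u) := by rw [hXY]; ring
  rw [this]
  exact Valuation.map_sub_lt _ (hvX ▸ hXY') hpu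

end Special

section SpecialVal

open SqGroup IsLocalRing

variable {E : Type*} [Field E]

/-- `p` is represented by the form `⟨1, r⟩` modulo `T`. -/
def RepMod (T : SqGroup E) (r p : E) : Prop :=
  ∃ s t, (s = 0 ∨ s ∈ T) ∧ (t = 0 ∨ t ∈ T) ∧ p = s + r * t

/-- The version of `SpecialField` relative to a pair of square class groups. -/
structure Special (T H : SqGroup E) : Prop where
  exists_rep : ∀ r, r ∈ H → r ∉ T → ∃ h, h ≠ 0 ∧ RepMod T r h ∧ h ∉ T ∧ h * r ∉ T
  trans : ∀ r q p, r ∈ H → r ∉ T → q ∈ H → q ∉ T → p ≠ 0 → RepMod T r q → RepMod T q p →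
    RepMod T r p

theorem RepMod.mul_sq {T : SqGroup E} {r p z : E} (hz : z ≠ 0) (h : RepMod T r p) :
    RepMod T r (p * z ^ 2) := by
  obtain ⟨s, t, hs, ht, rfl⟩ := h
  refine ⟨s * z ^ 2, t * z ^ 2, ?_, ?_, by ring⟩
  · exact hs.imp (fun h => by simp [h]) (fun h => (mul_sq_iff hz).2 h)
  · exact ht.imp (fun h => by simp [h]) (fun h => (mul_sq_iff hz).2 h)

theorem RepMod.form_mul_sq {T : SqGroup E} {r p z : E} (hz : z ≠ 0) (h : RepMod T r p) :
    RepMod T (r * z ^ 2) p := by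
  obtain ⟨s, t, hs, ht, rfl⟩ := h
  refine ⟨s, t * z⁻¹ ^ 2, hs, ?_, by field_simp⟩
  exact ht.imp (fun h => by simp [h]) (fun h => (mul_sq_iff (inv_ne_zero hz)).2 h)

theorem RepMod.mul_sq_iff {T : SqGroup E} {r p z : E} (hz : z ≠ 0) :
    RepMod T r (p * z ^ 2) ↔ RepMod T r p :=
  ⟨fun h => by
    have := h.mul_sq (inv_ne_zero hz)
    have e : p * z ^ 2 * z⁻¹ ^ 2 = p := by field_simp
    rwa [e] at this, fun h => h.mul_sq hz⟩

theorem RepMod.form_mul_sq_iff {T : SqGroup E} {r p z : E} (hz : z ≠ 0) :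
    RepMod T (r * z ^ 2) p ↔ RepMod T r p :=
  ⟨fun h => by
    have := h.form_mul_sq (inv_ne_zero hz)
    have e : r * z ^ 2 * z⁻¹ ^ 2 = r := by field_simp
    rwa [e] at this, fun h => h.form_mul_sq hz⟩

section Transfer

variable {K L : Type*} [Field K] [Field L] {R : WittRel K L}

theorem WittRel.repMod {T : SqGroup K} {T' : SqGroup L} (hT : ∀ x y, R.rel x y → (x ∈ T ↔ y ∈ T'))
    {r p : K} {r' p' : L} (hr : R.rel r r') (hp : R.rel p p') (h : RepMod T r p) :
    RepMod T' r' p' := by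
  obtain ⟨s, t, hs, ht, e⟩ := h
  rcases hs with rfl | hs
  · rcases ht with rfl | ht
    · simp at e
      exact absurd e (R.ne_zero hp)
    · obtain ⟨t', ht'⟩ := R.total t (SqGroup.ne_zero ht)
      have h1 := R.mul hr ht'
      rw [zero_add] at e
      rw [← e] at h1
      obtain ⟨z, hz, e'⟩ := R.inj' h1 hp
      refine ⟨0, t' * z ^ 2, Or.inl rfl, Or.inr ((SqGroup.mul_sq_iff hz).2 ((hT _ _ ht').1 ht)), ?_⟩
      rw [e']; ring
  · obtain ⟨s', hs'⟩ := R.total s (SqGroup.ne_zero hs)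
    have hs'T := (hT _ _ hs').1 hs
    rcases ht with rfl | ht
    · rw [mul_zero, add_zero] at e
      rw [← e] at hs'
      obtain ⟨z, hz, e'⟩ := R.inj' hs' hp
      exact ⟨s' * z ^ 2, 0, Or.inr ((SqGroup.mul_sq_iff hz).2 hs'T), Or.inl rfl, by rw [e']; ring⟩
    · obtain ⟨t', ht'⟩ := R.total t (SqGroup.ne_zero ht)
      have ht'T := (hT _ _ ht').1 ht
      obtain ⟨x, y, e'⟩ := R.rep hs' (R.mul hr ht') hp ⟨1, 1, by rw [e]; ring⟩
      refine ⟨s' * x ^ 2, t' * y ^ 2, ?_, ?_, by rw [e']; ring⟩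
      · by_cases hx : x = 0
        · simp [hx]
        · exact Or.inr ((SqGroup.mul_sq_iff hx).2 hs'T)
      · by_cases hy : y = 0
        · simp [hy]
        · exact Or.inr ((SqGroup.mul_sq_iff hy).2 ht'T)

theorem WittRel.special {T H : SqGroup K} {T' H' : SqGroup L}
    (hT : ∀ x y, R.rel x y → (x ∈ T ↔ y ∈ T')) (hH : ∀ x y, R.rel x y → y ∈ H' → x ∈ H)
    (h : Special T H) : Special T' H' := by
  have hT' : ∀ y x, R.symm.rel y x → (y ∈ T' ↔ x ∈ T) := fun y x h => (hT x y h).symm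
  constructor
  · intro r' hr' hrT'
    have hr0 : r' ≠ 0 := SqGroup.ne_zero hr'
    obtain ⟨r, hr⟩ := R.total' r' hr0
    obtain ⟨x, hx0, hx, hxT, hxrT⟩ := h.exists_rep r (hH _ _ hr hr') (fun h => hrT' ((hT _ _ hr).1 h))
    obtain ⟨x', hx'⟩ := R.total x hx0
    exact ⟨x', R.ne_zero' hx', WittRel.repMod hT hr hx' hx, fun h => hxT ((hT _ _ hx').2 h),
      fun h => hxrT ((hT _ _ (R.mul hx' hr)).2 h)⟩
  · intro r' q' p' hr' hrT' hq' hqT' hp' h1 h2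
    obtain ⟨r, hr⟩ := R.total' r' (SqGroup.ne_zero hr')
    obtain ⟨q, hq⟩ := R.total' q' (SqGroup.ne_zero hq')
    obtain ⟨p, hp⟩ := R.total' p' hp'
    refine WittRel.repMod hT hr hp (h.trans r q p (hH _ _ hr hr') (fun h => hrT' ((hT _ _ hr).1 h))
      (hH _ _ hq hq') (fun h => hqT' ((hT _ _ hq).1 h)) (R.ne_zero hp) ?_ ?_)
    · exact WittRel.repMod (R := R.symm) hT' hr hq h1
    · exact WittRel.repMod (R := R.symm) hT' hq hp h2

end Transfer

variable {O : ValuationSubring E}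

theorem residue_eq_zero_iff' (a : O) : residue O a = 0 ↔ O.valuation (a : E) < 1 := by
  rw [residue_eq_zero_iff, ← ValuationSubring.valuation_lt_one_iff]

theorem residue_eq_iff (a b : O) : residue O a = residue O b ↔ O.valuation ((a : E) - b) < 1 := by
  rw [← sub_eq_zero, ← map_sub, residue_eq_zero_iff']
  rfl

theorem residue_ne_zero_iff (a : O) : residue O a ≠ 0 ↔ O.valuation (a : E) = 1 := by
  rw [Ne, residue_eq_zero_iff', not_lt]
  exact ⟨fun h => le_antisymm (O.valuation_le_one a) h, fun h => h.ge⟩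

theorem isSquare_residue_iff {a : O} (ha : O.valuation (a : E) = 1) :
    IsSquare (residue O a) ↔ (a : E) ∈ oneUnits O := by
  constructor
  · rintro ⟨y, hy⟩
    obtain ⟨y, rfl⟩ := residue_surjective y
    have hy0 : residue O y ≠ 0 := by
      intro h0
      rw [h0, mul_zero] at hy
      exact (residue_ne_zero_iff a).2 ha hy
    have hy1 := (residue_ne_zero_iff y).1 hy0
    have hyE : (y : E) ≠ 0 := by intro h0; simp [h0] at hy1
    rw [← map_mul, residue_eq_iff] at hy
    refine ⟨(y : E)⁻¹, inv_ne_zero hyE, ?_⟩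
    have e : (a : E) * (y : E)⁻¹ ^ 2 - 1 = ((a : E) - (y * y : O)) * (y : E)⁻¹ ^ 2 := by
      push_cast
      field_simp
    rw [e, map_mul, map_pow, map_inv₀, hy1]
    simpa using hy
  · rintro ⟨y, hy0, hy⟩
    have hy1 : O.valuation (y ^ 2) = 1 := by
      have := val_eq_one_of_sub hy
      rwa [map_mul, ha, one_mul] at this
    have hy2 : O.valuation y = 1 := by
      rw [map_pow] at hy1
      exact (pow_eq_one_iff_of_nonneg zero_le two_ne_zero).1 hy1
    have hyO : y⁻¹ ∈ O := (ValuationSubring.valuation_le_one_iff _ _).1 (by rw [map_inv₀, hy2, inv_one])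
    refine ⟨residue O ⟨y⁻¹, hyO⟩, ?_⟩
    rw [← map_mul, residue_eq_iff]
    have e : (a : E) - ((⟨y⁻¹, hyO⟩ * ⟨y⁻¹, hyO⟩ : O) : E) = (a * y ^ 2 - 1) * y⁻¹ ^ 2 := by
      push_cast
      field_simp
    rw [e, map_mul, map_pow, map_inv₀, hy2]
    simpa using hy

theorem repMod_of_residue {r p : O} (hr : O.valuation (r : E) = 1) (hp : O.valuation (p : E) = 1)
    (h : ∃ x y, residue O p = x ^ 2 + residue O r * y ^ 2) :
    RepMod (oneUnits O) (r : E) (p : E) := by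
  obtain ⟨x, y, h⟩ := h
  obtain ⟨x, rfl⟩ := residue_surjective x
  obtain ⟨y, rfl⟩ := residue_surjective y
  by_cases hx : residue O x = 0
  · have hy : residue O y ≠ 0 := by
      intro hy
      rw [hx, hy] at h
      exact (residue_ne_zero_iff p).2 hp (by simpa using h)
    have hr' := (residue_ne_zero_iff r).2 hr
    have hrE : (r : E) ≠ 0 := by intro h0; simp [h0] at hr
    have hrO : (r : E)⁻¹ ∈ O :=
      (ValuationSubring.valuation_le_one_iff _ _).1 (by rw [map_inv₀, hr, inv_one])
    have hprr : residue O (p * ⟨_, hrO⟩) = residue O y * residue O y := by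
      apply mul_left_cancel₀ hr'
      have : r * (p * ⟨_, hrO⟩) = p := Subtype.ext (by push_cast; field_simp)
      rw [← map_mul, this, h, hx]; ring
    refine ⟨0, p * (r : E)⁻¹, Or.inl rfl, Or.inr ?_, by field_simp; ring⟩
    refine (isSquare_residue_iff (a := p * ⟨_, hrO⟩) ?_).1 ⟨_, hprr⟩
    push_cast
    rw [map_mul, hp, map_inv₀, hr, inv_one, mul_one]
  · refine ⟨p - r * (y : E) ^ 2, (y : E) ^ 2, Or.inr ?_, ?_, by ring⟩
    · have hres : residue O (p - r * y ^ 2) = residue O x * residue O x := by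
        rw [map_sub, map_mul, map_pow, h]; ring
      have := (isSquare_residue_iff (a := p - r * y ^ 2) ?_).1 ⟨_, hres⟩
      · simpa using this
      · rw [← residue_ne_zero_iff, hres]
        exact mul_ne_zero hx hx
    · by_cases hy : (y : E) = 0
      · simp [hy]
      · exact Or.inr (SqGroup.sq _ hy)

theorem residue_of_repMod {r p : E} (hneg : (-1 : E) ∈ oneUnits O) (hr : O.valuation r = 1)
    (hrT : r ∉ oneUnits O) (hp : p ≠ 0) (h : RepMod (oneUnits O) r p) :
    ∃ z, z ≠ 0 ∧ O.valuation (p * z ^ 2) = 1 ∧ ∀ (r' p' : O), (r' : E) = r → (p' : E) = p * z ^ 2 →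
      ∃ x y, residue O p' = x ^ 2 + residue O r' * y ^ 2 := by
  have lift : ∀ x : E, O.valuation x ≤ 1 → ∃ x' : O, (x' : E) = x := fun x hx =>
    ⟨⟨x, (ValuationSubring.valuation_le_one_iff _ _).1 hx⟩, rfl⟩
  have hnsq : ∀ r' : O, (r' : E) = r → ∀ c, residue O r' ≠ -c ^ 2 := by
    intro r' hr' c hc
    have h1 : IsSquare (residue O (-1)) := (isSquare_residue_iff (by simp)).2 (by simpa using hneg)
    refine hrT (hr' ▸ (isSquare_residue_iff (a := r') (hr' ▸ hr)).1 ?_)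
    rw [hc, neg_eq_neg_one_mul]
    rw [map_neg, map_one] at h1
    exact h1.mul (IsSquare.sq c)
  obtain ⟨s, t, hs, ht, rfl⟩ := h
  rcases hs with rfl | ⟨u, hu0, hu⟩
  · rcases ht with rfl | ⟨w, hw0, hw⟩
    · simp at hp
    · have e : (0 + r * t) * w ^ 2 = r * (t * w ^ 2 - 1) + r := by ring
      have hlt : O.valuation (r * (t * w ^ 2 - 1)) < 1 := by rw [map_mul, hr, one_mul]; exact hw
      refine ⟨w, hw0, ?_, fun r' p' hr' hp' => ⟨0, 1, ?_⟩⟩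
      · rw [e, Valuation.map_add_eq_of_lt_right _ (by rwa [hr]), hr]
      · rw [zero_pow two_ne_zero, one_pow, mul_one, zero_add, residue_eq_iff, hp', hr', e]
        simpa using hlt
  · rcases ht with rfl | ⟨w, hw0, hw⟩
    · refine ⟨u, hu0, ?_, fun r' p' hr' hp' => ⟨1, 0, ?_⟩⟩
      · simpa using val_eq_one_of_sub hu
      · rw [zero_pow two_ne_zero, one_pow, mul_zero, add_zero, ← map_one (residue O), residue_eq_iff,
          hp']
        simpa using hu
    · -- both terms are present: scale by the dominating one
      have main : ∀ (z a b : E), z ≠ 0 → O.valuation a ≤ 1 → O.valuation b ≤ 1 →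
          (a = 1 ∨ b = 1) → O.valuation ((s + r * t) * z ^ 2 - (a ^ 2 + r * b ^ 2)) < 1 →
          ∃ z, z ≠ 0 ∧ O.valuation ((s + r * t) * z ^ 2) = 1 ∧ ∀ (r' p' : O), (r' : E) = r →
            (p' : E) = (s + r * t) * z ^ 2 → ∃ x y, residue O p' = x ^ 2 + residue O r' * y ^ 2 := by
        intro z a b hz ha hb hab hlt
        obtain ⟨a', rfl⟩ := lift a ha
        obtain ⟨b', rfl⟩ := lift b hb
        obtain ⟨r', hr'⟩ := lift r hr.le
        have h1 : O.valuation (((a' ^ 2 + r' * b' ^ 2 : O)) : E) = 1 := by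
          rw [← residue_ne_zero_iff, map_add, map_mul, map_pow, map_pow]
          intro h0
          have hr'0 := (residue_ne_zero_iff r').2 (hr' ▸ hr)
          rcases hab with h | h
          · have : a' = 1 := Subtype.ext h
            rw [this, map_one, one_pow] at h0
            have hb0 : residue O b' ≠ 0 := by
              intro hb0; rw [hb0] at h0; simp at h0
            exact hnsq r' hr' (residue O b')⁻¹ (by field_simp; linear_combination h0)
          · have : b' = 1 := Subtype.ext h
            rw [this, map_one, one_pow, mul_one] at h0
            exact hnsq r' hr' (residue O a') (by linear_combination h0)
        push_cast at h1
        rw [hr'] at h1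
        refine ⟨z, hz, ?_, fun r'' p' hr'' hp' => ⟨residue O a', residue O b', ?_⟩⟩
        · have := Valuation.map_add_eq_of_lt_right O.valuation (h1.symm ▸ hlt)
          rw [sub_add_cancel] at this
          rw [this, h1]
        · rw [← map_pow, ← map_pow, ← map_mul, ← map_add, residue_eq_iff, hp']
          push_cast
          rw [hr'']
          exact hlt
      rcases le_total (O.valuation (u / w)) 1 with hle | hle
      · refine main u 1 (u / w) hu0 (by simp) hle (Or.inl rfl) ?_
        have e : (s + r * t) * u ^ 2 - (1 ^ 2 + r * (u / w) ^ 2) =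
            (s * u ^ 2 - 1) + r * ((t * w ^ 2 - 1) * (u / w) ^ 2) := by field_simp; ring
        rw [e]
        refine Valuation.map_add_lt _ hu ?_
        rw [map_mul, hr, one_mul, map_mul, map_pow]
        exact mul_lt_one_of_nonneg_of_lt_one_left zero_le hw (pow_le_one₀ zero_le hle)
      · have hle' : O.valuation (w / u) ≤ 1 := by
          rw [← inv_div, map_inv₀]
          exact inv_le_one_of_one_le₀ hle
        refine main w (w / u) 1 hw0 hle' (by simp) (Or.inr rfl) ?_
        have e : (s + r * t) * w ^ 2 - ((w / u) ^ 2 + r * 1 ^ 2) =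
            (s * u ^ 2 - 1) * (w / u) ^ 2 + r * (t * w ^ 2 - 1) := by field_simp; ring
        rw [e]
        refine Valuation.map_add_lt _ ?_ ?_
        · rw [map_mul, map_pow]
          exact mul_lt_one_of_nonneg_of_lt_one_left zero_le hu (pow_le_one₀ zero_le hle')
        · rw [map_mul, hr, one_mul]
          exact hw

theorem specialField_of_special (hneg : (-1 : E) ∈ oneUnits O)
    (h : Special (oneUnits O) (unitsSq O)) : SpecialField (ResidueField O) := by
  have val : ∀ a : O, ¬ IsSquare (residue O a) → O.valuation (a : E) = 1 ∧ (a : E) ∉ oneUnits O :=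
    fun a ha => by
      have h1 : O.valuation (a : E) = 1 := (residue_ne_zero_iff a).1 fun h0 => ha (h0 ▸ ⟨0, by simp⟩)
      exact ⟨h1, fun h2 => ha ((isSquare_residue_iff h1).2 h2)⟩
  constructor
  · intro r hr
    obtain ⟨r, rfl⟩ := residue_surjective r
    obtain ⟨hr1, hrT⟩ := val r hr
    obtain ⟨x, hx0, hx, hxT, hxrT⟩ := h.exists_rep r (unit_mem_unitsSq hr1) hrT
    obtain ⟨z, hz, hz1, hz2⟩ := residue_of_repMod hneg hr1 hrT hx0 hx
    let p' : O := ⟨x * z ^ 2, (ValuationSubring.valuation_le_one_iff _ _).1 hz1.le⟩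
    obtain ⟨a, b, hab⟩ := hz2 r p' rfl rfl
    refine ⟨a, b, ?_, ?_⟩
    · rw [← hab, isSquare_residue_iff hz1]
      exact fun h => hxT ((SqGroup.mul_sq_iff hz).1 h)
    · rw [← hab, ← map_mul, isSquare_residue_iff (by push_cast; rw [map_mul, hz1, hr1, one_mul])]
      intro h
      refine hxrT ((SqGroup.mul_sq_iff hz).1 ?_)
      convert h using 1
      push_cast
      ring
  · intro r q p hr hq hp h1 h2
    obtain ⟨r, rfl⟩ := residue_surjective r
    obtain ⟨q, rfl⟩ := residue_surjective q
    obtain ⟨p, rfl⟩ := residue_surjective p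
    obtain ⟨hr1, hrT⟩ := val r hr
    obtain ⟨hq1, hqT⟩ := val q hq
    have hp1 := (residue_ne_zero_iff p).1 hp
    have hp0 : (p : E) ≠ 0 := by intro h0; simp [h0] at hp1
    obtain ⟨z, hz, hz1, hz2⟩ := residue_of_repMod hneg hr1 hrT hp0
      (h.trans r q p (unit_mem_unitsSq hr1) hrT (unit_mem_unitsSq hq1) hqT hp0
        (repMod_of_residue hr1 hq1 h1) (repMod_of_residue hq1 hp1 h2))
    have hzv : O.valuation z = 1 := by
      rw [map_mul, hp1, one_mul, map_pow] at hz1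
      exact (pow_eq_one_iff_of_nonneg zero_le two_ne_zero).1 hz1
    let z' : O := ⟨z, (ValuationSubring.valuation_le_one_iff _ _).1 hzv.le⟩
    have hz'0 : residue O z' ≠ 0 := (residue_ne_zero_iff z').2 hzv
    obtain ⟨a, b, hab⟩ := hz2 r (p * z' ^ 2) rfl (by push_cast; rfl)
    refine ⟨a / residue O z', b / residue O z', ?_⟩
    rw [map_mul, map_pow] at hab
    field_simp
    exact hab

theorem special_of_specialField (hneg : (-1 : E) ∈ oneUnits O)
    (h : SpecialField (ResidueField O)) : Special (oneUnits O) (unitsSq O) := by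
  have lift : ∀ x : E, O.valuation x = 1 → ∃ x' : O, (x' : E) = x := fun x hx =>
    ⟨⟨x, (ValuationSubring.valuation_le_one_iff _ _).1 hx.le⟩, rfl⟩
  have unit : ∀ r : E, r ∈ unitsSq O → r ∉ oneUnits O → ∃ (z : E) (r' : O), z ≠ 0 ∧
      (r' : E) = r * z ^ 2 ∧ O.valuation (r' : E) = 1 ∧ ¬ IsSquare (residue O r') := by
    rintro r ⟨z, hz, hz1⟩ hrT
    obtain ⟨r', hr'⟩ := lift _ hz1
    refine ⟨z, r', hz, hr', hr' ▸ hz1, ?_⟩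
    rw [isSquare_residue_iff (hr' ▸ hz1), hr', SqGroup.mul_sq_iff hz]
    exact hrT
  constructor
  · intro r hr hrT
    obtain ⟨z, r', hz, hr', hr1, hrs⟩ := unit r hr hrT
    obtain ⟨x, y, h1, h2⟩ := h.exists_rep _ hrs
    obtain ⟨q, hq⟩ := residue_surjective (x ^ 2 + residue O r' * y ^ 2)
    rw [← hq] at h1 h2
    have hq1 : O.valuation (q : E) = 1 :=
      (residue_ne_zero_iff q).1 fun h0 => h1 (h0 ▸ ⟨0, by simp⟩)
    refine ⟨q, by intro h0; simp [h0] at hq1, ?_, ?_, ?_⟩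
    · have := repMod_of_residue hr1 hq1 ⟨x, y, hq⟩
      rwa [hr', RepMod.form_mul_sq_iff hz] at this
    · rwa [isSquare_residue_iff hq1] at h1
    · rw [← map_mul, isSquare_residue_iff (by push_cast; rw [map_mul, hq1, hr1, one_mul])] at h2
      push_cast at h2
      rwa [hr', ← mul_assoc, SqGroup.mul_sq_iff hz] at h2
  · intro r q p hr hrT hq hqT hp h1 h2
    obtain ⟨z, r', hz, hr', hr1, hrs⟩ := unit r hr hrT
    obtain ⟨w, q', hw, hq', hq1, hqs⟩ := unit q hq hqT
    rw [← RepMod.form_mul_sq_iff hz, ← hr']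
    rw [← RepMod.form_mul_sq_iff hz, ← RepMod.mul_sq_iff hw, ← hr', ← hq'] at h1
    rw [← RepMod.form_mul_sq_iff hw, ← hq'] at h2
    have hrT' : (r' : E) ∉ oneUnits O := by rwa [hr', SqGroup.mul_sq_iff hz]
    have hqT' : (q' : E) ∉ oneUnits O := by rwa [hq', SqGroup.mul_sq_iff hw]
    have hq'0 : (q' : E) ≠ 0 := by intro h0; simp [h0] at hq1
    obtain ⟨y, hy, hy1, hy2⟩ := residue_of_repMod hneg hq1 hqT' hp h2
    obtain ⟨p', hp'⟩ := lift _ hy1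
    obtain ⟨c, hc, hc1, hc2⟩ := residue_of_repMod hneg hr1 hrT' hq'0 h1
    have hcv : O.valuation c = 1 := by
      rw [map_mul, hq1, one_mul, map_pow] at hc1
      exact (pow_eq_one_iff_of_nonneg zero_le two_ne_zero).1 hc1
    obtain ⟨c', hc'⟩ := lift _ hcv
    have hc'0 : residue O c' ≠ 0 := (residue_ne_zero_iff c').2 (hc' ▸ hcv)
    obtain ⟨a, b, hab⟩ := hc2 r' (q' * c' ^ 2) rfl (by push_cast; rw [hc'])
    rw [map_mul, map_pow] at hab
    have hrep := h.trans (residue O r') (residue O q') (residue O p') hrs hqs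
      ((residue_ne_zero_iff p').2 (hp' ▸ hy1)) ⟨a / residue O c', b / residue O c', by
        field_simp; exact hab⟩ (hy2 q' p' rfl hp')
    have := repMod_of_residue hr1 (hp' ▸ hy1) hrep
    rwa [hp', RepMod.mul_sq_iff hy] at this

end SpecialVal

section SpecialGlobal

open IsDedekindDomain NumberField WithZero

theorem exists_nonsquare_unit {A F : Type*} [CommRing A] [IsDedekindDomain A] [Field F] [Algebra A F]
    [IsFractionRing A F] (v : HeightOneSpectrum A) [Finite (A ⧸ v.asIdeal)]
    (h2 : v.valuation F 2 = 1) :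
    ∃ u : F, v.valuation F u = 1 ∧ ∀ z, ¬ v.valuation F (u - z ^ 2) < 1 := by
  have := v.isMaximal
  let := Ideal.Quotient.field v.asIdeal
  have h2' : (2 : A) ∉ v.asIdeal := by
    intro hmem
    have : v.valuation F (algebraMap A F 2) < 1 := (v.valuation_lt_one_iff_mem _).2 hmem
    rw [map_ofNat, h2] at this
    exact lt_irrefl _ this
  have hchar : ringChar (A ⧸ v.asIdeal) ≠ 2 := by
    intro hc
    have h := ringChar.Nat.cast_ringChar (R := A ⧸ v.asIdeal)
    rw [hc] at h
    refine h2' (Ideal.Quotient.eq_zero_iff_mem.1 ?_)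
    rw [map_ofNat]
    exact_mod_cast h
  obtain ⟨a, ha⟩ := FiniteField.exists_nonsquare hchar
  obtain ⟨u, rfl⟩ := Ideal.Quotient.mk_surjective a
  have hu : u ∉ v.asIdeal := fun h => ha (Ideal.Quotient.eq_zero_iff_mem.2 h ▸ ⟨0, by simp⟩)
  have hv1 : v.valuation F (algebraMap A F u) = 1 :=
    le_antisymm (v.valuation_le_one u) (not_lt.1 fun h => hu ((v.valuation_lt_one_iff_mem _).1 h))
  refine ⟨algebraMap A F u, hv1, fun z hz => ?_⟩
  have hz1 : v.valuation F z ≤ 1 := by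
    have h1 := (v.valuation F).map_sub_le hv1.le hz.le
    rw [sub_sub_cancel, map_pow] at h1
    exact (pow_le_one_iff two_ne_zero).1 h1
  obtain ⟨c, hc⟩ := v.exists_valuation_sub_lt_of_integer hz1 1
  refine ha ⟨Ideal.Quotient.mk _ c, ?_⟩
  rw [← map_mul, Ideal.Quotient.mk_eq_mk_iff_sub_mem, ← v.valuation_lt_one_iff_mem (K := F)]
  change v.valuation F (algebraMap A F (u - c * c)) < 1
  have e : algebraMap A F (u - c * c) = (algebraMap A F u - z ^ 2) -
      (algebraMap A F c - z) * (algebraMap A F c + z) := by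
    rw [map_sub, map_mul]; ring
  rw [e]
  refine Valuation.map_sub_lt _ hz ?_
  rw [map_mul]
  refine mul_lt_one_of_nonneg_of_lt_one_left zero_le (by simpa using hc) ?_
  exact Valuation.map_add_le _ (v.valuation_le_one c) hz1

theorem not_specialField_numberField (F : Type*) [Field F] [NumberField F]
    (hneg : IsSquare (-1 : F)) : ¬ SpecialField F := by
  obtain ⟨v, hv⟩ := exists_odd_prime (k := F)
  obtain ⟨π, -, hπ⟩ := exists_uniformizer v
  have := finite_quotient v
  obtain ⟨u, hu, hu'⟩ := exists_nonsquare_unit v hv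
  refine not_specialField (v.valuation F) (ϖ := (π : F)) ?_ ?_ hv hneg hu hu'
  · rw [hπ, ← exp_zero, exp_lt_exp]; norm_num
  · rw [hπ, log_exp]; decide

theorem exists_valuation_dedekind (A F : Type*) [CommRing A] [IsDedekindDomain A] [Field F]
    [Algebra A F] [IsFractionRing A F] [Ring.HasFiniteQuotients A] (hA : ¬ IsField A)
    (hu : IsUnit (2 : A)) :
    ∃ v : Valuation F (WithZero (Multiplicative ℤ)), v 2 = 1 ∧ (∃ ϖ, v ϖ = exp (-1)) ∧
      ∃ u, v u = 1 ∧ ∀ z, ¬ v (u - z ^ 2) < 1 := by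
  obtain ⟨M, hM⟩ := Ideal.exists_maximal A
  let v : HeightOneSpectrum A := ⟨M, hM.isPrime, Ring.ne_bot_of_isMaximal_of_not_isField hM hA⟩
  have hv2 : v.valuation F 2 = 1 := by
    have : v.valuation F (algebraMap A F 2) = 1 := by
      refine le_antisymm (v.valuation_le_one _) (not_lt.1 fun h => ?_)
      exact v.isPrime.ne_top (Ideal.eq_top_of_isUnit_mem _ ((v.valuation_lt_one_iff_mem _).1 h) hu)
    rwa [map_ofNat] at this
  have : Finite (A ⧸ v.asIdeal) := Ring.HasFiniteQuotients.finiteQuotient v.ne_bot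
  exact ⟨v.valuation F, hv2, v.valuation_exists_uniformizer F, exists_nonsquare_unit v hv2⟩

theorem exists_valuation_functionField (Fq S : Type*) [Field Fq] [Finite Fq] (h2 : (2 : Fq) ≠ 0)
    [Field S] [Algebra (RatFunc Fq) S] [FiniteDimensional (RatFunc Fq) S]
    [Algebra.IsSeparable (RatFunc Fq) S] :
    ∃ v : Valuation S (WithZero (Multiplicative ℤ)), v 2 = 1 ∧ (∃ ϖ, v ϖ = exp (-1)) ∧
      ∃ u, v u = 1 ∧ ∀ z, ¬ v (u - z ^ 2) < 1 := by
  let : Algebra (Polynomial Fq) S :=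
    ((algebraMap (RatFunc Fq) S).comp (algebraMap (Polynomial Fq) (RatFunc Fq))).toAlgebra
  have : IsScalarTower (Polynomial Fq) (RatFunc Fq) S := IsScalarTower.of_algebraMap_eq fun _ => rfl
  have : FunctionField Fq S := ‹FiniteDimensional (RatFunc Fq) S›
  have hfq : Ring.HasFiniteQuotients (Polynomial Fq) := ⟨fun {I} hI => by
    obtain ⟨f, hf, hf0⟩ := Submodule.exists_mem_ne_zero_of_ne_bot hI
    have h1 : Module.Finite Fq (Polynomial Fq ⧸ Ideal.span {f}) :=
      (AdjoinRoot.powerBasis hf0).finite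
    have : Finite (Polynomial Fq ⧸ Ideal.span {f}) := Module.finite_of_finite Fq
    have hle : Ideal.span {f} ≤ I := (Ideal.span_singleton_le_iff_mem _).2 hf
    exact Finite.of_surjective _ (Ideal.Quotient.factor_surjective hle)⟩
  have hfin : Module.Finite (Polynomial Fq) (FunctionField.ringOfIntegers Fq S) := inferInstance
  have : Module.IsTorsionFree (Polynomial Fq) (FunctionField.ringOfIntegers Fq S) := by
    have := FunctionField.ringOfIntegers.algebraMap_injective Fq S
    exact (Module.isTorsionFree_iff_algebraMap_injective).2 this
  have hfq' : Ring.HasFiniteQuotients (FunctionField.ringOfIntegers Fq S) :=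
    Ring.HasFiniteQuotients.of_module_finite (Polynomial Fq) _
  have hu : IsUnit (2 : FunctionField.ringOfIntegers Fq S) := by
    have h3 := ((isUnit_iff_ne_zero.2 h2).map (Polynomial.C (R := Fq))).map
      (algebraMap (Polynomial Fq) (FunctionField.ringOfIntegers Fq S))
    rwa [map_ofNat, map_ofNat] at h3
  exact exists_valuation_dedekind (FunctionField.ringOfIntegers Fq S) S
    (FunctionField.ringOfIntegers.not_isField Fq S) hu

theorem not_specialField_functionField (Fq κ : Type*) [Field Fq] [Finite Fq] (h2 : (2 : Fq) ≠ 0)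
    [Field κ] [Algebra (RatFunc Fq) κ] [FiniteDimensional (RatFunc Fq) κ]
    (hneg : IsSquare (-1 : κ)) : ¬ SpecialField κ := by
  let S := separableClosure (RatFunc Fq) κ
  obtain ⟨v, hv2, ⟨ϖ, hϖ⟩, u, hu, hu'⟩ := exists_valuation_functionField Fq S h2
  have : FiniteDimensional S κ := inferInstance
  have : IsPurelyInseparable S κ := inferInstance
  obtain ⟨p, hp⟩ := CharP.exists Fq
  have hpp : p.Prime := CharP.char_is_prime Fq p
  have hp2 : p ≠ 2 := by
    rintro rfl
    exact h2 (by simpa using CharP.cast_eq_zero Fq 2)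
  have : ExpChar Fq p := ExpChar.prime hpp
  have : ExpChar (RatFunc Fq) p := expChar_of_injective_algebraMap (algebraMap Fq _).injective p
  have : ExpChar S p := expChar_of_injective_algebraMap (algebraMap (RatFunc Fq) _).injective p
  set n := IsPurelyInseparable.exponent S κ
  set φ : κ →+* S := IsPurelyInseparable.iterateFrobenius S κ p le_rfl with hφ
  have hφ1 : ∀ a : S, φ (algebraMap S κ a) = a ^ p ^ n := fun a =>
    IsPurelyInseparable.iterateFrobenius_algebraMap κ p le_rfl a
  have hodd : Odd (p ^ n) := (hpp.odd_of_ne_two hp2).pow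
  obtain ⟨m, hm⟩ := hodd
  rw [hm] at hφ1
  refine not_specialField (v.comap φ) (ϖ := algebraMap S κ ϖ) (u := algebraMap S κ u) ?_ ?_ ?_ hneg
    ?_ ?_
  · rw [Valuation.comap_apply, hφ1, map_pow]
    refine pow_lt_one₀ zero_le ?_ (by omega)
    rw [hϖ, ← exp_zero, exp_lt_exp]; norm_num
  · rw [Valuation.comap_apply, hφ1, map_pow, hϖ, log_pow, log_exp]
    refine ⟨-(m : ℤ) - 1, ?_⟩
    simp
    ring
  · rw [Valuation.comap_apply, map_ofNat, hv2]
  · rw [Valuation.comap_apply, hφ1, map_pow, hu, one_pow]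
  · intro z hz
    rw [Valuation.comap_apply, map_sub, map_pow, hφ1] at hz
    have hu0 : u ≠ 0 := by rintro rfl; simp at hu
    refine hu' (φ z / u ^ m) ?_
    have e : u - (φ z / u ^ m) ^ 2 = (u ^ (2 * m + 1) - φ z ^ 2) / (u ^ m) ^ 2 := by
      field_simp
      ring
    rw [e, map_div₀, map_pow, map_pow, hu]
    simpa using hz

end SpecialGlobal

section ResidueFinite

open IsLocalRing

/-- `κ` is finite-dimensional over `F`, expressed through linear relations. -/
def FinDim {F κ : Type*} [Field F] [Field κ] (j : F →+* κ) : Prop :=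
  ∃ N : ℕ, ∀ x : Fin N → κ, ∃ c : Fin N → F, c ≠ 0 ∧ ∑ i, j (c i) * x i = 0

theorem FinDim.finite {F κ : Type*} [Field F] [Field κ] [Algebra F κ]
    (h : FinDim (algebraMap F κ)) : FiniteDimensional F κ := by
  obtain ⟨N, hN⟩ := h
  refine Module.rank_lt_aleph0_iff.1 ((rank_le (R := F) (M := κ) (n := N) fun s hs => ?_).trans_lt
    (Cardinal.natCast_lt_aleph0 (n := N)))
  by_contra hlt
  rw [not_le] at hlt
  let e : Fin N → s := fun i => s.equivFin.symm ⟨i, i.2.trans hlt⟩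
  have he : Function.Injective e := fun i i' h => by
    have := s.equivFin.symm.injective h
    exact Fin.ext (by simpa using congrArg Fin.val this)
  obtain ⟨c, hc, hsum⟩ := hN fun i => (e i : κ)
  refine hc (funext fun i => ?_)
  refine Fintype.linearIndependent_iff.1 (hs.comp e he) c ?_ i
  simpa [Algebra.smul_def] using hsum

theorem FinOver.finite {F κ : Type*} [Field F] [Field κ] {j : F →+* κ} {s : κ} (h : FinOver j s)
    (htr : ∀ p : Polynomial F, p.eval₂ j s = 0 → p = 0) :
    ∃ _ : Algebra (RatFunc F) κ, FiniteDimensional (RatFunc F) κ := by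
  have hinj : Function.Injective (Polynomial.eval₂RingHom j s) :=
    (injective_iff_map_eq_zero _).2 htr
  let g : RatFunc F →+* κ := IsFractionRing.lift hinj
  let := g.toAlgebra
  refine ⟨this, FinDim.finite ?_⟩
  obtain ⟨N, hN⟩ := h
  refine ⟨N, fun x => ?_⟩
  obtain ⟨p, hp, hsum⟩ := hN x
  refine ⟨fun i => algebraMap _ _ (p i), fun h0 => hp (funext fun i => ?_), ?_⟩
  · have := congrFun h0 i
    simpa using this
  · rw [← hsum]
    refine Finset.sum_congr rfl fun i _ => ?_
    change IsFractionRing.lift hinj _ * _ = _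
    rw [IsFractionRing.lift_algebraMap]
    rfl

theorem exists_coeff_zero_ne_zero {k L ι : Type*} [Field k] [Field L] [Fintype ι] {φ : k →+* L}
    {s : L} (hs : s ≠ 0) (x : ι → L) (n : ℕ) : ∀ p : ι → Polynomial k, p ≠ 0 →
    ∑ i, (p i).natDegree ≤ n → ∑ i, (p i).eval₂ φ s * x i = 0 →
    ∃ p : ι → Polynomial k, (∃ i, (p i).coeff 0 ≠ 0) ∧ ∑ i, (p i).eval₂ φ s * x i = 0 := by
  induction n with
  | zero =>
    intro p hp hn hsum
    refine ⟨p, ?_, hsum⟩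
    by_contra! hcon
    refine hp (funext fun i => ?_)
    have hi : (p i).natDegree = 0 := by
      have := Finset.sum_eq_zero_iff.1 (Nat.le_zero.1 hn) i (Finset.mem_univ i)
      exact this
    rw [Polynomial.eq_C_of_natDegree_eq_zero hi, hcon i]
    simp
  | succ n ih =>
    intro p hp hn hsum
    by_cases hcon : ∃ i, (p i).coeff 0 ≠ 0
    · exact ⟨p, hcon, hsum⟩
    push Not at hcon
    have hdiv : ∀ i, p i = Polynomial.divX (p i) * Polynomial.X := fun i => by
      conv_lhs => rw [← Polynomial.divX_mul_X_add (p i)]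
      rw [hcon i]; simp
    obtain ⟨i0, hi0⟩ := Function.ne_iff.1 hp
    refine ih (fun i => Polynomial.divX (p i)) ?_ ?_ ?_
    · intro h0
      apply hi0
      rw [hdiv i0, congrFun h0 i0]
      simp
    · have hlt : ∑ i, (Polynomial.divX (p i)).natDegree < ∑ i, (p i).natDegree := by
        refine Finset.sum_lt_sum (fun i _ => ?_) ⟨i0, Finset.mem_univ _, ?_⟩
        · rw [Polynomial.natDegree_divX_eq_natDegree_tsub_one]; omega
        · rw [Polynomial.natDegree_divX_eq_natDegree_tsub_one]
          have : (p i0).natDegree ≠ 0 := by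
            intro h0
            apply hi0
            rw [Polynomial.eq_C_of_natDegree_eq_zero h0, hcon i0]
            simp
          omega
      omega
    · have : s * ∑ i, (Polynomial.divX (p i)).eval₂ φ s * x i = 0 := by
        rw [← hsum, Finset.mul_sum]
        refine Finset.sum_congr rfl fun i _ => ?_
        conv_rhs => rw [hdiv i]
        rw [Polynomial.eval₂_mul, Polynomial.eval₂_X]
        ring
      exact (mul_eq_zero.1 this).resolve_left hs

/-- The map to the residue field of a valuation ring containing the ground field. -/
noncomputable def residueHom {k L : Type*} [Field k] [Field L] {O : ValuationSubring L} (φ : k →+* L)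
    (hk : ∀ x, φ x ∈ O) : k →+* ResidueField O :=
  (residue O).comp (φ.codRestrict O.toSubring hk)

theorem finDim_residueHom {k L : Type*} [Field k] [Field L] {O : ValuationSubring L} {φ : k →+* L}
    (hk : ∀ x, φ x ∈ O) {s : L} (hs0 : s ≠ 0) (hs : O.valuation s < 1) (h : FinOver φ s) :
    FinDim (residueHom φ hk) := by
  obtain ⟨N, hN⟩ := h
  refine ⟨N, fun x => ?_⟩
  choose y hy using fun i => residue_surjective (x i)
  obtain ⟨p, hp, hsum⟩ := hN fun i => (y i : L)
  obtain ⟨p, ⟨i0, hi0⟩, hsum⟩ := exists_coeff_zero_ne_zero hs0 _ _ p hp le_rfl hsum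
  refine ⟨fun i => (p i).coeff 0, fun h0 => hi0 (congrFun h0 i0), ?_⟩
  let s' : O := ⟨s, (ValuationSubring.valuation_le_one_iff _ _).1 hs.le⟩
  have hs' : residue O s' = 0 := (residue_eq_zero_iff' _).2 hs
  have h1 : ∑ i, (p i).eval₂ (φ.codRestrict O.toSubring hk) s' * y i = 0 := by
    apply Subtype.ext
    rw [ZeroMemClass.coe_zero, ← hsum]
    change O.subtype _ = _
    rw [map_sum]
    refine Finset.sum_congr rfl fun i _ => ?_
    rw [map_mul, Polynomial.hom_eval₂]
    rfl
  have h2 := congrArg (residue O) h1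
  rw [map_sum, map_zero] at h2
  rw [← h2]
  refine Finset.sum_congr rfl fun i _ => ?_
  rw [map_mul, Polynomial.hom_eval₂, hs', hy, Polynomial.eval₂_at_zero]
  rfl

theorem exists_normalized {k L ι : Type*} [Field k] [Field L] [Fintype ι] {φ : k →+* L}
    (O : ValuationSubring L) (p : ι → Polynomial k) (hp : p ≠ 0) :
    ∃ c : k, c ≠ 0 ∧ (∀ i n, O.valuation (φ (c * (p i).coeff n)) ≤ 1) ∧
      ∃ i n, O.valuation (φ (c * (p i).coeff n)) = 1 := by
  classical
  obtain ⟨i0, hi0⟩ := Function.ne_iff.1 hp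
  let S : Finset (Σ _ : ι, ℕ) := Finset.univ.sigma fun i => (p i).support
  have hS : S.Nonempty := by
    obtain ⟨n, hn⟩ := Polynomial.support_nonempty.2 hi0
    exact ⟨⟨i0, n⟩, Finset.mem_sigma.2 ⟨Finset.mem_univ _, hn⟩⟩
  obtain ⟨⟨i, n⟩, hin, hmax⟩ := S.exists_max_image
    (fun j => O.valuation (φ ((p j.1).coeff j.2))) hS
  have hne : (p i).coeff n ≠ 0 := Polynomial.mem_support_iff.1 (Finset.mem_sigma.1 hin).2
  have hne' : O.valuation (φ ((p i).coeff n)) ≠ 0 := by simpa using hne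
  refine ⟨((p i).coeff n)⁻¹, inv_ne_zero hne, fun i' n' => ?_, i, n, ?_⟩
  · rw [map_mul, map_inv₀, map_mul, map_inv₀]
    by_cases h0 : (p i').coeff n' = 0
    · simp [h0]
    · have := hmax ⟨i', n'⟩ (Finset.mem_sigma.2 ⟨Finset.mem_univ _, Polynomial.mem_support_iff.2 h0⟩)
      rw [inv_mul_le_iff₀ (zero_lt_iff.2 hne'), mul_one]
      exact this
  · rw [inv_mul_cancel₀ hne, map_one, map_one]

theorem FinOver.residue {k L F : Type*} [Field k] [Field L] [Field F] {O : ValuationSubring L}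
    {φ : k →+* L} {s : O} (h : FinOver φ (s : L)) (j : F →+* ResidueField O)
    (hj : ∀ c, ∀ c' : O, (c' : L) = φ c → ∃ d, IsLocalRing.residue O c' = j d) :
    FinOver j (IsLocalRing.residue O s) := by
  obtain ⟨N, hN⟩ := h
  refine ⟨N, fun x => ?_⟩
  choose y hy using fun i => residue_surjective (x i)
  obtain ⟨p, hp, hsum⟩ := hN fun i => (y i : L)
  obtain ⟨c, hc0, hc, i0, n0, hc1⟩ := exists_normalized (φ := φ) O p hp
  have hmem : ∀ i n, φ (c * (p i).coeff n) ∈ O := fun i n =>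
    (ValuationSubring.valuation_le_one_iff _ _).1 (hc i n)
  choose d hd using fun i n => hj _ ⟨_, hmem i n⟩ rfl
  refine ⟨fun i => ∑ n ∈ Finset.range ((p i).natDegree + 1), Polynomial.monomial n (d i n),
    fun h0 => ?_, ?_⟩
  · have h1 := congrArg (fun q => Polynomial.coeff q n0) (congrFun h0 i0)
    have hn0 : n0 < (p i0).natDegree + 1 := by
      by_contra hlt
      rw [Polynomial.coeff_eq_zero_of_natDegree_lt (by omega)] at hc1
      simp at hc1
    simp only [Polynomial.finsetSum_coeff, Polynomial.coeff_monomial, Finset.sum_ite_eq',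
      Finset.mem_range, hn0, if_true, Pi.zero_apply, Polynomial.coeff_zero] at h1
    have h2 := hd i0 n0
    rw [h1, map_zero] at h2
    exact (residue_ne_zero_iff _).2 hc1 h2
  · have h1 : ∑ i, (∑ n ∈ Finset.range ((p i).natDegree + 1), (⟨_, hmem i n⟩ : O) * s ^ n) * y i
        = 0 := by
      apply Subtype.ext
      have : φ c * ∑ i, (p i).eval₂ φ s * (y i : L) = 0 := by rw [hsum, mul_zero]
      rw [ZeroMemClass.coe_zero, ← this]
      change O.subtype _ = _
      rw [map_sum, Finset.mul_sum]
      refine Finset.sum_congr rfl fun i _ => ?_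
      rw [map_mul, map_sum, Polynomial.eval₂_eq_sum_range, ← mul_assoc, Finset.mul_sum]
      congr 1
      refine Finset.sum_congr rfl fun n _ => ?_
      rw [map_mul, map_pow]
      change φ (c * (p i).coeff n) * (s : L) ^ n = _
      rw [map_mul]
      ring
    have h2 := congrArg (IsLocalRing.residue O) h1
    rw [map_sum, map_zero] at h2
    rw [← h2]
    refine Finset.sum_congr rfl fun i _ => ?_
    rw [map_mul, map_sum, hy, Polynomial.eval₂_finsetSum]
    congr 1
    refine Finset.sum_congr rfl fun n _ => ?_
    rw [Polynomial.eval₂_monomial, map_mul, map_pow, hd]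

end ResidueFinite

section NoSpecial

open IsLocalRing IsDedekindDomain NumberField

universe w

theorem isSquare_mul_of_finite {F : Type*} [Field F] [Finite F] (h2 : (2 : F) ≠ 0) {a b : F}
    (ha : ¬ IsSquare a) (hb : ¬ IsSquare b) : IsSquare (a * b) := by
  have := Fintype.ofFinite F
  have hF : ringChar F ≠ 2 := by
    intro hc
    have h := ringChar.Nat.cast_ringChar (R := F)
    rw [hc] at h
    exact h2 (by exact_mod_cast h)
  have h0 : ∀ x : F, ¬ IsSquare x → x ≠ 0 := by
    rintro x hx rfl
    exact hx ⟨0, by simp⟩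
  have hneg : ∀ x : F, ¬ IsSquare x → x ^ (Fintype.card F / 2) = -1 := fun x hx =>
    (FiniteField.pow_dichotomy hF (h0 x hx)).resolve_left fun h =>
      hx ((FiniteField.isSquare_iff hF (h0 x hx)).2 h)
  rw [FiniteField.isSquare_iff hF (mul_ne_zero (h0 a ha) (h0 b hb)), mul_pow, hneg a ha, hneg b hb]
  ring

theorem not_specialField_algebraic {F κ : Type*} [Field F] [Finite F] [Field κ] [Algebra F κ]
    [Algebra.IsAlgebraic F κ] (h2 : (2 : κ) ≠ 0) {r : κ} (hr : ¬ IsSquare r) :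
    ¬ SpecialField κ := by
  intro h
  obtain ⟨x, y, h1, h3⟩ := h.exists_rep r hr
  set z := x ^ 2 + r * y ^ 2
  let M := IntermediateField.adjoin F ({r, z} : Set κ)
  have : FiniteDimensional F M := IntermediateField.finiteDimensional_adjoin fun x _ =>
    Algebra.IsIntegral.isIntegral x
  have : Finite M := Module.finite_of_finite F
  let r' : M := ⟨r, IntermediateField.subset_adjoin _ _ (by simp)⟩
  let z' : M := ⟨z, IntermediateField.subset_adjoin _ _ (by simp)⟩
  have hsq : ∀ m : M, IsSquare m → IsSquare (m : κ) := fun m hm => hm.map M.val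
  have h2' : (2 : M) ≠ 0 := fun h0 => h2 (by
    have h4 := congrArg M.val h0
    rwa [map_ofNat, map_zero] at h4)
  exact h3 (hsq (z' * r') (isSquare_mul_of_finite h2' (fun h => h1 (hsq _ h))
    (fun h => hr (hsq _ h))))

variable {k : Type w} [Field k] [NumberField k] {L : Type*} [Field L] [Algebra k L]

theorem exists_finite_residueField_hom {O : ValuationSubring L} {v : HeightOneSpectrum (𝓞 k)}
    (hle : ∀ x : k, O.valuation (algebraMap k L x) ≤ 1 ↔ v.valuation k x ≤ 1)
    (hlt : ∀ x : k, O.valuation (algebraMap k L x) < 1 ↔ v.valuation k x < 1) :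
    ∃ (F : Type w) (_ : Field F) (_ : Finite F) (j : F →+* ResidueField O), ∀ (c : k) (c' : O),
      (c' : L) = algebraMap k L c → ∃ d, residue O c' = j d := by
  have := v.isMaximal
  let := Ideal.Quotient.field v.asIdeal
  have hmem : ∀ a : 𝓞 k, algebraMap k L (algebraMap (𝓞 k) k a) ∈ O := fun a =>
    (ValuationSubring.valuation_le_one_iff _ _).1 ((hle _).2 (v.valuation_le_one a))
  let g : 𝓞 k →+* O :=
    ((algebraMap k L).comp (algebraMap (𝓞 k) k)).codRestrict O.toSubring hmem
  refine ⟨𝓞 k ⧸ v.asIdeal, inferInstance, finite_quotient v,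
    Ideal.Quotient.lift v.asIdeal ((residue O).comp g) fun a ha => ?_, fun c c' hc => ?_⟩
  · exact (residue_eq_zero_iff' _).2 ((hlt _).2 ((v.valuation_lt_one_iff_mem a).2 ha))
  · have hc1 : v.valuation k c ≤ 1 := (hle c).1 (hc ▸ O.valuation_le_one c')
    obtain ⟨a, ha⟩ := exists_close v hc1
    refine ⟨Ideal.Quotient.mk _ a, ?_⟩
    rw [Ideal.Quotient.lift_mk, RingHom.comp_apply, eq_comm, residue_eq_iff, hc]
    change O.valuation (algebraMap k L (algebraMap (𝓞 k) k a) - _) < 1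
    rw [← map_sub]
    exact (hlt _).2 ha

theorem not_special (hfin : ∀ s : L, FinOver (algebraMap k L) s) {O : ValuationSubring L}
    (hO : O ≠ ⊤) (h2 : O.valuation 2 = 1) (hneg : (-1 : L) ∈ oneUnits O)
    {u : L} (hu : O.valuation u = 1) (hu' : u ∉ oneUnits O) :
    ¬ Special (oneUnits O) (unitsSq O) := by
  intro hsp
  have hS := specialField_of_special hneg hsp
  have hneg' : IsSquare (-1 : ResidueField O) := by
    have := (isSquare_residue_iff (a := (-1 : O)) (by simp)).2 (by simpa using hneg)
    rwa [map_neg, map_one] at this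
  have h2' : (2 : ResidueField O) ≠ 0 := by
    have := (residue_ne_zero_iff (2 : O)).2 h2
    rwa [map_ofNat] at this
  by_cases hk : ∀ x : k, algebraMap k L x ∈ O
  · obtain ⟨s, hs0, hs⟩ : ∃ s : L, s ≠ 0 ∧ O.valuation s < 1 := by
      by_contra! hcon
      refine hO (eq_top_iff.2 fun x _ => ?_)
      by_cases hx : x = 0
      · exact hx ▸ O.zero_mem
      · have := hcon x⁻¹ (inv_ne_zero hx)
        rw [map_inv₀] at this
        refine (ValuationSubring.valuation_le_one_iff _ _).1 ?_
        exact (one_le_inv₀ (by simpa [zero_lt_iff] using hx)).1 this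
    let := (residueHom (algebraMap k L) hk).toAlgebra
    have : FiniteDimensional k (ResidueField O) :=
      FinDim.finite (finDim_residueHom hk hs0 hs (hfin s))
    have : CharZero (ResidueField O) := charZero_of_injective_algebraMap
      (algebraMap k (ResidueField O)).injective
    have : FiniteDimensional ℚ (ResidueField O) := Module.Finite.trans k _
    have : NumberField (ResidueField O) := { }
    exact not_specialField_numberField _ hneg' hS
  · obtain ⟨v, hle, hlt, -⟩ := exists_prime_of_valuationSubring O hk
    obtain ⟨F, _, _, j, hj⟩ := exists_finite_residueField_hom hle hlt
    by_cases htr : ∃ s : O, ∀ p : Polynomial F, p.eval₂ j (residue O s) = 0 → p = 0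
    · obtain ⟨s, hs⟩ := htr
      obtain ⟨_, _⟩ := (FinOver.residue (hfin s) j hj).finite hs
      refine not_specialField_functionField F _ (fun h0 => h2' ?_) hneg' hS
      rw [← map_ofNat j 2, h0, map_zero]
    · push Not at htr
      let := j.toAlgebra
      have : Algebra.IsAlgebraic F (ResidueField O) := ⟨fun x => by
        obtain ⟨x, rfl⟩ := residue_surjective x
        obtain ⟨p, hp, hp0⟩ := htr x
        exact ⟨p, hp0, hp⟩⟩
      let u' : O := ⟨u, (ValuationSubring.valuation_le_one_iff _ _).1 hu.le⟩
      exact not_specialField_algebraic (F := F) h2' (r := residue O u')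
        (fun h => hu' ((isSquare_residue_iff (a := u') hu).1 h)) hS

end NoSpecial

noncomputable section Gauss

open IsLocalRing

theorem val_comap_le {F M : Type*} [Field F] [Field M] {O : ValuationSubring M} {j : F →+* M}
    {x : F} : (O.comap j).valuation x ≤ 1 ↔ O.valuation (j x) ≤ 1 := by
  rw [ValuationSubring.valuation_le_one_iff, ValuationSubring.valuation_le_one_iff]
  exact ValuationSubring.mem_comap

theorem val_comap_lt {F M : Type*} [Field F] [Field M] {O : ValuationSubring M} {j : F →+* M}
    {x : F} : (O.comap j).valuation x < 1 ↔ O.valuation (j x) < 1 := by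
  by_cases hx : x = 0
  · simp [hx]
  · have h := val_comap_le (O := O) (j := j) (x := x⁻¹)
    rw [map_inv₀, map_inv₀, map_inv₀, inv_le_one₀ (zero_lt_iff.2 ((map_ne_zero _).2 hx)),
      inv_le_one₀ (zero_lt_iff.2 ((map_ne_zero _).2 ((map_ne_zero _).2 hx)))] at h
    rw [← not_le, ← not_le, h]

theorem val_comap_eq {F M : Type*} [Field F] [Field M] {O : ValuationSubring M} {j : F →+* M}
    {x : F} : (O.comap j).valuation x = 1 ↔ O.valuation (j x) = 1 := by
  rw [le_antisymm_iff, le_antisymm_iff, ← not_lt, ← not_lt, val_comap_lt, not_lt, val_comap_le,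
    not_lt]

variable {F : Type*} [Field F]

theorem exists_integral_multiple (A : ValuationSubring F) {P : Polynomial F} (hP : P ≠ 0) :
    ∃ c : F, c ≠ 0 ∧ ∃ p : Polynomial A, p.map (residue A) ≠ 0 ∧
      p.map A.subtype = Polynomial.C c * P := by
  obtain ⟨c, hc, h1, i, n, hn⟩ := exists_normalized (φ := RingHom.id F) A (fun _ : Unit => P)
    (fun h => hP (congrFun h ()))
  have hl : Polynomial.C c * P ∈ Polynomial.lifts A.subtype := by
    rw [Polynomial.lifts_iff_coeff_lifts]
    intro m
    rw [Polynomial.coeff_C_mul]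
    exact ⟨⟨_, (A.valuation_le_one_iff _).1 (h1 () m)⟩, rfl⟩
  obtain ⟨p, hp⟩ := (Polynomial.mem_lifts _).1 hl
  refine ⟨c, hc, p, fun h0 => ?_, hp⟩
  have h2 : (p.coeff n : F) = c * P.coeff n := by
    rw [← Polynomial.coeff_C_mul, ← hp, Polynomial.coeff_map]; rfl
  have h3 := congrArg (fun q => Polynomial.coeff q n) h0
  simp only [Polynomial.coeff_map, Polynomial.coeff_zero] at h3
  exact (residue_ne_zero_iff (p.coeff n)).2 (by rw [h2]; exact hn) h3

/-- The embedding of the polynomials over a valuation ring in the rational functions. -/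
def gaussEmb (A : ValuationSubring F) : Polynomial A →+* RatFunc F :=
  (algebraMap (Polynomial F) (RatFunc F)).comp (Polynomial.mapRingHom A.subtype)

theorem gaussEmb_apply (A : ValuationSubring F) (p : Polynomial A) :
    gaussEmb A p = algebraMap (Polynomial F) (RatFunc F) (p.map A.subtype) := rfl

theorem gaussEmb_injective (A : ValuationSubring F) : Function.Injective (gaussEmb A) :=
  (RatFunc.algebraMap_injective F).comp (Polynomial.map_injective _ Subtype.val_injective)

theorem gaussEmb_ne_zero {A : ValuationSubring F} {p : Polynomial A}
    (h : p.map (residue A) ≠ 0) : gaussEmb A p ≠ 0 := by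
  rw [map_ne_zero_iff _ (gaussEmb_injective A)]
  rintro rfl
  simp at h

theorem gaussEmb_C (A : ValuationSubring F) (c : A) :
    gaussEmb A (Polynomial.C c) = RatFunc.C (c : F) := by
  rw [gaussEmb_apply, Polynomial.map_C]
  exact RatFunc.algebraMap_C _

theorem gauss_exists_eq (A : ValuationSubring F) {r : RatFunc F} (hr : r ≠ 0) :
    ∃ c : F, c ≠ 0 ∧ ∃ p q : Polynomial A, p.map (residue A) ≠ 0 ∧ q.map (residue A) ≠ 0 ∧
      r * gaussEmb A q = RatFunc.C c * gaussEmb A p := by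
  obtain ⟨P, Q, hQ, rfl⟩ := IsFractionRing.div_surjective (A := Polynomial F) r
  have hQ0 : Q ≠ 0 := nonZeroDivisors.ne_zero hQ
  have hP0 : P ≠ 0 := by rintro rfl; simp at hr
  obtain ⟨c, hc, p, hp, hp'⟩ := exists_integral_multiple A hP0
  obtain ⟨d, hd, q, hq, hq'⟩ := exists_integral_multiple A hQ0
  refine ⟨d / c, div_ne_zero hd hc, p, q, hp, hq, ?_⟩
  have hQ1 : algebraMap (Polynomial F) (RatFunc F) Q ≠ 0 := by simpa using hQ0
  have hc1 : (RatFunc.C c : RatFunc F) ≠ 0 := by simpa using hc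
  rw [gaussEmb_apply, gaussEmb_apply, hp', hq', map_mul, map_mul, RatFunc.algebraMap_C,
    RatFunc.algebraMap_C, map_div₀]
  field_simp

/-- The Gauss extension of a valuation ring to the field of rational functions. -/
def gaussRing (A : ValuationSubring F) : ValuationSubring (RatFunc F) where
  carrier := {r | ∃ p q : Polynomial A, q.map (residue A) ≠ 0 ∧ r * gaussEmb A q = gaussEmb A p}
  mul_mem' := by
    rintro r s ⟨p, q, hq, h⟩ ⟨p', q', hq', h'⟩
    exact ⟨p * p', q * q', by rw [Polynomial.map_mul]; exact mul_ne_zero hq hq', by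
      rw [map_mul, map_mul, ← h, ← h']; ring⟩
  one_mem' := ⟨1, 1, by simp, by simp⟩
  add_mem' := by
    rintro r s ⟨p, q, hq, h⟩ ⟨p', q', hq', h'⟩
    exact ⟨p * q' + p' * q, q * q', by rw [Polynomial.map_mul]; exact mul_ne_zero hq hq', by
      rw [map_add, map_mul, map_mul, map_mul, ← h, ← h']; ring⟩
  zero_mem' := ⟨0, 1, by simp, by simp⟩
  neg_mem' := by
    rintro r ⟨p, q, hq, h⟩
    exact ⟨-p, q, hq, by rw [map_neg, ← h]; ring⟩
  mem_or_inv_mem' := by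
    intro r
    by_cases hr : r = 0
    · exact Or.inl ⟨0, 1, by simp, by simp [hr]⟩
    obtain ⟨c, hc, p, q, hp, hq, h⟩ := gauss_exists_eq A hr
    rcases A.mem_or_inv_mem c with hcA | hcA
    · exact Or.inl ⟨Polynomial.C ⟨c, hcA⟩ * p, q, hq, by rw [h, map_mul, gaussEmb_C]⟩
    · refine Or.inr ⟨Polynomial.C ⟨c⁻¹, hcA⟩ * q, p, hp, ?_⟩
      have hc1 : (RatFunc.C c : RatFunc F) ≠ 0 := by simpa using hc
      rw [map_mul, gaussEmb_C, map_inv₀, inv_mul_eq_iff_eq_mul₀ hr, mul_left_comm, h,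
        inv_mul_cancel_left₀ hc1]

theorem gauss_val_eq_one {A : ValuationSubring F} {r : RatFunc F} {p q : Polynomial A}
    (hp : p.map (residue A) ≠ 0) (hq : q.map (residue A) ≠ 0)
    (h : r * gaussEmb A q = gaussEmb A p) : (gaussRing A).valuation r = 1 := by
  have hr : r ≠ 0 := by rintro rfl; exact gaussEmb_ne_zero hp (by rw [← h, zero_mul])
  refine le_antisymm ((ValuationSubring.valuation_le_one_iff _ _).2 ⟨p, q, hq, h⟩) ?_
  have := ((gaussRing A).valuation_le_one_iff r⁻¹).2 ⟨q, p, hp, by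
    rw [← h, inv_mul_cancel_left₀ hr]⟩
  rw [map_inv₀] at this
  exact (inv_le_one₀ (zero_lt_iff.2 ((map_ne_zero _).2 hr))).1 this

theorem gauss_exists_of_val_lt_one {A : ValuationSubring F} {r : RatFunc F}
    (h : (gaussRing A).valuation r < 1) : ∃ p q : Polynomial A, p.map (residue A) = 0 ∧
      q.map (residue A) ≠ 0 ∧ r * gaussEmb A q = gaussEmb A p := by
  obtain ⟨p, q, hq, hr⟩ := (ValuationSubring.valuation_le_one_iff _ _).1 h.le
  exact ⟨p, q, by_contra fun hp => h.ne (gauss_val_eq_one hp hq hr), hq, hr⟩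

theorem gaussRing_comap (A : ValuationSubring F) : (gaussRing A).comap RatFunc.C = A := by
  ext c
  rw [ValuationSubring.mem_comap]
  refine ⟨fun h => ?_, fun h => ⟨Polynomial.C ⟨c, h⟩, 1, by simp, by
    rw [gaussEmb_C, map_one, mul_one]⟩⟩
  by_contra hc
  have hc0 : c ≠ 0 := by rintro rfl; exact hc A.zero_mem
  have hc1 : (RatFunc.C c : RatFunc F) ≠ 0 := by simpa using hc0
  have hinv : c⁻¹ ∈ A := (A.mem_or_inv_mem c).resolve_left hc
  obtain ⟨p, q, hq, h⟩ := h
  have hq' : q = Polynomial.C ⟨c⁻¹, hinv⟩ * p := by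
    apply gaussEmb_injective A
    rw [map_mul, gaussEmb_C, ← h, map_inv₀, inv_mul_cancel_left₀ hc1]
  refine hq ?_
  rw [hq', Polynomial.map_mul, Polynomial.map_C, (residue_eq_zero_iff' _).2, map_zero, zero_mul]
  exact val_lt_one_of_inv_notMem (by simpa using hc)

theorem gauss_val_C_lt {A : ValuationSubring F} {c : F} :
    (gaussRing A).valuation (RatFunc.C c) < 1 ↔ A.valuation c < 1 := by
  rw [← val_comap_lt, gaussRing_comap]

theorem gauss_val_C_eq {A : ValuationSubring F} {c : F} :
    (gaussRing A).valuation (RatFunc.C c) = 1 ↔ A.valuation c = 1 := by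
  rw [← val_comap_eq, gaussRing_comap]

theorem gauss_val_emb {A : ValuationSubring F} {p : Polynomial A} (hp : p.map (residue A) ≠ 0) :
    (gaussRing A).valuation (gaussEmb A p) = 1 :=
  gauss_val_eq_one hp (q := 1) (by simp) (by simp)

theorem gauss_exists_val_eq (A : ValuationSubring F) {r : RatFunc F} (hr : r ≠ 0) :
    ∃ c : F, c ≠ 0 ∧ (gaussRing A).valuation r = (gaussRing A).valuation (RatFunc.C c) := by
  obtain ⟨c, hc, p, q, hp, hq, h⟩ := gauss_exists_eq A hr
  have := congrArg (gaussRing A).valuation h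
  rw [map_mul, map_mul, gauss_val_emb hp, gauss_val_emb hq, mul_one, mul_one] at this
  exact ⟨c, hc, this⟩

theorem gaussEmb_X (A : ValuationSubring F) : gaussEmb A Polynomial.X = RatFunc.X := by
  rw [gaussEmb_apply, Polynomial.map_X, RatFunc.algebraMap_X]

theorem gauss_val_X (A : ValuationSubring F) : (gaussRing A).valuation RatFunc.X = 1 := by
  rw [← gaussEmb_X]; exact gauss_val_emb (by simp)

theorem gauss_C_mul_X_notMem (A : ValuationSubring F) (d : F) :
    RatFunc.C d * RatFunc.X ∉ oneUnits (gaussRing A) := by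
  rintro ⟨y, hy, hlt⟩
  obtain ⟨c, hc, p, q, hp, hq, h⟩ := gauss_exists_eq A hy
  have hval := val_eq_one_of_sub hlt
  rw [map_mul, map_mul, gauss_val_X, mul_one, map_pow] at hval
  have hyc : (gaussRing A).valuation y = (gaussRing A).valuation (RatFunc.C c) := by
    have := congrArg (gaussRing A).valuation h
    rwa [map_mul, map_mul, gauss_val_emb hp, gauss_val_emb hq, mul_one, mul_one] at this
  rw [hyc, ← map_pow, ← map_mul, ← map_pow, ← map_mul, gauss_val_C_eq] at hval
  obtain ⟨p', q', hp', hq', h'⟩ := gauss_exists_of_val_lt_one hlt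
  let e : A := ⟨d * c ^ 2, (A.valuation_le_one_iff _).1 hval.le⟩
  have key : Polynomial.C e * Polynomial.X * p ^ 2 * q' = q ^ 2 * (q' + p') := by
    apply gaussEmb_injective A
    simp only [map_mul, map_pow, map_add, gaussEmb_X, gaussEmb_C]
    change RatFunc.C (d * c ^ 2) * _ * _ * _ = _
    rw [← h', map_mul, map_pow]
    linear_combination (-RatFunc.C d * RatFunc.X * gaussEmb A q' *
      (RatFunc.C c * gaussEmb A p + y * gaussEmb A q)) * h
  have key2 := congrArg (Polynomial.map (residue A)) key
  simp only [Polynomial.map_mul, Polynomial.map_pow, Polynomial.map_add, Polynomial.map_X,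
    Polynomial.map_C, hp', add_zero] at key2
  have key3 := mul_right_cancel₀ hq' key2
  have he : residue A e ≠ 0 := (residue_ne_zero_iff _).2 hval
  have hdeg := congrArg Polynomial.natDegree key3
  rw [Polynomial.natDegree_mul (mul_ne_zero (by simpa using he) Polynomial.X_ne_zero)
    (pow_ne_zero 2 hp), Polynomial.natDegree_C_mul he, Polynomial.natDegree_X,
    Polynomial.natDegree_pow, Polynomial.natDegree_pow] at hdeg
  omega

theorem gauss_val_polynomial_lt {A : ValuationSubring F} {P : Polynomial F}
    (h : ∀ i, A.valuation (P.coeff i) < 1) :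
    (gaussRing A).valuation (algebraMap (Polynomial F) (RatFunc F) P) < 1 := by
  rw [P.as_sum_range_C_mul_X_pow, map_sum]
  refine Valuation.map_sum_lt _ one_ne_zero fun i _ => ?_
  rw [map_mul, map_pow, RatFunc.algebraMap_X, RatFunc.algebraMap_C, map_mul, map_pow, gauss_val_X,
    one_pow, mul_one]
  exact gauss_val_C_lt.2 (h i)

end Gauss

section Dyadic

open IsLocalRing

variable {E : Type*} [Field E] {O : ValuationSubring E}

theorem two_residue_eq_zero (h2 : O.valuation 2 < 1) : (2 : ResidueField O) = 0 := by
  have := (residue_eq_zero_iff' (2 : O)).2 h2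
  rwa [map_ofNat] at this

theorem neg_one_mem_oneUnits (h2 : O.valuation 2 < 1) : (-1 : E) ∈ oneUnits O := by
  refine ⟨1, one_ne_zero, ?_⟩
  rw [show (-1 : E) * 1 ^ 2 - 1 = -2 by norm_num, Valuation.map_neg]
  exact h2

theorem oneUnits_pm (h2 : O.valuation 2 < 1) {x : E} :
    x ∈ (oneUnits O).pm ↔ x ∈ oneUnits O := by
  rw [SqGroup.mem_pm]
  refine ⟨?_, Or.inl⟩
  rintro (h | h)
  · exact h
  · simpa using SqGroup.mul (neg_one_mem_oneUnits h2) h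

theorem special_of_val_two_lt (h2 : O.valuation 2 < 1) : Special (oneUnits O) (unitsSq O) :=
  special_of_specialField (neg_one_mem_oneUnits h2) (specialField_charTwo (two_residue_eq_zero h2))

theorem isSquare_of_one_add {κ : Type*} [Field κ] (h2 : (2 : κ) = 0) {x : κ}
    (h : IsSquare (1 + x)) : IsSquare x := by
  obtain ⟨s, hs⟩ := h
  exact ⟨s + 1, by linear_combination hs - (s + 1) * h2⟩

theorem indepPair_of_val_two_lt (h2 : O.valuation 2 < 1) {z : E} (hz : O.valuation z = 1)
    (hzT : z ∉ oneUnits O) :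
    O.valuation (1 - z) = 1 ∧ IndepPair (oneUnits O) z (1 - z) := by
  have h2' := two_residue_eq_zero h2
  have h1 : O.valuation (1 - z) = 1 := by
    refine le_antisymm (O.valuation.map_sub_le (map_one _).le hz.le) ?_
    by_contra! h
    refine hzT ⟨1, one_ne_zero, ?_⟩
    rwa [one_pow, mul_one, Valuation.map_sub_swap]
  let z' : O := ⟨z, (O.valuation_le_one_iff _).1 hz.le⟩
  have hz' : ¬ IsSquare (residue O z') := fun h => hzT ((isSquare_residue_iff (a := z') hz).1 h)
  refine ⟨h1, add_sub_cancel _ _, ?_, ?_, ?_⟩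
  · rwa [oneUnits_pm h2]
  · rw [oneUnits_pm h2]
    intro h
    have h3 := (isSquare_residue_iff (a := 1 - z') h1).2 h
    rw [map_sub, map_one] at h3
    refine hz' (isSquare_of_one_add h2' ?_)
    convert h3 using 1
    linear_combination residue O z' * h2'
  · rw [oneUnits_pm h2]
    intro h
    have h3 := (isSquare_residue_iff (a := z' * (1 - z'))
      (show O.valuation (z * (1 - z)) = 1 by rw [map_mul, hz, h1, one_mul])).2 h
    rw [map_mul, map_sub, map_one] at h3
    obtain ⟨s, hs⟩ := h3
    exact hz' ⟨s + residue O z', by linear_combination hs - s * residue O z' * h2'⟩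

theorem eq_of_le_of_val_two_lt (h2 : O.valuation 2 < 1) {z : E} (hz : O.valuation z = 1)
    (hzT : z ∉ oneUnits O) (O₃ : ValuationSubring E) (hle : O₃ ≤ O)
    (h : ∀ x, O₃.valuation x < 1 → 1 + x ∈ oneUnits O) : O₃ = O := by
  have h2' := two_residue_eq_zero h2
  refine le_antisymm hle fun μ hμ => ?_
  by_contra hμ3
  have hμ0 : μ ≠ 0 := by rintro rfl; exact hμ3 O₃.zero_mem
  set ν := μ⁻¹ with hν
  have hν3 : O₃.valuation ν < 1 := val_lt_one_of_inv_notMem (by rwa [hν, inv_inv])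
  have hνO : O.valuation ν = 1 := by
    refine le_antisymm ((O.valuation_le_one_iff _).2 (hle ((O₃.valuation_le_one_iff _).1 hν3.le)))
      (not_lt.1 fun hlt => inv_notMem_of_val_lt_one (inv_ne_zero hμ0) hlt (by rwa [inv_inv]))
  have key : ∀ x, O₃.valuation x < 1 → O.valuation x = 1 → x ∈ oneUnits O := by
    intro x hx3 hx
    let x' : O := ⟨x, (O.valuation_le_one_iff _).1 hx.le⟩
    refine (isSquare_residue_iff (a := x') hx).1 (isSquare_of_one_add h2' ?_)
    have hle1 : O.valuation (1 + x) ≤ 1 := Valuation.map_add_le _ (by simp) hx.le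
    rcases hle1.lt_or_eq with hlt | heq
    · have := (residue_eq_zero_iff' (1 + x')).2 hlt
      rw [map_add, map_one] at this
      exact this ▸ IsSquare.zero
    · have := (isSquare_residue_iff (a := 1 + x') heq).2 (h x hx3)
      rwa [map_add, map_one] at this
  have hνT := key ν hν3 hνO
  refine hzT ?_
  rcases O₃.mem_or_inv_mem z with hz3 | hz3
  · refine (SqGroup.mul_iff hνT).1 (key _ ?_ (by rw [map_mul, hνO, hz, one_mul]))
    rw [map_mul]
    exact mul_lt_one_of_lt_of_le hν3 ((O₃.valuation_le_one_iff _).2 hz3)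
  · refine SqGroup.inv_iff.1 ((SqGroup.mul_iff hνT).1 (key _ ?_
      (by rw [map_mul, hνO, map_inv₀, hz, inv_one, one_mul])))
    rw [map_mul]
    exact mul_lt_one_of_lt_of_le hν3 ((O₃.valuation_le_one_iff _).2 hz3)

theorem Arch.comap {L : Type*} [Field L] (h : Arch O) (j : L →+* E) : Arch (O.comap j) := by
  intro x hx y
  obtain ⟨n, hn⟩ := h (j x) (val_comap_lt.1 hx) (j y)
  exact ⟨n, val_comap_lt.2 (by rwa [map_mul, map_pow])⟩

theorem exists_unit_notMem_oneUnits {L : Type*} [Field L] (j : L →+* E) (h2 : O.valuation 2 < 1)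
    {X : E} (hX : O.valuation X = 1) (hXT : X ∉ oneUnits O) {P : Polynomial L} (hP : P ≠ 0)
    (hPX : P.eval₂ j X = 0) :
    ∃ z, (O.comap j).valuation z = 1 ∧ z ∉ oneUnits (O.comap j) := by
  by_contra! hcon
  set W := O.comap j with hW
  have h2W : W.valuation 2 < 1 := val_comap_lt.2 (by rwa [map_ofNat])
  let f : W →+* O := (j.comp W.subtype).codRestrict O.toSubring fun x => x.2
  have hf : ∀ x : W, (f x : E) = j x := fun _ => rfl
  have hloc : IsLocalHom f := ⟨fun x hx => by
    rw [← residue_ne_zero_iff_isUnit, residue_ne_zero_iff] at hx ⊢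
    exact val_comap_eq.2 hx⟩
  let F := ResidueField.map f
  let := F.toAlgebra
  have hsq : ∀ x : ResidueField W, IsSquare x := by
    intro x
    obtain ⟨x, rfl⟩ := residue_surjective x
    by_cases hx : residue W x = 0
    · exact hx ▸ IsSquare.zero
    · have hx' := (residue_ne_zero_iff x).1 hx
      exact (isSquare_residue_iff hx').2 (hcon _ hx')
  have : CharP (ResidueField W) 2 :=
    CharTwo.of_one_ne_zero_of_two_eq_zero one_ne_zero (two_residue_eq_zero h2W)
  have : CharP (ResidueField O) 2 :=
    CharTwo.of_one_ne_zero_of_two_eq_zero one_ne_zero (two_residue_eq_zero h2)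
  have : PerfectRing (ResidueField W) 2 := PerfectRing.ofSurjective _ 2 fun x => by
    obtain ⟨y, hy⟩ := hsq x
    exact ⟨y, by rw [hy, frobenius_def, pow_two]⟩
  have : PerfectField (ResidueField W) := PerfectRing.toPerfectField _ 2
  let X' : O := ⟨X, (O.valuation_le_one_iff _).1 hX.le⟩
  obtain ⟨c, hc, p, hp, hp'⟩ := exists_integral_multiple W hP
  have hroot : (p.map (residue W)).eval₂ F (residue O X') = 0 := by
    have h1 : p.eval₂ f X' = 0 := by
      apply Subtype.ext
      change O.subtype _ = _
      rw [Polynomial.hom_eval₂]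
      have h3 := congrArg (Polynomial.eval₂ j X) hp'
      rw [Polynomial.eval₂_map, Polynomial.eval₂_mul, hPX, mul_zero] at h3
      exact h3
    have h4 := congrArg (residue O) h1
    rw [Polynomial.hom_eval₂, map_zero] at h4
    rw [Polynomial.eval₂_map, ← h4]
    congr 1
  have halg : IsAlgebraic (ResidueField W) (residue O X') := ⟨_, hp, hroot⟩
  have : Algebra.IsAlgebraic (ResidueField W)
      (IntermediateField.adjoin (ResidueField W) {residue O X'}) :=
    IntermediateField.isAlgebraic_adjoin_simple halg.isIntegral
  let M := IntermediateField.adjoin (ResidueField W) {residue O X'}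
  have : PerfectField M := Algebra.IsAlgebraic.perfectField (ResidueField W)
  have : CharP M 2 := (algebraMap M (ResidueField O)).charP (algebraMap M (ResidueField O)).injective 2
  have : PerfectRing M 2 := PerfectField.toPerfectRing 2
  obtain ⟨y, hy⟩ := surjective_frobenius M 2 ⟨residue O X', IntermediateField.subset_adjoin _ _ rfl⟩
  have hXsq : IsSquare (residue O X') := by
    have := congrArg (algebraMap M (ResidueField O)) hy
    rw [frobenius_def, map_pow] at this
    exact ⟨_, by rw [← pow_two]; exact this.symm⟩
  exact hXT ((isSquare_residue_iff (a := X') hX).1 hXsq)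

end Dyadic

noncomputable section DyadicGauss

open IsDedekindDomain NumberField

universe w

variable {F : Type w} [Field F] [NumberField F]

theorem exists_dyadic (F : Type w) [Field F] [NumberField F] :
    ∃ v : HeightOneSpectrum (𝓞 F), v.valuation F 2 < 1 := by
  have h2 : Ideal.span {(2 : 𝓞 F)} ≠ ⊤ := by
    rw [Ne, Ideal.span_singleton_eq_top]
    intro hu
    obtain ⟨x, hx⟩ := hu.exists_right_inv
    have hx' : (2 : F) * (x : F) = 1 := by
      have := congrArg (algebraMap (𝓞 F) F) hx
      rwa [map_mul, map_one, map_ofNat] at this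
    have h1 : IsIntegral ℤ (algebraMap ℚ F (1 / 2)) := by
      have : algebraMap ℚ F (1 / 2) = x := by
        rw [map_div₀, map_one, map_ofNat]
        field_simp
        exact hx'.symm
      rw [this]
      exact x.isIntegral_coe
    rw [isIntegral_algebraMap_iff (algebraMap ℚ F).injective, IsIntegrallyClosed.isIntegral_iff] at h1
    obtain ⟨n, hn⟩ := h1
    have h3 : (n : ℚ) = 1 / 2 := hn
    have h4 : ((2 * n : ℤ) : ℚ) = ((1 : ℤ) : ℚ) := by push_cast; rw [h3]; norm_num
    have := Int.cast_injective h4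
    omega
  obtain ⟨M, hM, hle⟩ := Ideal.exists_le_maximal _ h2
  have h2M : (2 : 𝓞 F) ∈ M := hle (Ideal.mem_span_singleton_self _)
  refine ⟨⟨M, hM.isPrime, fun h => ?_⟩, ?_⟩
  · rw [h, Ideal.mem_bot] at h2M
    exact two_ne_zero h2M
  · have := (HeightOneSpectrum.valuation_lt_one_iff_mem (K := F) ⟨M, hM.isPrime, fun h => by
      rw [h, Ideal.mem_bot] at h2M; exact two_ne_zero h2M⟩ 2).2 h2M
    change HeightOneSpectrum.valuation F _ (algebraMap (𝓞 F) F 2) < 1 at this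
    rwa [map_ofNat] at this

theorem exists_pow_mul_lt_one (v : HeightOneSpectrum (𝓞 F)) {c : F} (hc : v.valuation F c < 1)
    (d : F) : ∃ n : ℕ, v.valuation F (c ^ n * d) < 1 := by
  by_cases hd : d = 0
  · exact ⟨0, by simp [hd]⟩
  have hd' : v.valuation F d ≠ 0 := (map_ne_zero _).2 hd
  obtain ⟨n, hn⟩ := exists_pow_lt₀ hc (Units.mk0 _ (inv_ne_zero hd'))
  refine ⟨n, ?_⟩
  rw [map_mul, map_pow]
  calc _ < (v.valuation F d)⁻¹ * v.valuation F d :=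
        mul_lt_mul_of_pos_right hn (zero_lt_iff.2 hd')
    _ = 1 := inv_mul_cancel₀ hd'

/-- The valuation ring of a prime of a number field. -/
abbrev primeRing (v : HeightOneSpectrum (𝓞 F)) : ValuationSubring F :=
  (v.valuation F).valuationSubring

theorem primeRing_lt {v : HeightOneSpectrum (𝓞 F)} {c : F} :
    (primeRing v).valuation c < 1 ↔ v.valuation F c < 1 :=
  (Valuation.isEquiv_valuation_valuationSubring _).lt_one_iff_lt_one.symm

theorem primeRing_eq {v : HeightOneSpectrum (𝓞 F)} {c : F} :
    (primeRing v).valuation c = 1 ↔ v.valuation F c = 1 :=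
  (Valuation.isEquiv_valuation_valuationSubring _).eq_one_iff_eq_one.symm

theorem arch_gaussRing (v : HeightOneSpectrum (𝓞 F)) : Arch (gaussRing (primeRing v)) := by
  intro x hx y
  by_cases hx0 : x = 0
  · exact ⟨1, by simp [hx0]⟩
  by_cases hy0 : y = 0
  · exact ⟨1, by simp [hy0]⟩
  obtain ⟨c, -, hc⟩ := gauss_exists_val_eq (primeRing v) hx0
  obtain ⟨d, -, hd⟩ := gauss_exists_val_eq (primeRing v) hy0
  rw [hc, gauss_val_C_lt, primeRing_lt] at hx
  obtain ⟨n, hn⟩ := exists_pow_mul_lt_one v hx d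
  refine ⟨n, ?_⟩
  rw [map_mul, map_pow, hc, hd, ← map_pow, ← map_mul, ← map_pow, ← map_mul, gauss_val_C_lt,
    primeRing_lt]
  exact hn

theorem exists_notMem_unitsSq {v : HeightOneSpectrum (𝓞 F)} (h2 : v.valuation F 2 < 1)
    {L : Type*} [Field L] (j : L →+* RatFunc F) :
    ∃ x, x ≠ 0 ∧ x ∉ unitsSq ((gaussRing (primeRing v)).comap j) := by
  by_contra! hcon
  have key : ∀ n : ℕ, ∀ x : L, x ≠ 0 → ∀ c : F, c ≠ 0 →
      (gaussRing (primeRing v)).valuation (j x) =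
        (gaussRing (primeRing v)).valuation (RatFunc.C c) → (2 : ℤ) ^ n ∣ ordAt v c := by
    intro n
    induction n with
    | zero => simp
    | succ n ih =>
      intro x hx c hc hxc
      obtain ⟨y, hy, hxy⟩ := hcon x hx
      rw [val_comap_eq, map_mul, map_pow, map_mul, map_pow, hxc] at hxy
      obtain ⟨d, hd, hyd⟩ := gauss_exists_val_eq (primeRing v) ((map_ne_zero j).2 hy)
      rw [hyd, ← map_pow, ← map_mul, ← map_pow, ← map_mul, gauss_val_C_eq, primeRing_eq] at hxy
      have h1 := ordAt_eq_zero hxy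
      rw [ordAt_mul v hc (pow_ne_zero 2 hd), ordAt_sq] at h1
      obtain ⟨m, hm⟩ := ih y hy d hd hyd
      exact ⟨-m, by rw [pow_succ]; linear_combination h1 - 2 * hm⟩
  have hne : ordAt v (2 : F) ≠ 0 := by
    intro h0
    rw [val_eq_exp v two_ne_zero, h0] at h2
    simp at h2
  have h2L : (2 : L) ≠ 0 := by
    intro h
    have h1 := congrArg j h
    rw [map_ofNat, map_zero, ← map_ofNat RatFunc.C 2, map_eq_zero] at h1
    exact two_ne_zero h1
  refine hne (Int.eq_zero_of_abs_lt_dvd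
    (key (ordAt v (2 : F)).natAbs 2 h2L 2 two_ne_zero (by rw [map_ofNat j, map_ofNat RatFunc.C])) ?_)
  rw [Int.abs_eq_natAbs]
  exact_mod_cast Nat.lt_two_pow_self

theorem exists_scale (v : HeightOneSpectrum (𝓞 F)) {P : Polynomial F} (hP : P.coeff 0 ≠ 0) :
    ∃ ρ : F, ρ ≠ 0 ∧ ∀ i, (primeRing v).valuation
      ((Polynomial.C (P.coeff 0)⁻¹ * P.comp (Polynomial.C ρ * Polynomial.X) - 1).coeff i) < 1 := by
  obtain ⟨π, hπ0, hπ⟩ := exists_uniformizer v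
  have hπ1 : v.valuation F (π : F) < 1 := by
    rw [hπ, ← WithZero.exp_zero, WithZero.exp_lt_exp]; norm_num
  have hπ0' : (π : F) ≠ 0 := by simpa using hπ0
  choose n hn using fun i => exists_pow_mul_lt_one v hπ1 ((P.coeff 0)⁻¹ * P.coeff i)
  set m := (Finset.range (P.natDegree + 1)).sup n with hm
  refine ⟨(π : F) ^ m, pow_ne_zero _ hπ0', fun i => ?_⟩
  rw [primeRing_lt, Polynomial.coeff_sub, Polynomial.coeff_C_mul, Polynomial.comp_C_mul_X_coeff]
  rcases Nat.eq_zero_or_pos i with rfl | hi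
  · simp [hP]
  rw [Polynomial.coeff_one, if_neg hi.ne', sub_zero]
  by_cases hid : i ≤ P.natDegree
  · have hle : n i ≤ m * i := (Finset.le_sup (f := n) (Finset.mem_range.2 (by omega))).trans
      (Nat.le_mul_of_pos_right _ hi)
    rw [← pow_mul, ← Nat.sub_add_cancel hle, pow_add, show (P.coeff 0)⁻¹ * (P.coeff i *
      ((π : F) ^ (m * i - n i) * (π : F) ^ n i)) = (π : F) ^ (m * i - n i) * ((π : F) ^ n i *
      ((P.coeff 0)⁻¹ * P.coeff i)) by ring, map_mul, map_pow]
    exact mul_lt_one_of_nonneg_of_lt_one_right (pow_le_one₀ zero_le hπ1.le) zero_le (hn i)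
  · rw [Polynomial.coeff_eq_zero_of_natDegree_lt (not_le.1 hid)]
    simp

/-- A valuation ring witnessing that an element is not a one-unit, with all the properties needed
to transport it along a Witt equivalence. -/
structure DyadicWitness {L : Type*} [Field L] (g : L) (W : ValuationSubring L) : Prop where
  two : W.valuation 2 < 1
  arch : Arch W
  exists_notMem : ∃ x, x ≠ 0 ∧ x ∉ unitsSq W
  exists_unit : ∃ z, W.valuation z = 1 ∧ z ∉ oneUnits W
  notMem : g ∉ oneUnits W

theorem mem_oneUnits_of_comap {L M : Type*} [Field L] [Field M] {O : ValuationSubring M}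
    {j : L →+* M} {g : L} (h : g ∈ oneUnits (O.comap j)) : j g ∈ oneUnits O := by
  obtain ⟨y, hy, h⟩ := h
  refine ⟨j y, (map_ne_zero j).2 hy, ?_⟩
  rw [val_comap_lt] at h
  simpa using h

theorem exists_dyadicWitness {L : Type*} [Field L] {v : HeightOneSpectrum (𝓞 F)}
    (h2 : v.valuation F 2 < 1) (j : L →+* RatFunc F)
    {P : Polynomial L} (hP : P ≠ 0) (hPX : P.eval₂ j RatFunc.X = 0) {g : L} {d : F} {B s : RatFunc F}
    (hs : s ≠ 0) (hB : (gaussRing (primeRing v)).valuation (B - 1) < 1)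
    (hg : j g = RatFunc.C d * RatFunc.X * B * s ^ 2) :
    DyadicWitness g ((gaussRing (primeRing v)).comap j) := by
  have h2' : (gaussRing (primeRing v)).valuation 2 < 1 := by
    have := gauss_val_C_lt.2 (primeRing_lt.2 h2)
    rwa [map_ofNat] at this
  refine ⟨val_comap_lt.2 (by rwa [map_ofNat]), (arch_gaussRing v).comap j,
    exists_notMem_unitsSq h2 j, exists_unit_notMem_oneUnits j h2' (gauss_val_X _) ?_ hP hPX, ?_⟩
  · simpa using gauss_C_mul_X_notMem (primeRing v) 1
  · intro h
    have h1 := mem_oneUnits_of_comap h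
    have hB' : B ∈ oneUnits (gaussRing (primeRing v)) := by
      simpa using one_add_mem_oneUnits hB
    rw [hg, SqGroup.mul_sq_iff hs, SqGroup.mul_iff' hB'] at h1
    exact gauss_C_mul_X_notMem _ _ h1

end DyadicGauss

section DyadicExists

open IsDedekindDomain NumberField

universe w

theorem numberField_of_finite {k k' : Type*} [Field k] [NumberField k] [Field k'] [Algebra k k']
    [FiniteDimensional k k'] : NumberField k' := by
  have : CharZero k' := charZero_of_injective_algebraMap (algebraMap k k').injective
  have : FiniteDimensional ℚ k' := Module.Finite.trans k _
  exact { }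

theorem exists_root_extension {k : Type w} [Field k] [NumberField k] {p : Polynomial k}
    (hp : Irreducible p) : ∃ (k' : Type w) (_ : Field k') (_ : NumberField k') (h : k →+* k')
      (θ : k'), ∀ G : Polynomial k, G.eval₂ h θ = 0 ↔ p ∣ G := by
  have : Fact (Irreducible p) := ⟨hp⟩
  have : FiniteDimensional k (AdjoinRoot p) := (AdjoinRoot.powerBasis hp.ne_zero).finite
  refine ⟨AdjoinRoot p, inferInstance, numberField_of_finite (k := k), AdjoinRoot.of p,
    AdjoinRoot.root p, fun G => ?_⟩
  rw [← AdjoinRoot.mk_eq_zero, ← AdjoinRoot.aeval_eq, Polynomial.aeval_def,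
    AdjoinRoot.algebraMap_eq]

theorem exists_sq_mul_squarefree {k : Type*} [Field k] (n : ℕ) : ∀ P : Polynomial k, P ≠ 0 →
    P.natDegree ≤ n → ∃ f S : Polynomial k, P = f ^ 2 * S ∧ Squarefree S := by
  induction n with
  | zero =>
    intro P hP hn
    refine ⟨1, P, by simp, ?_⟩
    refine IsUnit.squarefree (Polynomial.isUnit_iff_degree_eq_zero.2 ?_)
    rw [Polynomial.degree_eq_natDegree hP, Nat.le_zero.1 hn]
    rfl
  | succ n ih =>
    intro P hP hn
    by_cases hsq : Squarefree P
    · exact ⟨1, P, by simp, hsq⟩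
    unfold Squarefree at hsq
    push Not at hsq
    obtain ⟨x, ⟨Q, hQ⟩, hx⟩ := hsq
    have hx0 : x ≠ 0 := by rintro rfl; simp at hQ; exact hP hQ
    have hQ0 : Q ≠ 0 := by rintro rfl; simp at hQ; exact hP hQ
    have hd : 0 < x.natDegree := by
      rw [Nat.pos_iff_ne_zero]
      intro h0
      refine hx (Polynomial.isUnit_iff_degree_eq_zero.2 ?_)
      rw [Polynomial.degree_eq_natDegree hx0, h0]
      rfl
    have hdeg := congrArg Polynomial.natDegree hQ
    rw [Polynomial.natDegree_mul (mul_ne_zero hx0 hx0) hQ0, Polynomial.natDegree_mul hx0 hx0] at hdeg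
    obtain ⟨f, S, hfS, hS⟩ := ih Q hQ0 (by omega)
    exact ⟨x * f, S, by rw [hQ, hfS]; ring, hS⟩

theorem isAlgebraic_C {L F : Type*} [Field L] [Field F] [NumberField F] [Algebra L (RatFunc F)]
    (θ : F) : IsAlgebraic L (RatFunc.C θ : RatFunc F) := by
  have : CharZero (RatFunc F) := charZero_of_injective_ringHom (RatFunc.C (K := F)).injective
  have : CharZero L := ⟨fun a b h => by
    have := congrArg (algebraMap L (RatFunc F)) h
    simpa using this⟩
  obtain ⟨p, hp, h⟩ := Algebra.IsAlgebraic.isAlgebraic (R := ℚ) θ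
  refine ⟨p.map (algebraMap ℚ L), (Polynomial.map_ne_zero_iff (algebraMap ℚ L).injective).2 hp, ?_⟩
  rw [Polynomial.aeval_def, Polynomial.eval₂_map, Subsingleton.elim
    ((algebraMap L (RatFunc F)).comp (algebraMap ℚ L)) (RatFunc.C.comp (algebraMap ℚ F)),
    ← Polynomial.hom_eval₂]
  rw [Polynomial.aeval_def] at h
  rw [h, map_zero]

theorem exists_dyadicWitness_of_ne {k : Type w} [Field k] [NumberField k] {L : Type*} [Field L]
    (j : L →+* RatFunc k) {P₀ : Polynomial L} (hP₀ : P₀ ≠ 0) (hPX : P₀.eval₂ j RatFunc.X = 0)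
    {g : L} (hg0 : g ≠ 0) (hg : ∀ (c : k) (f : RatFunc k), j g ≠ RatFunc.C c * f ^ 2) :
    ∃ W : ValuationSubring L, DyadicWitness g W := by
  obtain ⟨P, Q, hQ, hPQ⟩ := IsFractionRing.div_surjective (A := Polynomial k) (j g)
  have hQ0 : Q ≠ 0 := nonZeroDivisors.ne_zero hQ
  have hQ1 : algebraMap (Polynomial k) (RatFunc k) Q ≠ 0 := by simpa using hQ0
  have hP0 : P ≠ 0 := by
    rintro rfl
    rw [map_zero, zero_div] at hPQ
    exact (map_ne_zero j).2 hg0 hPQ.symm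
  obtain ⟨f, S, hfS, hS⟩ := exists_sq_mul_squarefree _ (P * Q) (mul_ne_zero hP0 hQ0) le_rfl
  have hf0 : f ≠ 0 := by rintro rfl; simp [hP0, hQ0] at hfS
  have hSu : ¬ IsUnit S := by
    intro hu
    obtain ⟨c, -, rfl⟩ := Polynomial.isUnit_iff.1 hu
    refine hg c (algebraMap _ _ f / algebraMap _ _ Q) ?_
    have h1 := congrArg (algebraMap (Polynomial k) (RatFunc k)) hfS
    rw [map_mul, map_mul, map_pow, RatFunc.algebraMap_C] at h1
    rw [← hPQ]
    field_simp
    linear_combination h1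
  obtain ⟨p, hp, G, hG⟩ := WfDvdMonoid.exists_irreducible_factor hSu (hS.ne_zero)
  have hpG : ¬ p ∣ G := fun ⟨r, hr⟩ =>
    hp.not_isUnit (hS p ⟨r, by rw [hG, hr]; ring⟩)
  obtain ⟨F, _, _, h, θ, hθ⟩ := exists_root_extension hp
  obtain ⟨v, hv⟩ := exists_dyadic F
  have hder : p.derivative.eval₂ h θ ≠ 0 := by
    intro h0
    have := (hθ _).1 h0
    exact hp.natDegree_pos.ne' (Polynomial.derivative_eq_zero.1 <| Polynomial.eq_zero_of_dvd_of_degree_lt this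
      (Polynomial.degree_derivative_lt hp.ne_zero))
  have hroot : (S.map h).IsRoot θ := by
    rw [Polynomial.IsRoot, Polynomial.eval_map, hθ, hG]
    exact dvd_mul_right _ _
  obtain ⟨P₁, hP₁⟩ := Polynomial.dvd_iff_isRoot.2 hroot
  have hP₁0 : P₁.eval θ ≠ 0 := by
    have h1 := congrArg (fun q => (Polynomial.derivative q).eval θ) hP₁
    simp only [Polynomial.derivative_map, Polynomial.derivative_mul, Polynomial.eval_add,
      Polynomial.eval_mul, hG, Polynomial.eval_map, Polynomial.eval₂_add, Polynomial.eval₂_mul,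
      (hθ p).2 dvd_rfl, zero_mul, add_zero, Polynomial.eval_sub, Polynomial.eval_X,
      Polynomial.eval_C, sub_self, Polynomial.derivative_sub, Polynomial.derivative_X,
      Polynomial.derivative_C, sub_zero, one_mul] at h1
    rw [← h1]
    exact mul_ne_zero hder fun h0 => hpG ((hθ G).1 h0)
  set R := P₁.comp (Polynomial.X + Polynomial.C θ) with hR
  have hR0 : R.coeff 0 = P₁.eval θ := by
    rw [Polynomial.coeff_zero_eq_eval_zero, hR, Polynomial.eval_comp]
    simp
  obtain ⟨ρ, hρ, hB⟩ := exists_scale v (P := R) (by rwa [hR0])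
  let q : Polynomial F := Polynomial.C ρ * Polynomial.X + Polynomial.C θ
  let σ : Polynomial k →+* Polynomial F :=
    (Polynomial.compRingHom q).comp (Polynomial.mapRingHom h)
  have hσ : ∀ p, σ p = (p.map h).comp q := fun _ => rfl
  have hqd : q.natDegree = 1 := Polynomial.natDegree_linear hρ
  have hσi : Function.Injective ((algebraMap (Polynomial F) (RatFunc F)).comp σ) := by
    refine (RatFunc.algebraMap_injective F).comp ((injective_iff_map_eq_zero σ).2 fun p h0 => ?_)
    rw [hσ, Polynomial.comp_eq_zero_iff] at h0
    rcases h0 with h0 | ⟨-, h0⟩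
    · exact (Polynomial.map_eq_zero h).1 h0
    · rw [h0, Polynomial.natDegree_C] at hqd
      exact absurd hqd zero_ne_one
  let ψ : RatFunc k →+* RatFunc F := IsFractionRing.lift hσi
  have hψ : ∀ p : Polynomial k, ψ (algebraMap (Polynomial k) (RatFunc k) p) =
      algebraMap (Polynomial F) (RatFunc F) ((p.map h).comp q) := fun p =>
    IsFractionRing.lift_algebraMap hσi p
  let := (ψ.comp j).toAlgebra
  have hX : ψ RatFunc.X = RatFunc.C ρ * RatFunc.X + RatFunc.C θ := by
    rw [← RatFunc.algebraMap_X, hψ, Polynomial.map_X, Polynomial.X_comp, map_add, map_mul,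
      RatFunc.algebraMap_X, RatFunc.algebraMap_C, RatFunc.algebraMap_C]
  have halg1 : IsAlgebraic L (ψ RatFunc.X) := ⟨P₀, hP₀, by
    rw [Polynomial.aeval_def]
    change Polynomial.eval₂ (ψ.comp j) _ _ = 0
    rw [← Polynomial.hom_eval₂, hPX, map_zero]⟩
  have hρ1 : (RatFunc.C ρ : RatFunc F) ≠ 0 := by simpa using hρ
  have halg : IsAlgebraic L (RatFunc.X : RatFunc F) := by
    have h1 := (halg1.sub (isAlgebraic_C θ)).mul (isAlgebraic_C (L := L) ρ).inv
    have h2 : (RatFunc.X : RatFunc F) = (ψ RatFunc.X - RatFunc.C θ) * (RatFunc.C ρ)⁻¹ := by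
      rw [hX]
      field_simp
      ring
    rw [h2]
    exact h1
  obtain ⟨P₂, hP₂, hP₂X⟩ := halg
  refine ⟨_, exists_dyadicWitness hv (ψ.comp j) hP₂ hP₂X (d := ρ * R.coeff 0)
    (B := algebraMap _ _ (Polynomial.C (R.coeff 0)⁻¹ * R.comp (Polynomial.C ρ * Polynomial.X)))
    (s := ψ (algebraMap _ _ f / algebraMap _ _ Q)) ?_ ?_ ?_⟩
  · exact (map_ne_zero ψ).2 (div_ne_zero (by simpa using hf0) hQ1)
  · rw [← map_one (algebraMap (Polynomial F) (RatFunc F)), ← map_sub]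
    exact gauss_val_polynomial_lt hB
  · have h1 : j g = algebraMap _ _ S * (algebraMap _ _ f / algebraMap _ _ Q) ^ 2 := by
      have h1 := congrArg (algebraMap (Polynomial k) (RatFunc k)) hfS
      rw [map_mul, map_mul, map_pow] at h1
      rw [← hPQ]
      field_simp
      linear_combination h1
    have hR1 : R.coeff 0 ≠ 0 := by rwa [hR0]
    have h2 : (S.map h).comp q = Polynomial.C (ρ * R.coeff 0) * Polynomial.X *
        (Polynomial.C (R.coeff 0)⁻¹ * R.comp (Polynomial.C ρ * Polynomial.X)) := by
      rw [hP₁, Polynomial.mul_comp, hR, Polynomial.comp_assoc]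
      have h3 : (Polynomial.X + Polynomial.C θ).comp (Polynomial.C ρ * Polynomial.X) = q := by
        simp [q]
      rw [h3, ← hR]
      have h4 : (Polynomial.X - Polynomial.C θ).comp q = Polynomial.C ρ * Polynomial.X := by
        simp [q]
      have h5 : (Polynomial.C (R.coeff 0) : Polynomial F) * Polynomial.C (R.coeff 0)⁻¹ = 1 := by
        rw [← Polynomial.C_mul, mul_inv_cancel₀ hR1, Polynomial.C_1]
      rw [h4, Polynomial.C_mul]
      linear_combination (-Polynomial.C ρ * Polynomial.X * P₁.comp q) * h5
    change ψ (j g) = _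
    rw [h1, map_mul, hψ, h2, map_mul, map_mul, RatFunc.algebraMap_C, RatFunc.algebraMap_X, map_pow]

end DyadicExists

section ConicParam

universe w

variable {F : Type w} [Field F]

noncomputable def conicX (α b : F) : RatFunc F :=
  (RatFunc.C b - RatFunc.X ^ 2) / (RatFunc.C α * (RatFunc.C b + RatFunc.X ^ 2))

noncomputable def conicY (b : F) : RatFunc F := 2 * RatFunc.X / (RatFunc.C b + RatFunc.X ^ 2)

theorem C_add_X_sq_ne_zero {b : F} (hb : b ≠ 0) :
    (RatFunc.C b + RatFunc.X ^ 2 : RatFunc F) ≠ 0 := by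
  rw [← RatFunc.algebraMap_C, ← RatFunc.algebraMap_X, ← map_pow, ← map_add]
  intro h0
  have h1 := congrArg (fun p : Polynomial F => p.coeff 0) ((map_eq_zero_iff _
    (RatFunc.algebraMap_injective F)).1 h0)
  simp at h1
  exact hb h1

theorem ratFunc_X_ne_zero : (RatFunc.X : RatFunc F) ≠ 0 := RatFunc.X_ne_zero

theorem ratFunc_two_ne_zero [CharZero F] : (2 : RatFunc F) ≠ 0 := by
  rw [← map_ofNat RatFunc.C 2]
  exact (map_ne_zero _).2 two_ne_zero

theorem conicX_sq_add_conicY_sq {α b : F} (hα : α ≠ 0) (hb : b ≠ 0) :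
    RatFunc.C (α ^ 2) * conicX α b ^ 2 + RatFunc.C b * conicY b ^ 2 = 1 := by
  have h1 := C_add_X_sq_ne_zero hb
  have h2 : (RatFunc.C α : RatFunc F) ≠ 0 := (map_ne_zero _).2 hα
  rw [conicX, conicY, map_pow]
  field_simp
  ring

theorem conicY_ne_zero [CharZero F] {b : F} (hb : b ≠ 0) : conicY b ≠ 0 :=
  div_ne_zero (mul_ne_zero ratFunc_two_ne_zero ratFunc_X_ne_zero) (C_add_X_sq_ne_zero hb)

theorem ratFunc_X_eq [CharZero F] {α b : F} (hα : α ≠ 0) (hb : b ≠ 0) :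
    RatFunc.X = (1 - RatFunc.C α * conicX α b) / conicY b := by
  have h1 := C_add_X_sq_ne_zero hb
  have h2 : (RatFunc.C α : RatFunc F) ≠ 0 := (map_ne_zero _).2 hα
  have h3 := ratFunc_two_ne_zero (F := F)
  have h4 := ratFunc_X_ne_zero (F := F)
  rw [eq_div_iff (conicY_ne_zero hb), conicX, conicY]
  field_simp
  ring

theorem transcendental_conicX [CharZero F] {α b : F} (hα : α ≠ 0) (hb : b ≠ 0) :
    Transcendental F (conicX α b) := by
  refine RatFunc.transcendental_of_ne_C _ ?_
  rintro ⟨c, hc⟩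
  have h1 := C_add_X_sq_ne_zero hb
  have h2 : (RatFunc.C α : RatFunc F) ≠ 0 := (map_ne_zero _).2 hα
  rw [conicX, div_eq_iff (mul_ne_zero h2 h1)] at hc
  have h3 : (Polynomial.C b - Polynomial.X ^ 2 : Polynomial F) =
      Polynomial.C c * (Polynomial.C α * (Polynomial.C b + Polynomial.X ^ 2)) := by
    apply RatFunc.algebraMap_injective F
    simpa [RatFunc.algebraMap_C, RatFunc.algebraMap_X] using hc
  have h4 := congrArg (fun p : Polynomial F => p.coeff 0) h3
  have h5 := congrArg (fun p : Polynomial F => p.coeff 2) h3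
  simp [Polynomial.coeff_C] at h4 h5
  have h6 : (2 : F) * b = 0 := by linear_combination h4 - b * h5
  exact (mul_ne_zero two_ne_zero hb) h6

theorem exists_neg_hom (F : Type w) [Field F] : ∃ σ : RatFunc F →+* RatFunc F,
    σ RatFunc.X = - RatFunc.X ∧ ∀ c, σ (RatFunc.C c) = RatFunc.C c := by
  let τ : Polynomial F →+* Polynomial F := Polynomial.compRingHom (-Polynomial.X)
  have hττ : ∀ p, τ (τ p) = p := fun p => by
    change (p.comp (-Polynomial.X)).comp (-Polynomial.X) = p
    rw [Polynomial.comp_assoc]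
    simp
  have hτ : Function.Injective ((algebraMap (Polynomial F) (RatFunc F)).comp τ) :=
    (RatFunc.algebraMap_injective F).comp (Function.LeftInverse.injective hττ)
  have key : ∀ p : Polynomial F, (IsFractionRing.lift hτ : RatFunc F →+* RatFunc F)
      (algebraMap (Polynomial F) (RatFunc F) p) =
      algebraMap (Polynomial F) (RatFunc F) (p.comp (-Polynomial.X)) := fun p =>
    IsFractionRing.lift_algebraMap hτ p
  refine ⟨IsFractionRing.lift hτ, ?_, fun c => ?_⟩
  · rw [← RatFunc.algebraMap_X, key, Polynomial.X_comp, map_neg]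
  · rw [← RatFunc.algebraMap_C, key, Polynomial.C_comp]

theorem conic_linearIndependent [CharZero F] {α b : F} (hα : α ≠ 0) (hb : b ≠ 0)
    {P Q : Polynomial F} (h : P.eval₂ RatFunc.C (conicX α b) +
      Q.eval₂ RatFunc.C (conicX α b) * conicY b = 0) : P = 0 ∧ Q = 0 := by
  obtain ⟨σ, hσX, hσC⟩ := exists_neg_hom F
  have hσx : σ (conicX α b) = conicX α b := by
    simp only [conicX, map_div₀, map_sub, map_mul, map_add, map_pow, hσX, hσC, neg_sq]
  have hσy : σ (conicY b) = - conicY b := by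
    simp only [conicY, map_div₀, map_mul, map_add, map_pow, hσX, hσC, neg_sq, map_ofNat]
    ring
  have hσ2 : σ.comp RatFunc.C = RatFunc.C := RingHom.ext hσC
  have h' := congrArg σ h
  rw [map_add, map_mul, Polynomial.hom_eval₂, Polynomial.hom_eval₂, hσx, hσy, hσ2, map_zero] at h'
  have h2 := ratFunc_two_ne_zero (F := F)
  have hP : P.eval₂ RatFunc.C (conicX α b) = 0 := by
    refine (mul_eq_zero.1 (?_ : (2 : RatFunc F) * _ = 0)).resolve_left h2
    linear_combination h + h'
  have hQ : Q.eval₂ RatFunc.C (conicX α b) = 0 := by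
    rw [hP, zero_add] at h
    exact (mul_eq_zero.1 h).resolve_right (conicY_ne_zero hb)
  have hinj := transcendental_iff.1 (transcendental_conicX hα hb)
  exact ⟨hinj P hP, hinj Q hQ⟩

theorem subfield_eq_top (S : Subfield (RatFunc F)) (hC : ∀ c, RatFunc.C c ∈ S)
    (hX : RatFunc.X ∈ S) (z : RatFunc F) : z ∈ S := by
  have hp : ∀ p : Polynomial F, algebraMap (Polynomial F) (RatFunc F) p ∈ S := fun p => by
    induction p using Polynomial.induction_on' with
    | add p q hp hq => rw [map_add]; exact S.add_mem hp hq
    | monomial n c =>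
      rw [← Polynomial.C_mul_X_pow_eq_monomial, map_mul, map_pow, RatFunc.algebraMap_C,
        RatFunc.algebraMap_X]
      exact S.mul_mem (hC c) (S.pow_mem hX n)
  obtain ⟨p, q, -, rfl⟩ := IsFractionRing.div_surjective (A := Polynomial F) z
  exact S.div_mem (hp p) (hp q)

end ConicParam

section ConicField

universe w

variable {k : Type w} [Field k] {a b : k}

theorem conicRing_exists_form (hb : b ≠ 0) (z : ConicRing k a b) : ∃ P Q : Polynomial k,
    z = Ideal.Quotient.mk _ (P.eval₂ MvPolynomial.C (X 0) + Q.eval₂ MvPolynomial.C (X 0) * X 1) := by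
  obtain ⟨p, rfl⟩ := Ideal.Quotient.mk_surjective z
  have hrel : Ideal.Quotient.mk (Ideal.span {conicPoly k a b}) (X 1 ^ 2) =
      Ideal.Quotient.mk (Ideal.span {conicPoly k a b})
        (MvPolynomial.C b⁻¹ * (1 - MvPolynomial.C a * X 0 ^ 2)) := by
    rw [Ideal.Quotient.mk_eq_mk_iff_sub_mem, Ideal.mem_span_singleton]
    refine ⟨MvPolynomial.C b⁻¹, ?_⟩
    have h1 : (MvPolynomial.C b⁻¹ * MvPolynomial.C b : MvPolynomial (Fin 2) k) = 1 := by
      rw [← MvPolynomial.C_mul, inv_mul_cancel₀ hb, MvPolynomial.C_1]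
    rw [conicPoly]
    linear_combination (-(X 1 : MvPolynomial (Fin 2) k) ^ 2) * h1
  induction p using MvPolynomial.induction_on with
  | C c => exact ⟨Polynomial.C c, 0, by simp⟩
  | add p q hp hq =>
    obtain ⟨P, Q, h⟩ := hp
    obtain ⟨P', Q', h'⟩ := hq
    refine ⟨P + P', Q + Q', ?_⟩
    rw [map_add, h, h', ← map_add, Polynomial.eval₂_add, Polynomial.eval₂_add]
    congr 1
    ring
  | mul_X p i hp =>
    obtain ⟨P, Q, h⟩ := hp
    fin_cases i
    · refine ⟨P * Polynomial.X, Q * Polynomial.X, ?_⟩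
      rw [map_mul, h, ← map_mul, Polynomial.eval₂_mul, Polynomial.eval₂_mul, Polynomial.eval₂_X]
      congr 1
      change _ * X 0 = _
      ring
    · refine ⟨Q * (Polynomial.C b⁻¹ * (1 - Polynomial.C a * Polynomial.X ^ 2)), P, ?_⟩
      rw [map_mul, h]
      change _ * Ideal.Quotient.mk _ (X 1) = _
      rw [Polynomial.eval₂_mul, map_add, map_add, map_mul, map_mul, map_mul]
      have h2 : Polynomial.eval₂ (MvPolynomial.C (σ := Fin 2)) (X 0)
          (Polynomial.C b⁻¹ * (1 - Polynomial.C a * Polynomial.X ^ 2)) =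
          MvPolynomial.C b⁻¹ * (1 - MvPolynomial.C a * X 0 ^ 2) := by simp
      rw [h2, ← hrel, map_pow]
      ring

variable {k' : Type w} [Field k'] [Algebra k k'] [CharZero k']

theorem exists_conic_hom {L : Type*} [Field L] {ι : k →+* L} (hL : IsConicFunctionField k a b L ι)
    {α : k'} (hα : α ^ 2 = algebraMap k k' a) (hα0 : α ≠ 0) (hb : b ≠ 0) :
    ∃ φ : L →+* RatFunc k', φ.comp ι = RatFunc.C.comp (algebraMap k k') ∧
      (∃ x, φ x = conicX α (algebraMap k k' b)) ∧ (∃ y, φ y = conicY (algebraMap k k' b)) ∧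
      ∀ z, ∃ P Q P' Q' : Polynomial k,
        (P'.eval₂ (RatFunc.C.comp (algebraMap k k')) (conicX α (algebraMap k k' b)) +
          Q'.eval₂ (RatFunc.C.comp (algebraMap k k')) (conicX α (algebraMap k k' b)) *
          conicY (algebraMap k k' b)) ≠ 0 ∧
        φ z = (P.eval₂ (RatFunc.C.comp (algebraMap k k')) (conicX α (algebraMap k k' b)) +
          Q.eval₂ (RatFunc.C.comp (algebraMap k k')) (conicX α (algebraMap k k' b)) *
          conicY (algebraMap k k' b)) /
        (P'.eval₂ (RatFunc.C.comp (algebraMap k k')) (conicX α (algebraMap k k' b)) +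
          Q'.eval₂ (RatFunc.C.comp (algebraMap k k')) (conicX α (algebraMap k k' b)) *
          conicY (algebraMap k k' b)) := by
  obtain ⟨f, hf, hfι, hfr⟩ := hL
  have hb' : algebraMap k k' b ≠ 0 := (map_ne_zero _).2 hb
  set x := conicX α (algebraMap k k' b) with hx
  set y := conicY (algebraMap k k' b) with hy
  set c : k →+* RatFunc k' := RatFunc.C.comp (algebraMap k k') with hc
  let Ψ : MvPolynomial (Fin 2) k →+* RatFunc k' := MvPolynomial.eval₂Hom c ![x, y]
  have hΨ : ∀ p ∈ Ideal.span {conicPoly k a b}, Ψ p = 0 := by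
    intro p hp
    obtain ⟨q, rfl⟩ := Ideal.mem_span_singleton.1 hp
    have h1 := conicX_sq_add_conicY_sq hα0 hb'
    rw [hα] at h1
    have h2 : Ψ (conicPoly k a b) = 0 := by
      simp only [Ψ, conicPoly, map_sub, map_add, map_mul, map_pow, map_one,
        MvPolynomial.coe_eval₂Hom, MvPolynomial.eval₂_C, MvPolynomial.eval₂_X, Matrix.cons_val_zero,
        Matrix.cons_val_one]
      rw [sub_eq_zero]
      exact h1
    rw [map_mul, h2, zero_mul]
  let Φ : ConicRing k a b →+* RatFunc k' := Ideal.Quotient.lift _ Ψ hΨ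
  have hform : ∀ P Q : Polynomial k, Φ (Ideal.Quotient.mk _ (P.eval₂ MvPolynomial.C (X 0) +
      Q.eval₂ MvPolynomial.C (X 0) * X 1)) = P.eval₂ c x + Q.eval₂ c x * y := fun P Q => by
    change Ψ _ = _
    have h1 : Ψ.comp MvPolynomial.C = c := RingHom.ext fun r => by simp [Ψ]
    rw [map_add, map_mul, Polynomial.hom_eval₂, Polynomial.hom_eval₂, h1]
    simp [Ψ]
  have hΦ : Function.Injective Φ := by
    rw [injective_iff_map_eq_zero]
    intro z hz
    obtain ⟨P, Q, rfl⟩ := conicRing_exists_form hb z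
    rw [hform] at hz
    have h1 := conic_linearIndependent (P := P.map (algebraMap k k')) (Q := Q.map (algebraMap k k'))
      hα0 hb' (by rw [Polynomial.eval₂_map, Polynomial.eval₂_map]; exact hz)
    have h2 : ∀ R : Polynomial k, R.map (algebraMap k k') = 0 → R = 0 := fun R hR =>
      (Polynomial.map_eq_zero _).1 hR
    rw [h2 P h1.1, h2 Q h1.2]
    simp
  have : IsDomain (ConicRing k a b) := hf.isDomain f
  let := f.toAlgebra
  have : FaithfulSMul (ConicRing k a b) L := (faithfulSMul_iff_algebraMap_injective _ _).2 hf
  have : IsFractionRing (ConicRing k a b) L := IsFractionRing.of_field _ _ fun z => by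
    obtain ⟨p, q, -, h⟩ := hfr z
    exact ⟨p, q, h⟩
  let φ : L →+* RatFunc k' := IsFractionRing.lift hΦ
  have hφ : ∀ z, φ (f z) = Φ z := fun z => IsFractionRing.lift_algebraMap hΦ z
  refine ⟨φ, ?_, ⟨f (Ideal.Quotient.mk _ (X 0)), ?_⟩, ⟨f (Ideal.Quotient.mk _ (X 1)), ?_⟩,
    fun z => ?_⟩
  · ext r
    rw [← hfι]
    change φ (f _) = _
    rw [hφ]
    change Ψ (MvPolynomial.C r) = _
    simp [Ψ]
  · rw [hφ]; change Ψ _ = _; simp [Ψ]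
  · rw [hφ]; change Ψ _ = _; simp [Ψ]
  · obtain ⟨p, q, hq, rfl⟩ := hfr z
    obtain ⟨P, Q, rfl⟩ := conicRing_exists_form hb p
    obtain ⟨P', Q', rfl⟩ := conicRing_exists_form hb q
    refine ⟨P, Q, P', Q', ?_, ?_⟩
    · rw [← hform, ← hφ]
      exact (map_ne_zero φ).2 hq
    · rw [map_div₀, hφ, hφ, hform, hform]

end ConicField

section ConicDescent

universe w

theorem exists_quadratic {k : Type w} [Field k] [NumberField k] {a : k} (ha : ¬ IsSquare a) :
    ∃ (k' : Type w) (_ : Field k') (_ : NumberField k') (_ : Algebra k k')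
      (_ : FiniteDimensional k k') (α : k'), α ^ 2 = algebraMap k k' a ∧
      (∀ z, ∃ u v : k, z = algebraMap k k' u + algebraMap k k' v * α) ∧
      ∀ c d : k, algebraMap k k' c + algebraMap k k' d * α = 0 → c = 0 ∧ d = 0 := by
  set p : Polynomial k := Polynomial.X ^ 2 - Polynomial.C a with hp
  have hirr : Irreducible p := by
    refine X_pow_sub_C_irreducible_of_prime Nat.prime_two fun c hc => ha ⟨c, ?_⟩
    rw [← hc, pow_two]
  have hmonic : p.Monic := Polynomial.monic_X_pow_sub_C a two_ne_zero
  have hdeg : p.natDegree = 2 := Polynomial.natDegree_X_pow_sub_C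
  have : Fact (Irreducible p) := ⟨hirr⟩
  have : FiniteDimensional k (AdjoinRoot p) := (AdjoinRoot.powerBasis hirr.ne_zero).finite
  have hα : AdjoinRoot.root p ^ 2 = algebraMap k (AdjoinRoot p) a := by
    have h1 := AdjoinRoot.eval₂_root p
    rw [hp, Polynomial.eval₂_sub, Polynomial.eval₂_pow, Polynomial.eval₂_X, Polynomial.eval₂_C,
      sub_eq_zero] at h1
    exact h1
  refine ⟨AdjoinRoot p, inferInstance, numberField_of_finite (k := k), inferInstance, this,
    AdjoinRoot.root p, hα, fun z => ?_, fun c d h => ?_⟩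
  · induction z using AdjoinRoot.induction_on with
    | ih q =>
      induction q using Polynomial.induction_on' with
      | add q r hq hr =>
        obtain ⟨u, v, h⟩ := hq
        obtain ⟨u', v', h'⟩ := hr
        refine ⟨u + u', v + v', ?_⟩
        rw [map_add, h, h', map_add, map_add]
        ring
      | monomial n c =>
        induction n with
        | zero => exact ⟨c, 0, by simp⟩
        | succ n ih =>
          obtain ⟨u, v, h⟩ := ih
          refine ⟨v * a, u, ?_⟩
          rw [← Polynomial.monomial_mul_X, map_mul, h, AdjoinRoot.mk_X, map_mul, ← hα]
          ring
  · have h1 : AdjoinRoot.mk p (Polynomial.C c + Polynomial.C d * Polynomial.X) = 0 := by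
      rw [map_add, map_mul, AdjoinRoot.mk_X, AdjoinRoot.mk_C, AdjoinRoot.mk_C]
      exact h
    rw [AdjoinRoot.mk_eq_zero] at h1
    have h2 : (Polynomial.C c + Polynomial.C d * Polynomial.X : Polynomial k) = 0 := by
      refine Polynomial.eq_zero_of_dvd_of_natDegree_lt h1 ?_
      rw [hdeg, add_comm]
      exact lt_of_le_of_lt Polynomial.natDegree_linear_le one_lt_two
    have h3 := congrArg (fun q : Polynomial k => q.coeff 0) h2
    have h4 := congrArg (fun q : Polynomial k => q.coeff 1) h2
    simp [Polynomial.coeff_C] at h3 h4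
    exact ⟨h3, h4⟩

/-- The images of an abstract conic function field in a rational function field over a quadratic
extension. -/
structure QuadraticModel {k k' L : Type*} [Field k] [Field k'] [Field L] [Algebra k k']
    (a : k) (α : k') (ι : k →+* L) (φ : L →+* RatFunc k') : Prop where
  sq : α ^ 2 = algebraMap k k' a
  comp : φ.comp ι = RatFunc.C.comp (algebraMap k k')
  exists_coord : ∀ z : k', ∃ u v : k, z = algebraMap k k' u + algebraMap k k' v * α
  ne : ∀ z, φ z ≠ RatFunc.C α
  exists_rep : ∀ z, ∃ u v, z = φ u + RatFunc.C α * φ v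

theorem exists_quadraticModel {k : Type w} [Field k] [NumberField k] {a b : k} (ha : ¬ IsSquare a)
    (hb : b ≠ 0) {L : Type*} [Field L] {ι : k →+* L} (hL : IsConicFunctionField k a b L ι) :
    ∃ (k' : Type w) (_ : Field k') (_ : NumberField k') (_ : Algebra k k')
      (_ : FiniteDimensional k k') (α : k') (φ : L →+* RatFunc k'), QuadraticModel a α ι φ := by
  obtain ⟨k', _, _, _, hfin, α, hα, hrep, hind⟩ := exists_quadratic ha
  have hα0 : α ≠ 0 := by
    rintro rfl
    exact one_ne_zero (hind 0 1 (by simp)).2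
  obtain ⟨φ, hφι, ⟨x, hx⟩, ⟨y, hy⟩, hφ⟩ := exists_conic_hom hL hα hα0 hb
  have hb' : algebraMap k k' b ≠ 0 := (map_ne_zero _).2 hb
  have hne : ∀ z, φ z ≠ RatFunc.C α := by
    intro z hz
    obtain ⟨P, Q, P', Q', hne, h⟩ := hφ z
    rw [hz, eq_div_iff hne] at h
    have h1 := conic_linearIndependent (P := P.map (algebraMap k k') -
      Polynomial.C α * P'.map (algebraMap k k')) (Q := Q.map (algebraMap k k') -
      Polynomial.C α * Q'.map (algebraMap k k')) hα0 hb' (by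
        simp only [Polynomial.eval₂_sub, Polynomial.eval₂_mul, Polynomial.eval₂_C,
          Polynomial.eval₂_map]
        linear_combination -h)
    have h2 : ∀ P P' : Polynomial k, P.map (algebraMap k k') -
        Polynomial.C α * P'.map (algebraMap k k') = 0 → P' = 0 := by
      intro P P' h
      ext i
      have h3 := congrArg (fun q : Polynomial k' => q.coeff i) h
      simp only [Polynomial.coeff_sub, Polynomial.coeff_map, Polynomial.coeff_C_mul,
        Polynomial.coeff_zero] at h3
      rw [Polynomial.coeff_zero]
      refine neg_eq_zero.1 (hind (P.coeff i) (-P'.coeff i) ?_).2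
      rw [map_neg]
      linear_combination h3
    rw [h2 _ _ h1.1, h2 _ _ h1.2] at hne
    simp at hne
  refine ⟨k', _, ‹_›, _, hfin, α, φ, hα, hφι, hrep, hne, ?_⟩
  have hαφ : (RatFunc.C α) ^ 2 = φ (ι a) := by
    rw [← map_pow, hα]
    exact (RingHom.congr_fun hφι a).symm
  have hc0 : ∀ c, φ (ι c) = RatFunc.C (algebraMap k k' c) := RingHom.congr_fun hφι
  let S : Subfield (RatFunc k') :=
    { carrier := {z | ∃ u v, z = φ u + RatFunc.C α * φ v}
      mul_mem' := by
        rintro _ _ ⟨u, v, rfl⟩ ⟨u', v', rfl⟩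
        refine ⟨u * u' + ι a * (v * v'), u * v' + v * u', ?_⟩
        simp only [map_mul, map_add, ← hαφ]
        ring
      one_mem' := ⟨1, 0, by simp⟩
      add_mem' := by
        rintro _ _ ⟨u, v, rfl⟩ ⟨u', v', rfl⟩
        refine ⟨u + u', v + v', ?_⟩
        simp only [map_add]
        ring
      zero_mem' := ⟨0, 0, by simp⟩
      neg_mem' := by
        rintro _ ⟨u, v, rfl⟩
        refine ⟨-u, -v, ?_⟩
        simp only [map_neg]
        ring
      inv_mem' := by
        rintro _ ⟨u, v, rfl⟩
        by_cases h0 : φ u + RatFunc.C α * φ v = 0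
        · exact ⟨0, 0, by simp [h0]⟩
        have hD : φ u - RatFunc.C α * φ v ≠ 0 := by
          intro h1
          by_cases hv : v = 0
          · subst hv
            simp at h0 h1
            exact h0 h1
          · refine hne (u / v) ?_
            rw [map_div₀, div_eq_iff ((map_ne_zero φ).2 hv)]
            linear_combination h1
        refine ⟨u / (u ^ 2 - ι a * v ^ 2), -v / (u ^ 2 - ι a * v ^ 2), ?_⟩
        have h2 : φ (u ^ 2 - ι a * v ^ 2) =
            (φ u + RatFunc.C α * φ v) * (φ u - RatFunc.C α * φ v) := by
          simp only [map_mul, map_sub, map_pow, ← hαφ]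
          ring
        rw [map_div₀, map_div₀, h2, map_neg]
        field_simp
        ring }
  have hSφ : ∀ z, φ z ∈ S := fun z => ⟨z, 0, by simp⟩
  have hSC : ∀ c, RatFunc.C c ∈ S := by
    intro c
    obtain ⟨u, v, rfl⟩ := hrep c
    refine ⟨ι u, ι v, ?_⟩
    rw [hc0, hc0, map_add, map_mul]
    ring
  refine subfield_eq_top S hSC ?_
  rw [ratFunc_X_eq hα0 hb']
  refine S.div_mem (S.sub_mem S.one_mem (S.mul_mem (hSC α) ?_)) ?_
  · rw [← hx]; exact hSφ x
  · rw [← hy]; exact hSφ y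

namespace QuadraticModel

variable {k k' L : Type*} [Field k] [Field k'] [Field L]
  [Algebra k k'] {a : k} {α : k'} {ι : k →+* L} {φ : L →+* RatFunc k'}

theorem map_apply (M : QuadraticModel a α ι φ) (c : k) :
    φ (ι c) = RatFunc.C (algebraMap k k' c) := RingHom.congr_fun M.comp c

theorem sq_apply (M : QuadraticModel a α ι φ) : (RatFunc.C α) ^ 2 = φ (ι a) := by
  rw [← map_pow, M.sq, M.map_apply]

theorem coord_eq (M : QuadraticModel a α ι φ) {u v u' v' : L}
    (h : φ u + RatFunc.C α * φ v = φ u' + RatFunc.C α * φ v') : u = u' ∧ v = v' := by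
  by_cases hv : v = v'
  · refine ⟨φ.injective ?_, hv⟩
    rw [hv] at h
    exact add_right_cancel h
  · exfalso
    refine M.ne ((u' - u) / (v - v')) ?_
    have h1 : φ v - φ v' ≠ 0 := by
      rw [← map_sub]
      exact (map_ne_zero φ).2 (sub_ne_zero.2 hv)
    rw [map_div₀, map_sub, map_sub, div_eq_iff h1]
    linear_combination -h

theorem exists_of_C (M : QuadraticModel a α ι φ) {n : L} {m : k'} (h : φ n = RatFunc.C m) :
    ∃ c, n = ι c := by
  obtain ⟨u, v, rfl⟩ := M.exists_coord m
  refine ⟨u, (M.coord_eq (v := 0) (v' := ι v) ?_).1⟩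
  rw [h, M.map_apply, M.map_apply, map_add, map_mul, map_zero]
  ring

theorem exists_of_sq_C (M : QuadraticModel a α ι φ) {n : L} {m : k}
    (h : n ^ 2 = ι m) : ∃ c, n = ι c := by
  have h1 : φ n ^ 2 = RatFunc.C (algebraMap k k' m) := by rw [← map_pow, h, M.map_apply]
  have h2 : ∃ c, φ n = RatFunc.C c := by
    by_contra h3
    have h4 := RatFunc.transcendental_of_ne_C _ h3
    refine h4 ⟨Polynomial.X ^ 2 - Polynomial.C (algebraMap k k' m),
      Polynomial.X_pow_sub_C_ne_zero two_pos _, ?_⟩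
    simp [h1]
  obtain ⟨c, hc⟩ := h2
  exact M.exists_of_C hc

theorem descent [CharZero L] (M : QuadraticModel a α ι φ) {g : L} (hg : g ≠ 0) {c : k'} {f : RatFunc k'}
    (h : φ g = RatFunc.C c * f ^ 2) : ∃ (d : k) (z : L), g = ι d * z ^ 2 := by
  obtain ⟨c0, c1, rfl⟩ := M.exists_coord c
  obtain ⟨u, v, rfl⟩ := M.exists_rep f
  have h0 : g = ι c0 * (u ^ 2 + ι a * v ^ 2) + 2 * ι a * ι c1 * u * v ∧
      0 = ι c1 * (u ^ 2 + ι a * v ^ 2) + 2 * ι c0 * u * v := by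
    refine M.coord_eq ?_
    rw [map_zero, h, map_add, map_mul, ← M.map_apply, ← M.map_apply]
    simp only [map_add, map_mul, map_pow, ← M.sq_apply, map_ofNat]
    ring
  obtain ⟨e1, e2⟩ := h0
  set D := u ^ 2 - ι a * v ^ 2 with hD
  have hD0 : D ≠ 0 := by
    intro h1
    have h2 : φ (u ^ 2 - ι a * v ^ 2) =
        (φ u + RatFunc.C α * φ v) * (φ u - RatFunc.C α * φ v) := by
      simp only [map_mul, map_sub, map_pow, ← M.sq_apply]
      ring
    rw [← hD, h1, map_zero] at h2
    rcases mul_eq_zero.1 h2.symm with h3 | h3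
    · have := M.coord_eq (u' := 0) (v' := 0) (by rw [h3]; simp)
      rw [this.1, this.2] at e1
      simp at e1
      exact hg e1
    · have := M.coord_eq (u := u) (v := -v) (u' := 0) (v' := 0) (by rw [map_neg]; simp; linear_combination h3)
      rw [this.1, neg_eq_zero.1 this.2] at e1
      simp at e1
      exact hg e1
  obtain ⟨n, hn⟩ := M.exists_of_sq_C (n := g / D) (m := c0 ^ 2 - a * c1 ^ 2) (by
    rw [div_pow, div_eq_iff (pow_ne_zero 2 hD0), e1, hD]
    simp only [map_sub, map_mul, map_pow]
    linear_combination (-ι a * (ι c1 * (u ^ 2 + ι a * v ^ 2) + 2 * ι c0 * u * v)) * e2)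
  rw [div_eq_iff hD0] at hn
  by_cases hu : u = 0
  · refine ⟨c0 * a, v, ?_⟩
    rw [e1, hu, map_mul]
    ring
  · refine ⟨(c0 + n) / 2, D / u, ?_⟩
    have h2 : (2 : L) ≠ 0 := two_ne_zero
    have hsol : (ι c0 + ι n) * D ^ 2 = 2 * g * u ^ 2 := by
      rw [hD] at hn ⊢
      linear_combination (-(u ^ 2 - ι a * v ^ 2)) * hn - (u ^ 2 + ι a * v ^ 2) * e1 + 2 * ι a * u * v * e2
    rw [map_div₀, map_add, map_ofNat]
    field_simp
    linear_combination -hsol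

theorem exists_polynomial (M : QuadraticModel a α ι φ) :
    ∃ P : Polynomial L, P ≠ 0 ∧ P.eval₂ φ RatFunc.X = 0 := by
  obtain ⟨u, v, h⟩ := M.exists_rep RatFunc.X
  refine ⟨(Polynomial.X - Polynomial.C u) ^ 2 - Polynomial.C (ι a * v ^ 2), ?_, ?_⟩
  · refine Polynomial.Monic.ne_zero ?_
    refine Polynomial.Monic.sub_of_left ((Polynomial.monic_X_sub_C u).pow 2) ?_
    refine lt_of_le_of_lt Polynomial.degree_C_le ?_
    rw [Polynomial.degree_pow, Polynomial.degree_X_sub_C]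
    norm_num
  · simp only [Polynomial.eval₂_sub, Polynomial.eval₂_pow, Polynomial.eval₂_X, Polynomial.eval₂_C]
    rw [map_mul, map_pow, ← M.sq_apply]
    linear_combination (RatFunc.X - φ u + RatFunc.C α * φ v) * h

end QuadraticModel

/-- On the function field of a conic, an element that is not a constant times a square is
detected by a dyadic valuation. -/
theorem exists_dyadicWitness_conic {k : Type w} [Field k] [NumberField k] {a b : k}
    (ha : ¬ IsSquare a) (hb : b ≠ 0) {L : Type*} [Field L] {ι : k →+* L}
    (hL : IsConicFunctionField k a b L ι) {g : L} (hg : g ≠ 0)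
    (hgk : ∀ (d : k) (z : L), g ≠ ι d * z ^ 2) :
    ∃ W : ValuationSubring L, DyadicWitness g W := by
  obtain ⟨k', _, _, _, _, α, φ, M⟩ := exists_quadraticModel ha hb hL
  have : CharZero L := charZero_of_injective_ringHom ι.injective
  obtain ⟨P, hP, hPX⟩ := M.exists_polynomial
  refine exists_dyadicWitness_of_ne φ hP hPX hg fun c f h => ?_
  obtain ⟨d, z, h1⟩ := M.descent hg h
  exact hgk d z h1

theorem finOver_conic {k : Type w} [Field k] [NumberField k] {a b : k}
    (ha : ¬ IsSquare a) (hb : b ≠ 0) {L : Type*} [Field L] {ι : k →+* L}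
    (hL : IsConicFunctionField k a b L ι) (s : L) : FinOver ι s := by
  obtain ⟨k', _, _, _, _, α, φ, M⟩ := exists_quadraticModel ha hb hL
  refine FinOver.of_hom φ ?_
  rw [M.comp]
  exact finOver_ratFunc (φ s)

theorem exists_ratFunc_equiv {k : Type w} [Field k] [CharZero k] {K : Type*} [Field K] {ι : k →+* K}
    (hK : IsConicFunctionField k 1 1 K ι) :
    ∃ φ : K ≃+* RatFunc k, ∀ c, φ (ι c) = RatFunc.C c := by
  obtain ⟨φ, hφι, ⟨x, hx⟩, ⟨y, hy⟩, -⟩ := exists_conic_hom (k' := k) (α := 1) hK (by simp)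
    one_ne_zero one_ne_zero
  have hC : ∀ c, φ (ι c) = RatFunc.C c := fun c => RingHom.congr_fun hφι c
  rw [map_one] at hx hy
  have hsurj : Function.Surjective φ := by
    intro z
    refine subfield_eq_top φ.fieldRange (fun c => ⟨ι c, hC c⟩) ?_ z
    rw [ratFunc_X_eq (α := (1 : k)) (b := 1) one_ne_zero one_ne_zero, ← hx, ← hy, map_one, one_mul]
    exact ⟨(1 - x) / y, by rw [map_div₀, map_sub, map_one]⟩
  exact ⟨RingEquiv.ofBijective φ ⟨φ.injective, hsurj⟩, hC⟩

end ConicDescent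

section DyadicTransfer

open IsDedekindDomain NumberField

universe w

theorem exists_constant_of_evenDyadic {k : Type w} [Field k] [NumberField k] {K L : Type*}
    [Field K] [Field L] [Algebra k K] [Algebra k L] (hK : ∀ s : K, FinOver (algebraMap k K) s)
    (hL : ∀ g : L, g ≠ 0 → (∀ (d : k) (z : L), g ≠ algebraMap k L d * z ^ 2) →
      ∃ W : ValuationSubring L, DyadicWitness g W)
    (R : WittRel K L) {y : k} (hy : EvenDyadic y) {g : L} (h : R.rel (algebraMap k K y) g) :
    ∃ (d : k) (z : L), g = algebraMap k L d * z ^ 2 := by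
  by_contra hcon
  push Not at hcon
  obtain ⟨W, hW⟩ := hL g (R.ne_zero' h) hcon
  obtain ⟨z, hz, hzT⟩ := hW.exists_unit
  obtain ⟨hz1, hind⟩ := indepPair_of_val_two_lt hW.two hz hzT
  obtain ⟨O, hO, hT, hH, a', b', ha', hb', hab⟩ := R.symm.exists_valuationSubring hW.arch
    (eq_of_le_of_val_two_lt hW.two hz hzT) hW.exists_notMem hz hz1 hind
  by_cases h2 : O.valuation 2 < 1
  · obtain ⟨v, -, hlt, -⟩ := exists_prime_of_valuationSubring (k := k) O fun hk => by
      have h3 := (O.valuation_le_one_iff _).2 (hk 2⁻¹)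
      rw [map_inv₀, map_ofNat, map_inv₀] at h3
      have h4 : O.valuation (2 : K) ≠ 0 := (map_ne_zero _).2 (by
        have : CharZero K := charZero_of_injective_algebraMap (algebraMap k K).injective
        exact two_ne_zero)
      exact absurd h3 (not_le.2 ((one_lt_inv₀ (zero_lt_iff.2 h4)).2 h2))
    have hv2 : v.valuation k 2 < 1 := by
      rw [← hlt, map_ofNat]
      exact h2
    obtain ⟨z, hz0, hz⟩ := exists_sq_of_even v hv2 hy.1 (hy.2 v hv2)
    have h5 : algebraMap k K y ∈ oneUnits O := by
      refine mem_oneUnits.2 ⟨algebraMap k K z, (map_ne_zero _).2 hz0, ?_⟩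
      rw [← map_pow, ← map_mul, ← map_one (algebraMap k K), ← map_sub]
      exact (hlt _).2 hz
    exact hW.notMem ((hT g _ h).2 h5)
  · have h3 : O.valuation (2 : K) = 1 :=
      le_antisymm ((O.valuation_le_one_iff _).2 (ofNat_mem O 2)) (not_lt.1 h2)
    have hS := R.symm.special hT hH (special_of_val_two_lt hW.two)
    have hneg : (-1 : K) ∈ oneUnits O := (hT _ _ R.symm.neg_one).1 (neg_one_mem_oneUnits hW.two)
    exact not_special hK hO h3 hneg ha' (fun h' => hab.left (SqGroup.mem_pm.2 (Or.inl h'))) hS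

end DyadicTransfer

noncomputable section RationalPlace

open IsDedekindDomain NumberField

universe w

variable {k : Type w} [Field k]

/-- The valuation ring of the point `t = 0` in `k(t)`. -/
abbrev originRing (k : Type*) [Field k] : ValuationSubring (RatFunc k) :=
  ((Polynomial.idealX k).valuation (RatFunc k)).valuationSubring

theorem originRing_lt {x : RatFunc k} :
    (originRing k).valuation x < 1 ↔ (Polynomial.idealX k).valuation (RatFunc k) x < 1 :=
  (Valuation.isEquiv_valuation_valuationSubring _).lt_one_iff_lt_one.symm

theorem originRing_eq {x : RatFunc k} :
    (originRing k).valuation x = 1 ↔ (Polynomial.idealX k).valuation (RatFunc k) x = 1 :=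
  (Valuation.isEquiv_valuation_valuationSubring _).eq_one_iff_eq_one.symm

theorem origin_polynomial_lt {p : Polynomial k} :
    (originRing k).valuation (algebraMap (Polynomial k) (RatFunc k) p) < 1 ↔ p.coeff 0 = 0 := by
  rw [originRing_lt, HeightOneSpectrum.valuation_lt_one_iff_mem, Polynomial.idealX_span,
    Ideal.mem_span_singleton, Polynomial.X_dvd_iff]

theorem origin_polynomial_mem (p : Polynomial k) :
    algebraMap (Polynomial k) (RatFunc k) p ∈ originRing k :=
  (Valuation.mem_valuationSubring_iff _ _).2 (HeightOneSpectrum.valuation_le_one _ p)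

theorem origin_polynomial_eq {p : Polynomial k} (hp : p.coeff 0 ≠ 0) :
    (originRing k).valuation (algebraMap (Polynomial k) (RatFunc k) p) = 1 := by
  refine le_antisymm (((originRing k).valuation_le_one_iff _).2 (origin_polynomial_mem p)) ?_
  exact not_lt.1 fun h => hp (origin_polynomial_lt.1 h)

theorem origin_C_eq {c : k} (hc : c ≠ 0) : (originRing k).valuation (RatFunc.C c) = 1 := by
  rw [← RatFunc.algebraMap_C]
  exact origin_polynomial_eq (by rwa [Polynomial.coeff_C_zero])

theorem origin_C_lt {c : k} (hc : (originRing k).valuation (RatFunc.C c) < 1) : c = 0 := by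
  by_contra h
  exact hc.ne (origin_C_eq h)

theorem origin_exists_close {x : RatFunc k} (hx : (originRing k).valuation x ≤ 1) :
    ∃ c, (originRing k).valuation (x - RatFunc.C c) < 1 := by
  have hD : x.denom.coeff 0 ≠ 0 := by
    intro h0
    have hN : x.num.coeff 0 ≠ 0 := by
      intro h1
      obtain ⟨u, v, huv⟩ := x.isCoprime_num_denom
      have h2 := congrArg (fun p : Polynomial k => p.coeff 0) huv
      simp [Polynomial.mul_coeff_zero, h0, h1] at h2
    have h1 := origin_polynomial_lt.2 h0
    have h2 := origin_polynomial_eq hN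
    have h3 : x * algebraMap (Polynomial k) (RatFunc k) x.denom = algebraMap _ _ x.num := by
      have h4 := x.num_div_denom
      rw [div_eq_iff (by simpa using x.denom_ne_zero)] at h4
      exact h4.symm
    rw [← h3, map_mul] at h2
    rw [mul_comm] at h2
    exact (mul_lt_one_of_lt_of_le h1 hx).ne h2
  refine ⟨x.num.coeff 0 / x.denom.coeff 0, ?_⟩
  have h1 : (x - RatFunc.C (x.num.coeff 0 / x.denom.coeff 0)) *
      algebraMap (Polynomial k) (RatFunc k) x.denom = algebraMap (Polynomial k) (RatFunc k)
        (x.num - Polynomial.C (x.num.coeff 0 / x.denom.coeff 0) * x.denom) := by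
    have h4 := x.num_div_denom
    rw [div_eq_iff (by simpa using x.denom_ne_zero)] at h4
    rw [map_sub, map_mul, h4, RatFunc.algebraMap_C]
    ring
  have h2 := congrArg (originRing k).valuation h1
  rw [map_mul, origin_polynomial_eq hD, mul_one] at h2
  rw [h2, origin_polynomial_lt, Polynomial.coeff_sub, Polynomial.coeff_C_mul]
  field_simp
  ring

theorem isSquare_of_C_mem_oneUnits {c : k} (h : RatFunc.C c ∈ oneUnits (originRing k)) :
    IsSquare c := by
  obtain ⟨y, hy0, hy⟩ := mem_oneUnits.1 h
  by_cases hc : c = 0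
  · exact hc ▸ IsSquare.zero
  have h1 := val_eq_one_of_sub hy
  rw [map_mul, origin_C_eq hc, one_mul, map_pow] at h1
  have h2 : (originRing k).valuation y = 1 := (pow_eq_one_iff_left two_ne_zero).1 h1
  obtain ⟨d, hd⟩ := origin_exists_close h2.le
  have h3 : (originRing k).valuation (RatFunc.C (c * d ^ 2 - 1)) < 1 := by
    have h4 : RatFunc.C (c * d ^ 2 - 1) = (RatFunc.C c * y ^ 2 - 1) -
        RatFunc.C c * (y + RatFunc.C d) * (y - RatFunc.C d) := by
      simp only [map_sub, map_mul, map_pow, map_one]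
      ring
    rw [h4]
    refine lt_of_le_of_lt (Valuation.map_sub _ _ _) (max_lt hy ?_)
    rw [map_mul, mul_comm]
    refine mul_lt_one_of_lt_of_le hd (((originRing k).valuation_le_one_iff _).2 ?_)
    have hm : ∀ c : k, RatFunc.C c ∈ originRing k := fun c => by
      rw [← RatFunc.algebraMap_C]; exact origin_polynomial_mem _
    exact mul_mem (hm c) (add_mem (((originRing k).valuation_le_one_iff _).1 h2.le) (hm d))
  have h4 := origin_C_lt h3
  have hd0 : d ≠ 0 := by rintro rfl; simp at h4
  exact ⟨d⁻¹, by field_simp; linear_combination h4⟩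

theorem exists_C_mul_of_mem_unitsSq {x : RatFunc k} (hx : x ∈ unitsSq (originRing k)) :
    ∃ c : k, c ≠ 0 ∧ ∃ t ∈ oneUnits (originRing k), x = RatFunc.C c * t := by
  obtain ⟨y, hy0, hy⟩ := mem_unitsSq.1 hx
  obtain ⟨c, hc⟩ := origin_exists_close hy.le
  have hc0 : c ≠ 0 := by
    rintro rfl
    rw [map_zero, sub_zero] at hc
    exact hc.ne hy
  have hC0 : (RatFunc.C c : RatFunc k) ≠ 0 := (map_ne_zero _).2 hc0
  refine ⟨c, hc0, x / RatFunc.C c, mem_oneUnits.2 ⟨y, hy0, ?_⟩, by field_simp⟩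
  have h1 : x / RatFunc.C c * y ^ 2 - 1 = (x * y ^ 2 - RatFunc.C c) / RatFunc.C c := by
    field_simp
  rw [h1, map_div₀, origin_C_eq hc0, div_one]
  exact hc

theorem X_notMem_unitsSq : RatFunc.X ∉ unitsSq (originRing k) := by
  intro h
  obtain ⟨y, hy0, hy⟩ := mem_unitsSq.1 h
  rw [originRing_eq, map_mul, map_pow, Polynomial.valuation_X_eq_neg_one] at hy
  have h0 : (Polynomial.idealX k).valuation (RatFunc k) y ≠ 0 := (map_ne_zero _).2 hy0
  have h1 := congrArg WithZero.log hy
  rw [WithZero.log_mul WithZero.exp_ne_zero (pow_ne_zero 2 h0), WithZero.log_pow,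
    WithZero.log_exp, WithZero.log_one] at h1
  simp at h1
  omega

theorem arch_originRing : Arch (originRing k) := by
  intro x hx y
  rw [originRing_lt] at hx
  by_cases hy : y = 0
  · exact ⟨0, by simp [hy]⟩
  have hy' : (Polynomial.idealX k).valuation (RatFunc k) y ≠ 0 := (map_ne_zero _).2 hy
  obtain ⟨n, hn⟩ := exists_pow_lt₀ hx (Units.mk0 _ (inv_ne_zero hy'))
  refine ⟨n, ?_⟩
  rw [originRing_lt, map_mul, map_pow]
  calc _ < ((Polynomial.idealX k).valuation (RatFunc k) y)⁻¹ *
        (Polynomial.idealX k).valuation (RatFunc k) y :=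
        mul_lt_mul_of_pos_right hn (zero_lt_iff.2 hy')
    _ = 1 := inv_mul_cancel₀ hy'

variable [NumberField k]

theorem eq_originRing_of_le (O : ValuationSubring (RatFunc k)) (hle : O ≤ originRing k)
    (h : ∀ x, O.valuation x < 1 → 1 + x ∈ oneUnits (originRing k)) : O = originRing k := by
  refine le_antisymm hle fun x hx => ?_
  by_cases hk : ∀ c : k, algebraMap k (RatFunc k) c ∈ O
  · obtain ⟨c, hc⟩ := origin_exists_close (((originRing k).valuation_le_one_iff _).2 hx)
    have h1 : x - RatFunc.C c ∈ O := by
      by_cases h0 : x - RatFunc.C c = 0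
      · rw [h0]; exact zero_mem O
      · exact (O.mem_or_inv_mem _).resolve_right fun h1 =>
          inv_notMem_of_val_lt_one h0 hc (hle h1)
    have h2 := add_mem h1 (hk c)
    rwa [RatFunc.algebraMap_eq_C, sub_add_cancel] at h2
  · exfalso
    obtain ⟨q, -, hlt, -⟩ := exists_prime_of_valuationSubring O hk
    obtain ⟨r, hr⟩ : ∃ r, q ≠ r := by
      obtain ⟨q', r', h⟩ := exists_ne_prime (k := k)
      by_cases h' : q = q'
      · exact ⟨r', h' ▸ h⟩
      · exact ⟨q', h'⟩
    obtain ⟨c, hc, hc'⟩ := exists_crt_one hr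
    have h1 : O.valuation (algebraMap k (RatFunc k) c - 1) < 1 := by
      rw [← map_one (algebraMap k (RatFunc k)), ← map_sub]
      exact (hlt _).2 hc
    have h2 := h _ h1
    rw [add_sub_cancel, RatFunc.algebraMap_eq_C] at h2
    have h3 := isSquare_of_C_mem_oneUnits h2
    refine not_isSquare_of_odd (v := r) (x := c) ?_ h3
    rw [ordAt_eq_of_val hc']
    exact odd_neg_one

theorem origin_indepPair : ∃ a b, (originRing k).valuation a = 1 ∧ (originRing k).valuation b = 1 ∧
    IndepPair (oneUnits (originRing k)) a b := by
  obtain ⟨q, r, hqr⟩ := exists_ne_prime (k := k)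
  obtain ⟨a, b, hab, h⟩ := exists_independent_sum_one hqr
  have hne : ∀ x, x = a ∨ x = b ∨ x = a * b → x ≠ 0 := fun x hx h0 =>
    (h x hx).1 (h0 ▸ IsSquare.zero)
  have hpm : ∀ x, x = a ∨ x = b ∨ x = a * b → RatFunc.C x ∉ (oneUnits (originRing k)).pm := by
    intro x hx hm
    rcases SqGroup.mem_pm.1 hm with h1 | h1
    · exact (h x hx).1 (isSquare_of_C_mem_oneUnits h1)
    · rw [← map_neg] at h1
      exact (h x hx).2 (isSquare_of_C_mem_oneUnits h1)
  refine ⟨RatFunc.C a, RatFunc.C b, origin_C_eq (hne a (by simp)), origin_C_eq (hne b (by simp)),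
    ⟨by rw [← map_add, hab, map_one], hpm a (by simp), hpm b (by simp), ?_⟩⟩
  rw [← map_mul]
  exact hpm _ (by simp)

end RationalPlace

section NormForms

/-- The norm of a value of the form `z² - a x²` is again a value of this form. -/
theorem exists_norm_eq_sq_sub {k F : Type*} [Field k] [Field F] [Algebra k F]
    [FiniteDimensional k F] (a : k) (X Z : F) :
    ∃ U V : k, Algebra.norm k (Z ^ 2 - algebraMap k F a * X ^ 2) = U ^ 2 - a * V ^ 2 := by
  classical
  let B := Module.finBasis k F
  let m : F →+* Matrix (Fin (Module.finrank k F)) (Fin (Module.finrank k F)) k :=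
    (Algebra.leftMulMatrix B).toRingHom
  let c : k →+* (QuadraticAlgebra k a 0) := algebraMap k (QuadraticAlgebra k a 0)
  let ω : (QuadraticAlgebra k a 0) := QuadraticAlgebra.omega
  have hω : ω * ω = c a := by
    ext <;> simp [ω, c]
  have hsω : starRingEnd (QuadraticAlgebra k a 0) ω = -ω := by
    ext <;> simp [ω, starRingEnd_apply]
  have hsc : ∀ x, starRingEnd (QuadraticAlgebra k a 0) (c x) = c x := by
    intro x
    ext <;> simp [c, starRingEnd_apply]
  let M : Matrix (Fin (Module.finrank k F)) (Fin (Module.finrank k F)) (QuadraticAlgebra k a 0) :=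
    c.mapMatrix (m Z) + ω • c.mapMatrix (m X)
  have hM : (starRingEnd (QuadraticAlgebra k a 0)).mapMatrix M = c.mapMatrix (m Z) - ω • c.mapMatrix (m X) := by
    refine Matrix.ext fun i j => ?_
    simp [M, hsω, hsc, sub_eq_add_neg]
  have hprod : M * (starRingEnd (QuadraticAlgebra k a 0)).mapMatrix M =
      c.mapMatrix (m (Z ^ 2 - algebraMap k F a * X ^ 2)) := by
    have hcomm : c.mapMatrix (m X) * c.mapMatrix (m Z) = c.mapMatrix (m Z) * c.mapMatrix (m X) := by
      rw [← map_mul, ← map_mul, ← map_mul, ← map_mul, mul_comm]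
    have ha : c.mapMatrix (m (algebraMap k F a)) = c a • 1 := by
      have : m (algebraMap k F a) = algebraMap k _ a := (Algebra.leftMulMatrix B).commutes a
      rw [this]
      ext i j <;> by_cases h : i = j <;> simp [Matrix.algebraMap_matrix_apply, h]
    rw [hM, map_sub, map_sub, map_mul, map_mul, map_pow, map_pow, map_pow, map_pow, ha]
    simp only [M, add_mul, mul_sub, Matrix.smul_mul, Matrix.mul_smul, hcomm, one_mul, smul_smul,
      hω, pow_two]
    abel
  have hdet := congrArg Matrix.det hprod
  rw [Matrix.det_mul, ← RingHom.map_det, ← RingHom.map_det, starRingEnd_apply,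
    ← QuadraticAlgebra.algebraMap_norm_eq_mul_star] at hdet
  have h1 := (algebraMap k (QuadraticAlgebra k a 0)).injective hdet
  refine ⟨M.det.re, M.det.im, ?_⟩
  rw [Algebra.norm_eq_matrix_det B]
  change (m _).det = _
  rw [← h1, QuadraticAlgebra.norm_def]
  ring

/-- Anisotropic ternary forms stay anisotropic over extensions of odd degree. -/
theorem anisotropic_of_odd_finrank {k F : Type*} [Field k] [Field F] [Algebra k F]
    [FiniteDimensional k F] (hodd : Odd (Module.finrank k F)) {a b : k} (ha : ¬ IsSquare a)
    (h : ∀ x y z : k, a * x ^ 2 + b * y ^ 2 = z ^ 2 → x = 0 ∧ y = 0 ∧ z = 0)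
    {x y z : F} (hxyz : algebraMap k F a * x ^ 2 + algebraMap k F b * y ^ 2 = z ^ 2) :
    x = 0 ∧ y = 0 ∧ z = 0 := by
  obtain ⟨n, hn⟩ := hodd
  have ha0 : a ≠ 0 := fun h0 => ha (h0 ▸ IsSquare.zero)
  have hb0 : b ≠ 0 := fun h0 => one_ne_zero (h 0 1 0 (by simp [h0])).2.1
  by_cases hy : y = 0
  · subst hy
    by_cases hx : x = 0
    · subst hx
      exact ⟨rfl, rfl, by simpa using hxyz.symm⟩
    · refine absurd ?_ ha
      have h1 := congrArg (Algebra.norm k) hxyz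
      have hN : Algebra.norm k x ≠ 0 := by rwa [Ne, Algebra.norm_eq_zero_iff]
      rw [show algebraMap k F a * x ^ 2 + algebraMap k F b * 0 ^ 2 = algebraMap k F a * x ^ 2 by ring,
        map_mul, map_pow, map_pow, Algebra.norm_algebraMap, hn] at h1
      refine ⟨Algebra.norm k z / (a ^ n * Algebra.norm k x), ?_⟩
      field_simp
      rw [← h1]
      ring
  · exfalso
    obtain ⟨U, V, hUV⟩ := exists_norm_eq_sq_sub a x z
    have hN : Algebra.norm k y ≠ 0 := by rwa [Ne, Algebra.norm_eq_zero_iff]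
    rw [← hxyz, add_sub_cancel_left, map_mul, map_pow, Algebra.norm_algebraMap, hn] at hUV
    have := (h V (b ^ n * Algebra.norm k y) U (by linear_combination hUV)).2.1
    exact mul_ne_zero (pow_ne_zero _ hb0) hN this

theorem isSquare_norm_of_even_finrank {k F : Type*} [Field k] [Field F] [Algebra k F]
    (heven : Even (Module.finrank k F)) (c : k) (f : F) :
    IsSquare (Algebra.norm k (algebraMap k F c * f ^ 2)) := by
  rw [map_mul, map_pow, Algebra.norm_algebraMap]
  exact (heven.isSquare_pow c).mul (IsSquare.sq _)

theorem exists_norm_eq_eval (k F : Type*) [Field k] [Field F] [Algebra k F]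
    [FiniteDimensional k F] [Algebra.IsSeparable k F] :
    ∃ (θ : F) (f : Polynomial k), 0 < f.natDegree ∧ f.Separable ∧
      ∀ c : k, Algebra.norm k (algebraMap k F c - θ) = f.eval c := by
  let pb := Field.powerBasisOfFiniteOfSeparable k F
  refine ⟨pb.gen, minpoly k pb.gen, minpoly.natDegree_pos (Algebra.IsIntegral.isIntegral _),
    Algebra.IsSeparable.isSeparable _ _, fun c => ?_⟩
  rw [← charpoly_leftMulMatrix pb, Matrix.eval_charpoly, Algebra.norm_eq_matrix_det pb.basis,
    map_sub, AlgHom.commutes]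
  rfl

end NormForms

section OriginTransfer

open IsDedekindDomain NumberField IsLocalRing

universe w

variable {k : Type w} [Field k]

theorem exists_residue_isotropic {L : Type*} [Field L] [Algebra k L] {O : ValuationSubring L}
    (hk : ∀ x, algebraMap k L x ∈ O) {a b : k} {x y : L}
    (hxy : algebraMap k L a * x ^ 2 + algebraMap k L b * y ^ 2 = 1) :
    ∃ X Y Z : ResidueField O, (X ≠ 0 ∨ Y ≠ 0 ∨ Z ≠ 0) ∧
      residueHom (algebraMap k L) hk a * X ^ 2 + residueHom (algebraMap k L) hk b * Y ^ 2 =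
        Z ^ 2 := by
  have key : ∀ p q r : L, O.valuation p ≤ 1 → O.valuation q ≤ 1 → O.valuation r ≤ 1 →
      algebraMap k L a * p ^ 2 + algebraMap k L b * q ^ 2 = r ^ 2 →
      (O.valuation p = 1 ∨ O.valuation q = 1 ∨ O.valuation r = 1) →
      ∃ X Y Z : ResidueField O, (X ≠ 0 ∨ Y ≠ 0 ∨ Z ≠ 0) ∧
        residueHom (algebraMap k L) hk a * X ^ 2 + residueHom (algebraMap k L) hk b * Y ^ 2 =
          Z ^ 2 := by
    intro p q r hp hq hr heq hone
    let p' : O := ⟨p, (ValuationSubring.valuation_le_one_iff _ _).1 hp⟩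
    let q' : O := ⟨q, (ValuationSubring.valuation_le_one_iff _ _).1 hq⟩
    let r' : O := ⟨r, (ValuationSubring.valuation_le_one_iff _ _).1 hr⟩
    refine ⟨residue O p', residue O q', residue O r', ?_, ?_⟩
    · rcases hone with h | h | h
      · exact Or.inl ((residue_ne_zero_iff p').2 h)
      · exact Or.inr (Or.inl ((residue_ne_zero_iff q').2 h))
      · exact Or.inr (Or.inr ((residue_ne_zero_iff r').2 h))
    · have : (⟨_, hk a⟩ : O) * p' ^ 2 + (⟨_, hk b⟩ : O) * q' ^ 2 = r' ^ 2 := Subtype.ext heq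
      have := congrArg (residue O) this
      rwa [map_add, map_mul, map_mul, map_pow, map_pow, map_pow] at this
  have hdiv : ∀ p q : L, O.valuation p ≤ O.valuation q → q ≠ 0 → O.valuation (p / q) ≤ 1 := by
    intro p q hpq hq
    rw [map_div₀]
    exact div_le_one_of_le₀ hpq zero_le
  by_cases h : O.valuation x ≤ 1 ∧ O.valuation y ≤ 1
  · exact key x y 1 h.1 h.2 (by simp) (by rw [hxy, one_pow]) (by simp)
  · rcases le_total (O.valuation y) (O.valuation x) with hle | hle
    · have hx1 : 1 < O.valuation x := by
        by_contra! hx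
        exact h ⟨hx, hle.trans hx⟩
      have hx0 : x ≠ 0 := by
        rintro rfl
        simp at hx1
      refine key 1 (y / x) (1 / x) (by simp) (hdiv _ _ hle hx0)
        (hdiv _ _ (by simpa using hx1.le) hx0) ?_ (by simp)
      field_simp
      linear_combination hxy
    · have hy1 : 1 < O.valuation y := by
        by_contra! hy
        exact h ⟨hle.trans hy, hy⟩
      have hy0 : y ≠ 0 := by
        rintro rfl
        simp at hy1
      refine key (x / y) 1 (1 / y) (hdiv _ _ hle hy0) (by simp)
        (hdiv _ _ (by simpa using hy1.le) hy0) ?_ (by simp)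
      field_simp
      linear_combination hxy

variable [NumberField k] {L : Type*} [Field L] [Algebra k L]

theorem constants_mem_of_oneUnits_originRing
    (hL : ∀ g : L, g ≠ 0 → (∀ (d : k) (z : L), g ≠ algebraMap k L d * z ^ 2) →
      ∃ W, DyadicWitness g W)
    (R : WittRel (RatFunc k) L) {O : ValuationSubring L}
    (hT : ∀ x y, R.rel x y → (x ∈ oneUnits (originRing k) ↔ y ∈ oneUnits O)) (x : k) :
    algebraMap k L x ∈ O := by
  by_contra hx
  obtain ⟨v, -, hlt, -⟩ := exists_prime_of_valuationSubring (k := k) O (fun h => hx (h x))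
  obtain ⟨c, hc0, hc⟩ := exists_seq_not_isSquare (k := k)
  obtain ⟨S, _, key, hkey⟩ := exists_key_evenDyadic (k := k)
  obtain ⟨S', _, key', hkey'⟩ := exists_key (k := k) v
  obtain ⟨s, hs⟩ := Finite.exists_infinite_fiber (fun n : ℕ => key (c n))
  obtain ⟨⟨n₀, hn₀⟩⟩ : Nonempty ((fun n : ℕ => key (c n)) ⁻¹' {s}) := inferInstance
  have hg : ∀ j : (fun n : ℕ => key (c n)) ⁻¹' {s}, ∃ (d : k) (g z : L),
      R.rel (algebraMap k (RatFunc k) (c j / c n₀)) g ∧ g = algebraMap k L d * z ^ 2 := by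
    rintro ⟨j, hj⟩
    have hy : EvenDyadic (c j / c n₀) := hkey _ _ (hc0 j) (hc0 n₀) (hj.trans hn₀.symm)
    obtain ⟨g, hg⟩ := R.total (algebraMap k (RatFunc k) (c j / c n₀)) (by simpa using hy.1)
    obtain ⟨d, z, hd⟩ := exists_constant_of_evenDyadic (fun s => finOver_ratFunc (k := k) s)
      hL R hy hg
    exact ⟨d, g, z, hg, hd⟩
  choose d g z hg hd using hg
  have hd0 : ∀ j, d j ≠ 0 := fun j h0 => R.ne_zero' (hg j) (by rw [hd, h0, map_zero, zero_mul])
  have hz0 : ∀ j, z j ≠ 0 := fun j h0 => R.ne_zero' (hg j) (by rw [hd, h0]; ring)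
  obtain ⟨i, j, hij, hdij⟩ := Finite.exists_ne_map_eq_of_infinite (fun j => key' (d j))
  obtain ⟨t, ht0, ht⟩ := hkey' _ _ (hd0 i) (hd0 j) hdij
  have hmem : algebraMap k L (d i * d j) ∈ oneUnits O := by
    refine mem_oneUnits.2 ⟨algebraMap k L (t / d j), by simpa using ⟨ht0, hd0 j⟩, ?_⟩
    rw [← map_pow, ← map_mul, ← map_one (algebraMap k L), ← map_sub]
    refine (hlt _).2 ?_
    convert ht using 3
    have := hd0 j
    field_simp
  have hmem' : g i * g j ∈ oneUnits O := by
    refine ((oneUnits O).congr_sq (z := z i * z j) (mul_ne_zero (hz0 i) (hz0 j)) ?_).2 hmem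
    rw [hd, hd, map_mul]
    ring
  have h1 := (hT _ _ (R.mul (hg i) (hg j))).2 hmem'
  rw [← map_mul, RatFunc.algebraMap_eq_C] at h1
  have h2 := (isSquare_of_C_mem_oneUnits h1).mul (IsSquare.sq (c n₀))
  have h3 : IsSquare (c i * c j) := by
    have := hc0 n₀
    have h4 : c i * c j = c i / c n₀ * (c j / c n₀) * c n₀ ^ 2 := by field_simp
    rwa [h4]
  rcases lt_or_gt_of_ne (fun h => hij (Subtype.ext h) : (i : ℕ) ≠ j) with h | h
  · exact hc _ _ h h3
  · exact hc _ _ h (mul_comm (c i) (c j) ▸ h3)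

theorem odd_finrank_residueField
    (hL : ∀ g : L, g ≠ 0 → (∀ (d : k) (z : L), g ≠ algebraMap k L d * z ^ 2) →
      ∃ W, DyadicWitness g W)
    (R : WittRel (RatFunc k) L) {O : ValuationSubring L}
    (hT : ∀ x y, R.rel x y → (x ∈ oneUnits (originRing k) ↔ y ∈ oneUnits O))
    (hH : ∀ x y, R.rel x y → y ∈ unitsSq O → x ∈ unitsSq (originRing k))
    (hk : ∀ x : k, algebraMap k L x ∈ O) [Algebra k (ResidueField O)]
    (hcomp : ∀ x, algebraMap k (ResidueField O) x = residueHom (algebraMap k L) hk x)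
    [FiniteDimensional k (ResidueField O)] :
    Odd (Module.finrank k (ResidueField O)) := by
  rw [← Nat.not_even_iff_odd]
  intro heven
  obtain ⟨θ, f, hf, hsep, hθ⟩ := exists_norm_eq_eval k (ResidueField O)
  obtain ⟨c, hc0, hc⟩ := exists_seq_values hf hsep
  obtain ⟨S, _, key, hkey⟩ := exists_key_evenDyadic (k := k)
  have hx : ∀ i : ℕ, ∃ (u : O) (x : RatFunc k) (e : k) (t : RatFunc k), e ≠ 0 ∧
      residue O u = algebraMap k (ResidueField O) (c i) - θ ∧ O.valuation (u : L) = 1 ∧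
      R.rel x u ∧ t ∈ oneUnits (originRing k) ∧ x = RatFunc.C e * t := by
    intro i
    obtain ⟨u, hu⟩ := residue_surjective (algebraMap k (ResidueField O) (c i) - θ)
    have hu1 : O.valuation (u : L) = 1 := by
      rw [← residue_ne_zero_iff, hu]
      intro h0
      apply hc0 i
      rw [← hθ, h0, Algebra.norm_zero]
    have hu0 : (u : L) ≠ 0 := by
      intro h0
      simp [h0] at hu1
    obtain ⟨x, hx⟩ := R.total' (u : L) hu0
    obtain ⟨e, he, t, ht, rfl⟩ := exists_C_mul_of_mem_unitsSq (hH _ _ hx (unit_mem_unitsSq hu1))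
    exact ⟨u, _, e, t, he, hu, hu1, hx, ht, rfl⟩
  choose u x e t he hu hu1 hx ht hxt using hx
  obtain ⟨i, j, hij, hkij⟩ := Finite.exists_ne_map_eq_of_infinite (fun j => key (e j))
  have hy := hkey _ _ (he i) (he j) hkij
  obtain ⟨g, hg⟩ := R.total (algebraMap k (RatFunc k) (e i / e j)) (by simpa using hy.1)
  obtain ⟨d, z, hd⟩ := exists_constant_of_evenDyadic (fun s => finOver_ratFunc (k := k) s)
    hL R hy hg
  have hg0 := R.ne_zero' hg
  have hd0 : d ≠ 0 := fun h0 => hg0 (by rw [hd, h0, map_zero, zero_mul])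
  have hz0 : z ≠ 0 := fun h0 => hg0 (by rw [hd, h0]; ring)
  have htt := (oneUnits (originRing k)).mul (ht i) (ht j)
  obtain ⟨s, hs⟩ := R.total (t i * t j) ((oneUnits (originRing k)).ne_zero htt)
  have hs' := (hT _ _ hs).1 htt
  have h1 := R.mul hg hs
  have h2 := R.mul (hx i) (hx j)
  have h3 : R.rel (x i * x j) (g * s) := by
    have hej : (RatFunc.C (e j) : RatFunc k) ≠ 0 := (map_ne_zero _).2 (he j)
    have h4 : x i * x j =
        algebraMap k (RatFunc k) (e i / e j) * (t i * t j) * RatFunc.C (e j) ^ 2 := by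
      rw [hxt, hxt, RatFunc.algebraMap_eq_C, map_div₀]
      field_simp
    rw [h4]
    exact R.symm.mul_sq h1 hej
  obtain ⟨w, hw0, hw⟩ := R.inj' h3 h2
  have hdv : O.valuation (algebraMap k L d) = 1 := by
    have := residue_ne_zero_iff (⟨_, hk d⟩ : O)
    refine this.1 ?_
    change residueHom (algebraMap k L) hk d ≠ 0
    simpa using hd0
  have hmem : algebraMap k L d * (u i * u j : L) ∈ oneUnits O := by
    refine ((oneUnits O).congr_sq (z := algebraMap k L d * z * w) ?_ ?_).2 hs'
    · exact mul_ne_zero (mul_ne_zero (by simpa using hd0) hz0) hw0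
    · rw [hw, hd]
      ring
  have hval : O.valuation (((⟨_, hk d⟩ : O) * (u i * u j) : O) : L) = 1 := by
    change O.valuation (algebraMap k L d * (u i * u j : L)) = 1
    rw [map_mul, map_mul, hdv, hu1, hu1]
    simp
  obtain ⟨r, hr⟩ := (isSquare_residue_iff hval).2 hmem
  have hr' : algebraMap k (ResidueField O) d * ((algebraMap k (ResidueField O) (c i) - θ) *
      (algebraMap k (ResidueField O) (c j) - θ)) = r * r := by
    rw [← hr, map_mul, map_mul, hu, hu, hcomp d]
    rfl
  have hsq : IsSquare (f.eval (c i) * f.eval (c j)) := by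
    have h4 := isSquare_norm_of_even_finrank heven d⁻¹ r
    have h5 : algebraMap k (ResidueField O) d⁻¹ * r ^ 2 =
        (algebraMap k (ResidueField O) (c i) - θ) * (algebraMap k (ResidueField O) (c j) - θ) := by
      rw [pow_two, ← hr', ← mul_assoc, ← map_mul, inv_mul_cancel₀ hd0, map_one, one_mul]
    rwa [h5, map_mul, hθ, hθ] at h4
  rcases lt_or_gt_of_ne hij with h | h
  · exact hc _ _ h hsq
  · exact hc _ _ h (by rwa [mul_comm])

/-- A function field over `k` satisfying a dyadic condition in which an anisotropic form
`a x² + b y² - z²` becomes isotropic is not Witt equivalent to the rational function field. -/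
theorem isEmpty_wittRel_ratFunc {a b : k} (ha : ¬ IsSquare a)
    (hab : ∀ x y z : k, a * x ^ 2 + b * y ^ 2 = z ^ 2 → x = 0 ∧ y = 0 ∧ z = 0)
    (hfin : ∀ s : L, FinOver (algebraMap k L) s)
    (hL : ∀ g : L, g ≠ 0 → (∀ (d : k) (z : L), g ≠ algebraMap k L d * z ^ 2) →
      ∃ W, DyadicWitness g W)
    {x y : L} (hxy : algebraMap k L a * x ^ 2 + algebraMap k L b * y ^ 2 = 1)
    (R : WittRel (RatFunc k) L) : False := by
  obtain ⟨α, β, hα, hβ, hαβ⟩ := origin_indepPair (k := k)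
  obtain ⟨O, hO, hT, hH, -⟩ := R.exists_valuationSubring arch_originRing
    (fun O₃ hle h => eq_originRing_of_le O₃ hle h)
    ⟨RatFunc.X, RatFunc.X_ne_zero, X_notMem_unitsSq⟩ hα hβ hαβ
  have hk := constants_mem_of_oneUnits_originRing hL R hT
  obtain ⟨s, hs0, hs⟩ : ∃ s : L, s ≠ 0 ∧ O.valuation s < 1 := by
    by_contra! hcon
    refine hO (eq_top_iff.2 fun x _ => ?_)
    by_cases hx : x = 0
    · exact hx ▸ O.zero_mem
    · have := hcon x⁻¹ (inv_ne_zero hx)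
      rw [map_inv₀] at this
      refine (ValuationSubring.valuation_le_one_iff _ _).1 ?_
      exact (one_le_inv₀ (by simpa [zero_lt_iff] using hx)).1 this
  let := (residueHom (algebraMap k L) hk).toAlgebra
  have : FiniteDimensional k (ResidueField O) :=
    FinDim.finite (finDim_residueHom hk hs0 hs (hfin s))
  have hodd := odd_finrank_residueField hL R hT hH hk (fun _ => rfl)
  obtain ⟨X, Y, Z, hne, h⟩ := exists_residue_isotropic hk hxy
  obtain ⟨h1, h2, h3⟩ := anisotropic_of_odd_finrank hodd ha hab (x := X) (y := Y) (z := Z) h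
  rcases hne with hne | hne | hne
  exacts [hne h1, hne h2, hne h3]

end OriginTransfer

/-- Transport of a Witt equivalence along a field isomorphism. -/
def WittRel.congrLeft {K K' L : Type*} [Field K] [Field K'] [Field L] (R : WittRel K L)
    (φ : K' ≃+* K) : WittRel K' L where
  rel x y := R.rel (φ x) y
  ne_zero h h0 := R.ne_zero h (by rw [h0, map_zero])
  ne_zero' h := R.ne_zero' h
  total x hx := R.total (φ x) ((map_ne_zero φ).2 hx)
  total' y hy := by
    obtain ⟨x, hx⟩ := R.total' y hy
    exact ⟨φ.symm x, by rwa [φ.apply_symm_apply]⟩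
  sq x y hx hy := by
    rw [map_pow]
    exact R.sq _ _ ((map_ne_zero φ).2 hx) hy
  mul h h' := by
    rw [map_mul]
    exact R.mul h h'
  inj {x x' y} h h' := by
    obtain ⟨z, hz, e⟩ := R.inj h h'
    refine ⟨φ.symm z, (map_ne_zero φ.symm).2 hz, φ.injective ?_⟩
    rw [map_mul, map_pow, φ.apply_symm_apply, e]
  inj' h h' := R.inj' h h'
  neg_one := by
    rw [map_neg, map_one]
    exact R.neg_one
  rep {a b c _ _ _} ha hb hc := by
    rintro ⟨x, y, e⟩
    exact R.rep ha hb hc ⟨φ x, φ y, by rw [e, map_add, map_mul, map_mul, map_pow, map_pow]⟩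
  rep' {a b c _ _ _} ha hb hc h := by
    obtain ⟨x, y, e⟩ := R.rep' ha hb hc h
    refine ⟨φ.symm x, φ.symm y, φ.injective ?_⟩
    rw [e, map_add, map_mul, map_mul, map_pow, map_pow, φ.apply_symm_apply, φ.apply_symm_apply]

theorem IsConicFunctionField.exists_point {k : Type*} [Field k] {a b : k} {L : Type*} [Field L]
    {ι : k →+* L} (h : IsConicFunctionField k a b L ι) :
    ∃ x y : L, ι a * x ^ 2 + ι b * y ^ 2 = 1 := by
  obtain ⟨f, -, hι, -⟩ := h
  let q : MvPolynomial (Fin 2) k →+* L := f.comp (Ideal.Quotient.mk (Ideal.span {conicPoly k a b}))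
  have h0 : q (conicPoly k a b) = 0 := by
    have : Ideal.Quotient.mk (Ideal.span {conicPoly k a b}) (conicPoly k a b) = 0 :=
      Ideal.Quotient.eq_zero_iff_mem.2 (Ideal.subset_span rfl)
    rw [RingHom.comp_apply, this, map_zero]
  have hC : ∀ c, q (C c) = ι c := fun c => by
    rw [← hι]
    rfl
  refine ⟨q (X 0), q (X 1), sub_eq_zero.1 ?_⟩
  rw [← h0, conicPoly]
  simp only [map_sub, map_add, map_mul, map_pow, map_one, hC]

/-- Let `k` be a number field in which `−1` is a sum of two squares.  Then there are
nonzero `a, b ∈ k` such that `k_{a,b}` is not Witt equivalent to `k_{1,1}`; in particular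
there are at least two Witt-inequivalent fields of the form `k_{a,b}`. -/
theorem exists_conic_not_wittEquivalent_of_neg_one_sum_two_squares
    (k : Type u) [Field k] [NumberField k]
    (h : ∃ x y : k, -1 = x ^ 2 + y ^ 2) :
    ∃ a b : k, a ≠ 0 ∧ b ≠ 0 ∧ ConicNotWittEquivalent k a b 1 1 := by
  obtain ⟨a, b, ha0, hb0, ha, hab⟩ := exists_anisotropic (k := k)
  refine ⟨a, b, ha0, hb0, fun K L _ _ ι ι' hK hL ⟨α, hα⟩ => ?_⟩
  obtain ⟨φ, -⟩ := exists_ratFunc_equiv hL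
  obtain ⟨x, y, hxy⟩ := hK.exists_point
  let := ι.toAlgebra
  exact isEmpty_wittRel_ratFunc ha hab (finOver_conic ha hb0 hK)
    (fun g hg hgk => exists_dyadicWitness_conic ha hb0 hK hg hgk) hxy
    ((WittRel.ofEquiv α hα).symm.congrLeft φ.symm)

end
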